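/- arXiv:1210.6429 — 3 statements merged into one kernel-verified Lean document; each statement's English description precedes it below -/
import Mathlib

section
/- There is an absolute constant C > 0 with the following property: for every positive integer a, every integer m ≥ 2 and every real μ with 1 ≤ μ < log m, there exists T₀ (depending on a, m and μ) such that for every real T ≥ T₀, the number of primes p < T such that ord_p(a+j) ≤ T^{1 − m^{−1/μ}} for every integer j with 0 ≤ j < m and p ∤ (a+j), is at most C·π(T)/μ. -/
open Finset in
theorem sum_moebius_div_of_dvd {k l : ℕ} (hl : l ≠ 0) (hkl : k ∣ l) :
    ∑ d ∈ l.divisors with k ∣ d, (ArithmeticFunction.moebius (l / d) : ℝ)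
      = if l = k then 1 else 0 := by
  obtain ⟨e, rfl⟩ := hkl
  have hk : k ≠ 0 := by rintro rfl; simp at hl
  have he : e ≠ 0 := by rintro rfl; simp at hl
  have h : (k * e).divisors.filter (k ∣ ·) = e.divisors.image (k * ·) := by
    ext d
    simp only [mem_filter, Nat.mem_divisors, mem_image]
    constructor
    · rintro ⟨⟨h1, _⟩, c, rfl⟩
      exact ⟨c, ⟨Nat.dvd_of_mul_dvd_mul_left (Nat.pos_of_ne_zero hk) h1, he⟩, rfl⟩
    · rintro ⟨c, ⟨h1, _⟩, rfl⟩
      exact ⟨⟨Nat.mul_dvd_mul_left k h1, hl⟩, dvd_mul_right _ _⟩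
  rw [h, sum_image (fun a _ b _ hab => Nat.eq_of_mul_eq_mul_left (Nat.pos_of_ne_zero hk) hab)]
  have h2 : ∀ c ∈ e.divisors, (ArithmeticFunction.moebius (k * e / (k * c)) : ℝ)
      = ArithmeticFunction.moebius (e / c) := by
    intro c _
    rw [Nat.mul_div_mul_left _ _ (Nat.pos_of_ne_zero hk)]
  rw [sum_congr rfl h2, Nat.sum_div_divisors e (fun n => (ArithmeticFunction.moebius n : ℝ))]
  have h3 := congrArg (fun f : ArithmeticFunction ℤ => f e)
    ArithmeticFunction.moebius_mul_coe_zeta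
  simp only [ArithmeticFunction.coe_mul_zeta_apply, ArithmeticFunction.one_apply] at h3
  have h4 : (k * e = k) ↔ e = 1 := by
    constructor
    · intro h; exact Nat.eq_of_mul_eq_mul_left (Nat.pos_of_ne_zero hk) (by simpa using h)
    · rintro rfl; simp
  simp only [h4]
  rw [← Int.cast_sum, h3]
  split_ifs <;> simp

open Finset in
/-- Existence of Selberg sieve weights on a divisor-closed set of squarefree numbers. -/
theorem exists_selberg_weights (D : Finset ℕ) (hsq : ∀ d ∈ D, Squarefree d)
    (hdvd : ∀ d ∈ D, ∀ e, e ∣ d → e ∈ D) (hone : 1 ∈ D) :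
    ∃ w : ℕ → ℝ, w 1 = 1 ∧ (∀ d ∈ D, |w d| ≤ d) ∧
      ∑ d ∈ D, ∑ e ∈ D, w d * w e / (Nat.lcm d e : ℝ)
        = 1 / ∑ d ∈ D, 1 / (Nat.totient d : ℝ) := by
  have hne : ∀ d ∈ D, d ≠ 0 := fun d hd => (hsq d hd).ne_zero
  have hphi : ∀ d ∈ D, (0 : ℝ) < Nat.totient d := fun d hd => by
    exact_mod_cast Nat.totient_pos.2 (Nat.pos_of_ne_zero (hne d hd))
  set L : ℝ := ∑ d ∈ D, 1 / (Nat.totient d : ℝ) with hL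
  have hLpos : 0 < L := sum_pos (fun d hd => one_div_pos.2 (hphi d hd)) ⟨1, hone⟩
  set y : ℕ → ℝ := fun k => ArithmeticFunction.moebius k / (Nat.totient k * L) with hy
  set w : ℕ → ℝ := fun d =>
    d * ∑ k ∈ D with d ∣ k, ArithmeticFunction.moebius (k / d) * y k with hw
  have hmu : ∀ d ∈ D, (ArithmeticFunction.moebius d : ℝ) ^ 2 = 1 := fun d hd => by
    exact_mod_cast ArithmeticFunction.moebius_sq_eq_one_of_squarefree (hsq d hd)
  have inv : ∀ k ∈ D, ∑ d ∈ D with k ∣ d, w d / d = y k := by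
    intro k hk
    have e1 : ∀ d ∈ D.filter (k ∣ ·), w d / d
        = ∑ l ∈ D, if d ∣ l then ArithmeticFunction.moebius (l / d) * y l else 0 := by
      intro d hd
      have : (d : ℝ) ≠ 0 := by exact_mod_cast hne d (mem_filter.1 hd).1
      rw [← sum_filter]; simp only [hw]; field_simp
    rw [sum_congr rfl e1, sum_comm]
    have e2 : ∀ l ∈ D, (∑ d ∈ D with k ∣ d,
        if d ∣ l then (ArithmeticFunction.moebius (l / d) : ℝ) * y l else 0)
        = if l = k then y l else 0 := by
      intro l hl
      have e3 : (D.filter (k ∣ ·)).filter (· ∣ l) = l.divisors.filter (k ∣ ·) := by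
        ext d
        simp only [mem_filter, Nat.mem_divisors]
        constructor
        · rintro ⟨⟨_, h2⟩, h3⟩; exact ⟨⟨h3, hne l hl⟩, h2⟩
        · rintro ⟨⟨h3, _⟩, h2⟩; exact ⟨⟨hdvd l hl d h3, h2⟩, h3⟩
      rw [← sum_filter, e3, ← sum_mul]
      by_cases hkl : k ∣ l
      · rw [sum_moebius_div_of_dvd (hne l hl) hkl]; split_ifs <;> simp
      · rw [filter_false_of_mem]
        · have : l ≠ k := by rintro rfl; exact hkl dvd_rfl
          simp [this]
        · intro d hd hkd; exact hkl (hkd.trans (Nat.dvd_of_mem_divisors hd))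
    rw [sum_congr rfl e2]
    simp [hk]
  refine ⟨w, ?_, ?_, ?_⟩
  · simp only [hw, hy]
    simp only [Nat.cast_one, one_mul, one_dvd, filter_true, Nat.div_one]
    have : ∀ k ∈ D, (ArithmeticFunction.moebius k : ℝ)
        * (ArithmeticFunction.moebius k / (Nat.totient k * L)) = 1 / Nat.totient k / L := by
      intro k hk
      rw [← mul_div_assoc, ← sq, hmu k hk, div_div]
    rw [sum_congr rfl this, ← sum_div, div_self hLpos.ne']
  · intro d hd
    simp only [hw]
    rw [abs_mul, Nat.abs_cast]
    refine mul_le_of_le_one_right (Nat.cast_nonneg d) ?_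
    refine (abs_sum_le_sum_abs _ _).trans ?_
    have : ∀ k ∈ D.filter (d ∣ ·), |(ArithmeticFunction.moebius (k / d) : ℝ) * y k|
        ≤ 1 / Nat.totient k / L := by
      intro k hk
      have hk' := (mem_filter.1 hk).1
      have a1 : ∀ n, |(ArithmeticFunction.moebius n : ℝ)| ≤ 1 := fun n => by
        exact_mod_cast ArithmeticFunction.abs_moebius_le_one
      rw [abs_mul, hy]
      simp only
      rw [abs_div, abs_of_pos (mul_pos (hphi k hk') hLpos), div_div]
      have hp := mul_pos (hphi k hk') hLpos
      calc _ ≤ 1 * (1 / (Nat.totient k * L)) := by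
            gcongr
            · exact a1 _
            · exact a1 _
        _ = _ := one_mul _
    refine (sum_le_sum this).trans ?_
    rw [← sum_div, div_le_one hLpos]
    exact sum_le_sum_of_subset_of_nonneg (filter_subset _ _)
      fun k hk _ => (one_div_pos.2 (hphi k hk)).le
  · have e1 : ∀ d ∈ D, ∀ e ∈ D, w d * w e / (Nat.lcm d e : ℝ)
        = ∑ k ∈ D, (Nat.totient k : ℝ) * ((if k ∣ d then w d / d else 0)
          * (if k ∣ e then w e / e else 0)) := by
      intro d hd e he
      have hd0 : (d : ℝ) ≠ 0 := by exact_mod_cast hne d hd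
      have he0 : (e : ℝ) ≠ 0 := by exact_mod_cast hne e he
      have hg : ((Nat.gcd d e : ℕ) : ℝ) =
          ∑ k ∈ D, if k ∣ d ∧ k ∣ e then (Nat.totient k : ℝ) else 0 := by
        rw [← sum_filter]
        nth_rw 1 [← Nat.sum_totient (Nat.gcd d e)]
        rw [Nat.cast_sum]
        apply sum_congr _ fun _ _ => rfl
        ext k
        simp only [Nat.mem_divisors, mem_filter, Nat.dvd_gcd_iff]
        constructor
        · rintro ⟨h, _⟩; exact ⟨hdvd d hd k h.1, h⟩
        · rintro ⟨_, h⟩; exact ⟨h, Nat.gcd_ne_zero_left (hne d hd)⟩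
      have hlcm : (Nat.gcd d e : ℝ) * (Nat.lcm d e : ℝ) = d * e := by
        exact_mod_cast Nat.gcd_mul_lcm d e
      have hl0 : (Nat.lcm d e : ℝ) ≠ 0 := by
        exact_mod_cast Nat.lcm_ne_zero (hne d hd) (hne e he)
      have : w d * w e / (Nat.lcm d e : ℝ) = (Nat.gcd d e : ℝ) * (w d / d * (w e / e)) := by
        field_simp
        linear_combination (-w d * w e) * hlcm
      rw [this, hg, sum_mul]
      refine sum_congr rfl fun k _ => ?_
      by_cases h1 : k ∣ d <;> by_cases h2 : k ∣ e <;> simp [h1, h2]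
    have e2 : ∑ d ∈ D, ∑ e ∈ D, w d * w e / (Nat.lcm d e : ℝ)
        = ∑ k ∈ D, (Nat.totient k : ℝ) * (y k * y k) := by
      rw [sum_congr rfl fun d hd => sum_congr rfl fun e he => e1 d hd e he]
      rw [sum_congr rfl fun d _ => sum_comm]
      rw [sum_comm]
      refine sum_congr rfl fun k hk => ?_
      rw [← inv k hk, sum_filter, sum_mul_sum, mul_sum]
      refine sum_congr rfl fun d _ => ?_
      rw [mul_sum]
    rw [e2]
    have e3 : ∀ k ∈ D, (Nat.totient k : ℝ) * (y k * y k) = 1 / Nat.totient k / L ^ 2 := by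
      intro k hk
      have h1 := (hphi k hk).ne'
      have h2 := hLpos.ne'
      have h3 := hmu k hk
      simp only [hy]
      field_simp
      rw [h3]
    rw [sum_congr rfl e3, ← sum_div, ← hL]
    field_simp

open Finset in
/-- The upper bound of the Selberg sieve. -/
theorem card_filter_le_of_selberg (D : Finset ℕ) (hsq : ∀ d ∈ D, Squarefree d)
    (hdvd : ∀ d ∈ D, ∀ e, e ∣ d → e ∈ D) (hone : 1 ∈ D) (s : Finset ℕ) (f : ℕ → ℕ) (X : ℝ)
    (hX : ∀ d ∈ D, ∀ e ∈ D,
      |(#{n ∈ s | Nat.lcm d e ∣ f n} : ℝ) - X / (Nat.lcm d e : ℝ)| ≤ 1) :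
    (#{n ∈ s | ∀ d ∈ D, d ∣ f n → d = 1} : ℝ)
      ≤ X / (∑ d ∈ D, 1 / (Nat.totient d : ℝ)) + (∑ d ∈ D, (d : ℝ)) ^ 2 := by
  obtain ⟨w, w1, wle, wsum⟩ := exists_selberg_weights D hsq hdvd hone
  have key : (#{n ∈ s | ∀ d ∈ D, d ∣ f n → d = 1} : ℝ)
      ≤ ∑ n ∈ s, (∑ d ∈ D with d ∣ f n, w d) ^ 2 := by
    rw [card_filter, Nat.cast_sum]
    refine sum_le_sum fun n _ => ?_
    split_ifs with h
    · have : D.filter (· ∣ f n) = {1} := by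
        ext d
        simp only [mem_filter, mem_singleton]
        constructor
        · rintro ⟨h1, h2⟩; exact h d h1 h2
        · rintro rfl; exact ⟨hone, one_dvd _⟩
      rw [this]; simp [w1]
    · simp only [Nat.cast_zero]; positivity
  refine key.trans ?_
  have e1 : ∑ n ∈ s, (∑ d ∈ D with d ∣ f n, w d) ^ 2
      = ∑ d ∈ D, ∑ e ∈ D, w d * w e * (#{n ∈ s | Nat.lcm d e ∣ f n} : ℝ) := by
    have : ∀ n ∈ s, (∑ d ∈ D with d ∣ f n, w d) ^ 2
        = ∑ d ∈ D, ∑ e ∈ D, if Nat.lcm d e ∣ f n then w d * w e else 0 := by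
      intro n _
      rw [sq, sum_filter, sum_mul_sum]
      refine sum_congr rfl fun d _ => sum_congr rfl fun e _ => ?_
      by_cases h1 : d ∣ f n <;> by_cases h2 : e ∣ f n <;> simp [h1, h2, Nat.lcm_dvd_iff]
    rw [sum_congr rfl this, sum_comm]
    refine sum_congr rfl fun d _ => ?_
    rw [sum_comm]
    refine sum_congr rfl fun e _ => ?_
    rw [← sum_filter, sum_const, nsmul_eq_mul, mul_comm]
  rw [e1]
  have e2 : ∑ d ∈ D, ∑ e ∈ D, w d * w e * (#{n ∈ s | Nat.lcm d e ∣ f n} : ℝ)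
      ≤ ∑ d ∈ D, ∑ e ∈ D, (X * (w d * w e / (Nat.lcm d e : ℝ)) + d * e) := by
    refine sum_le_sum fun d hd => sum_le_sum fun e he => ?_
    have h1 : w d * w e * ((#{n ∈ s | Nat.lcm d e ∣ f n} : ℝ) - X / (Nat.lcm d e : ℝ))
        ≤ d * e := by
      refine (le_abs_self _).trans ?_
      rw [abs_mul, abs_mul]
      have := wle d hd
      have := wle e he
      have := hX d hd e he
      calc _ ≤ (d : ℝ) * e * 1 := by gcongr
        _ = _ := mul_one _
    have h2 : X * (w d * w e / (Nat.lcm d e : ℝ)) = w d * w e * (X / (Nat.lcm d e : ℝ)) := by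
      ring
    rw [h2]; linarith
  refine e2.trans (le_of_eq ?_)
  simp only [sum_add_distrib, ← mul_sum]
  rw [wsum, sq, sum_mul]
  ring

open Finset in
theorem sum_one_div_sq_le_two (n : ℕ) : ∑ i ∈ Icc 1 n, 1 / (i : ℝ) ^ 2 ≤ 2 := by
  have h := sum_Ioo_inv_sq_le (α := ℝ) 0 (n + 1)
  have e : Ioo 0 (n + 1) = Icc 1 n := by ext; simp; omega
  simpa [e] using h

open Finset in
theorem log_le_sum_one_div_totient (q R : ℕ) (hq : q.Prime) :
    Real.log (R + 1) / 4 ≤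
      ∑ d ∈ Icc 1 R with Squarefree d ∧ Nat.Coprime d q, 1 / (Nat.totient d : ℝ) := by
  set D := (Icc 1 R).filter (fun d => Squarefree d ∧ Nat.Coprime d q) with hD
  have h1 : Real.log (R + 1) ≤ ∑ i ∈ Icc 1 R, 1 / (i : ℝ) := by
    have h := log_add_one_le_harmonic R
    rw [harmonic_eq_sum_Icc] at h
    push_cast at h
    simpa [one_div] using h
  have h2 : ∑ i ∈ Icc 1 R with q ∣ i, 1 / (i : ℝ) ≤ (1 / 2) * ∑ i ∈ Icc 1 R, 1 / (i : ℝ) := by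
    have hsub : (Icc 1 R).filter (q ∣ ·) ⊆ (Icc 1 R).image (q * ·) := by
      intro i hi
      obtain ⟨hi, c, rfl⟩ := mem_filter.1 hi
      rw [mem_Icc] at hi
      refine mem_image.2 ⟨c, mem_Icc.2 ⟨?_, ?_⟩, rfl⟩
      · rcases Nat.eq_zero_or_pos c with rfl | h
        · simp at hi
        · exact h
      · exact (Nat.le_mul_of_pos_left c hq.pos).trans hi.2
    refine (sum_le_sum_of_subset_of_nonneg hsub fun _ _ _ => by positivity).trans ?_
    rw [sum_image fun a _ b _ h => Nat.eq_of_mul_eq_mul_left hq.pos h, mul_sum]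
    refine sum_le_sum fun i _ => ?_
    push_cast
    rw [one_div_mul_one_div]
    rcases Nat.eq_zero_or_pos i with rfl | h
    · simp
    · have : (2 : ℝ) ≤ q := by exact_mod_cast hq.two_le
      gcongr
  have h3 : ∑ i ∈ Icc 1 R with ¬ q ∣ i, 1 / (i : ℝ)
      ≤ (∑ d ∈ D, 1 / (d : ℝ)) * ∑ i ∈ Icc 1 R, 1 / (i : ℝ) ^ 2 := by
    have hsub : (Icc 1 R).filter (fun i => ¬ q ∣ i)
        ⊆ (D ×ˢ Icc 1 R).image (fun x => x.1 * x.2 ^ 2) := by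
      intro i hi
      obtain ⟨hi, hqi⟩ := mem_filter.1 hi
      rw [mem_Icc] at hi
      obtain ⟨k, b, hkb, hk⟩ := Nat.sq_mul_squarefree i
      have hb : 0 < b := by
        rcases Nat.eq_zero_or_pos b with rfl | h
        · simp at hkb; omega
        · exact h
      have hk0 : 0 < k := Nat.pos_of_ne_zero hk.ne_zero
      have hki : k ≤ i := hkb ▸ Nat.le_mul_of_pos_left k (by positivity)
      have hbi : b ≤ i := by
        calc b ≤ b ^ 2 := Nat.le_self_pow (by norm_num) b
          _ ≤ b ^ 2 * k := Nat.le_mul_of_pos_right _ hk0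
          _ = i := hkb
      refine mem_image.2 ⟨(k, b), mem_product.2 ⟨?_, mem_Icc.2 ⟨hb, by omega⟩⟩, ?_⟩
      · refine mem_filter.2 ⟨mem_Icc.2 ⟨hk0, by omega⟩, hk, ?_⟩
        rw [Nat.coprime_comm, hq.coprime_iff_not_dvd]
        intro h; exact hqi (hkb ▸ h.mul_left _)
      · rw [← hkb, mul_comm]
    calc _ ≤ ∑ i ∈ (D ×ˢ Icc 1 R).image (fun x : ℕ × ℕ => x.1 * x.2 ^ 2), 1 / (i : ℝ) :=
          sum_le_sum_of_subset_of_nonneg hsub fun _ _ _ => by positivity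
      _ ≤ ∑ x ∈ D ×ˢ Icc 1 R, 1 / ((x.1 * x.2 ^ 2 : ℕ) : ℝ) :=
          sum_image_le_of_nonneg fun _ _ => by positivity
      _ = _ := by
          rw [sum_product, sum_mul_sum]
          refine sum_congr rfl fun i _ => sum_congr rfl fun j _ => ?_
          push_cast
          rw [one_div_mul_one_div]
  have h4 := sum_one_div_sq_le_two R
  have h5 : ∑ d ∈ D, 1 / (d : ℝ) ≤ ∑ d ∈ D, 1 / (Nat.totient d : ℝ) := by
    refine sum_le_sum fun d hd => ?_
    have hd1 : 0 < d := (mem_Icc.1 (mem_filter.1 hd).1).1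
    have := Nat.totient_pos.2 hd1
    have := Nat.totient_le d
    gcongr
  have h6 := sum_filter_add_sum_filter_not (Icc 1 R) (q ∣ ·) (fun i => 1 / (i : ℝ))
  have h7 : (0 : ℝ) ≤ ∑ d ∈ D, 1 / (d : ℝ) := sum_nonneg fun _ _ => by positivity
  have h9 : (∑ d ∈ D, 1 / (d : ℝ)) * ∑ i ∈ Icc 1 R, 1 / (i : ℝ) ^ 2
      ≤ (∑ d ∈ D, 1 / (d : ℝ)) * 2 := mul_le_mul_of_nonneg_left h4 h7
  linarith

open Finset in
theorem abs_card_dvd_mul_add_one_sub_le (q d N : ℕ) (hd : 0 < d) (hqd : Nat.Coprime d q) :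
    |(#{n ∈ Ioc 0 N | d ∣ q * n + 1} : ℝ) - N / (d : ℝ)| ≤ 1 := by
  obtain ⟨v, hv⟩ : ∃ v : ℕ, d ∣ q * v + 1 := by
    obtain ⟨c, hc⟩ := (Nat.isCoprime_iff_coprime.2 hqd)
    obtain ⟨b, hb⟩ := hc
    refine ⟨(-b % d).toNat, ?_⟩
    have h0 : 0 ≤ -b % (d : ℤ) := Int.emod_nonneg _ (by exact_mod_cast hd.ne')
    zify
    rw [Int.toNat_of_nonneg h0]
    have h1 : (d : ℤ) ∣ -b % d - -b := by
      exact (Int.emod_emod_of_dvd (-b) dvd_rfl |> fun h => Int.ModEq.dvd (Int.ModEq.symm h))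
    have : (q : ℤ) * (-b % d) + 1 = q * (-b % d - -b) + c * d := by linear_combination -hb
    rw [this]
    exact dvd_add (h1.mul_left _) (Dvd.intro_left c rfl)
  have hfil : (Ioc 0 N).filter (fun n => d ∣ q * n + 1) =
      (Ioc 0 N).filter (fun n => n ≡ v [MOD d]) := by
    refine filter_congr fun n _ => ?_
    constructor
    · intro h
      have h1 : q * n + 1 ≡ q * v + 1 [MOD d] :=
        ((Nat.modEq_zero_iff_dvd.2 h).trans (Nat.modEq_zero_iff_dvd.2 hv).symm)
      exact Nat.ModEq.cancel_left_of_coprime hqd (Nat.ModEq.add_right_cancel' 1 h1)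
    · intro h
      have h1 : q * n + 1 ≡ q * v + 1 [MOD d] := (h.mul_left q).add_right 1
      exact Nat.modEq_zero_iff_dvd.1 (h1.trans (Nat.modEq_zero_iff_dvd.2 hv))
  rw [hfil]
  have h := Nat.Ioc_filter_modEq_card 0 N hd v
  have hdQ : (0 : ℚ) < d := by exact_mod_cast hd
  have hle : ⌊((0 : ℕ) - v : ℚ) / d⌋ ≤ ⌊((N : ℚ) - v) / d⌋ := by
    apply Int.floor_le_floor; gcongr; simp
  rw [max_eq_left (by linarith)] at h
  have f1 := Int.floor_le (((0 : ℕ) - v : ℚ) / d)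
  have f2 := Int.lt_floor_add_one (((0 : ℕ) - v : ℚ) / d)
  have f3 := Int.floor_le (((N : ℕ) - v : ℚ) / d)
  have f4 := Int.lt_floor_add_one (((N : ℕ) - v : ℚ) / d)
  have hQ : (#{n ∈ Ioc 0 N | n ≡ v [MOD d]} : ℚ)
      = (⌊((N : ℚ) - v) / d⌋ : ℚ) - (⌊((0 : ℕ) - v : ℚ) / d⌋ : ℚ) := by
    exact_mod_cast h
  have h5 : ((N : ℕ) - v : ℚ) / d - ((0 : ℕ) - v : ℚ) / d = N / d := by
    rw [← sub_div]; congr 1; push_cast; ring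
  have h6 : |(#{n ∈ Ioc 0 N | n ≡ v [MOD d]} : ℚ) - N / d| ≤ 1 := by
    rw [abs_le]; constructor <;> linarith
  have h7 := (Rat.cast_le (K := ℝ)).2 h6
  push_cast at h7
  exact h7

open Finset in
theorem card_primes_le_selberg (q N R : ℕ) (hq : q.Prime) (hR : 0 < R) :
    (#{n ∈ Ioc 0 N | (q * n + 1).Prime} : ℝ)
      ≤ N / (∑ d ∈ Icc 1 R with Squarefree d ∧ Nat.Coprime d q, 1 / (Nat.totient d : ℝ))
        + R ^ 4 + R := by
  set D := (Icc 1 R).filter (fun d => Squarefree d ∧ Nat.Coprime d q) with hD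
  have h := card_filter_le_of_selberg D (fun d hd => (mem_filter.1 hd).2.1)
    (fun d hd e he => by
      obtain ⟨h1, h2, h3⟩ := mem_filter.1 hd
      rw [mem_Icc] at h1
      exact mem_filter.2 ⟨mem_Icc.2 ⟨Nat.pos_of_dvd_of_pos he h1.1,
        (Nat.le_of_dvd h1.1 he).trans h1.2⟩,
        h2.squarefree_of_dvd he, h3.coprime_dvd_left he⟩)
    (mem_filter.2 ⟨mem_Icc.2 ⟨le_rfl, hR⟩, squarefree_one, Nat.coprime_one_left q⟩)
    (Ioc 0 N) (fun n => q * n + 1) N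
    (fun d hd e he => by
      obtain ⟨h1, h2, h3⟩ := mem_filter.1 hd
      obtain ⟨k1, k2, k3⟩ := mem_filter.1 he
      rw [mem_Icc] at h1 k1
      exact abs_card_dvd_mul_add_one_sub_le q _ N (Nat.lcm_pos h1.1 k1.1)
        (Nat.Coprime.coprime_dvd_left (Nat.lcm_dvd_mul d e) (h3.mul_left k3)))
  have hsum : (∑ d ∈ D, (d : ℝ)) ^ 2 ≤ R ^ 4 := by
    have : ∑ d ∈ D, (d : ℝ) ≤ R * R := by
      calc _ ≤ ∑ d ∈ Icc 1 R, (d : ℝ) :=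
            sum_le_sum_of_subset_of_nonneg (filter_subset _ _) fun _ _ _ => by positivity
        _ ≤ ∑ d ∈ Icc 1 R, (R : ℝ) := sum_le_sum fun d hd => by
            exact_mod_cast (mem_Icc.1 hd).2
        _ = _ := by simp
    have h0 : (0 : ℝ) ≤ ∑ d ∈ D, (d : ℝ) := sum_nonneg fun _ _ => by positivity
    calc _ ≤ ((R : ℝ) * R) ^ 2 := by gcongr
      _ = _ := by ring
  have hsub : (Ioc 0 N).filter (fun n => (q * n + 1).Prime) ⊆
      (Ioc 0 N).filter (fun n => ∀ d ∈ D, d ∣ q * n + 1 → d = 1) ∪ Ioc 0 R := by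
    intro n hn
    obtain ⟨hn, hp⟩ := mem_filter.1 hn
    rw [mem_union]
    by_cases hnR : n ≤ R
    · right; rw [mem_Ioc] at *; omega
    · left
      refine mem_filter.2 ⟨hn, fun d hd hdv => ?_⟩
      rcases (Nat.dvd_prime hp).1 hdv with h | h
      · exact h
      · have := (mem_Icc.1 (mem_filter.1 hd).1).2
        have := Nat.le_mul_of_pos_left n hq.pos
        omega
  have hc : (#{n ∈ Ioc 0 N | (q * n + 1).Prime} : ℝ) ≤
      #{n ∈ Ioc 0 N | ∀ d ∈ D, d ∣ q * n + 1 → d = 1} + R := by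
    have := (card_le_card hsub).trans (card_union_le _ _)
    rw [Nat.card_Ioc, Nat.sub_zero] at this
    exact_mod_cast this
  linarith

theorem log_le_two_mul_sqrt {x : ℝ} (hx : 0 < x) : Real.log x ≤ 2 * √x := by
  have h := Real.log_le_sub_one_of_pos (Real.sqrt_pos.2 hx)
  rw [Real.log_sqrt hx.le] at h
  linarith

open Finset in
/-- A Brun–Titchmarsh bound for primes congruent to `1` modulo a small prime. -/
theorem card_primes_modEq_one_le (q x : ℕ) (hq : q.Prime) (hqx : q ^ 2 ≤ x) (hx : 9 ≤ x) :
    (#{p ∈ range (x + 1) | p.Prime ∧ q ∣ p - 1} : ℝ) ≤ 144 * (x / q) / Real.log x := by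
  set N := x / q with hN
  have hN3 : 3 ≤ N := by
    rw [hN, Nat.le_div_iff_mul_le hq.pos]
    by_contra h
    have : 4 ≤ q := by omega
    nlinarith
  have hxN : x < (N + 1) ^ 2 := by
    have h1 : x < q * (N + 1) := by
      rw [hN]; exact Nat.lt_mul_div_succ x hq.pos
    have h2 : q ≤ N := by rw [hN, Nat.le_div_iff_mul_le hq.pos]; nlinarith
    nlinarith
  have hN3' : (3 : ℝ) ≤ N := by exact_mod_cast hN3
  have hNpos : (0 : ℝ) < N := by linarith
  have hlogN : 0 < Real.log N := Real.log_pos (by linarith)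
  have hlogx : 0 < Real.log x := Real.log_pos (by
    have : (9 : ℝ) ≤ x := by exact_mod_cast hx
    linarith)
  have hlog : Real.log x ≤ 4 * Real.log N := by
    have : (x : ℝ) ≤ (N : ℝ) ^ 4 := by
      have h1 : x ≤ N ^ 4 := by nlinarith [sq_nonneg (N : ℤ), Nat.mul_le_mul hN3 hN3]
      exact_mod_cast h1
    calc Real.log x ≤ Real.log ((N : ℝ) ^ 4) := Real.log_le_log (by
            have : 0 < x := by omega
            exact_mod_cast this) this
      _ = _ := by rw [Real.log_pow]; norm_num
  set R := ⌊(N : ℝ) ^ (1 / 8 : ℝ)⌋₊ with hR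
  have hR0 : 0 < R := Nat.floor_pos.2 (Real.one_le_rpow (by linarith) (by norm_num))
  have hRle : (R : ℝ) ≤ (N : ℝ) ^ (1 / 8 : ℝ) := Nat.floor_le (by positivity)
  have hR4 : (R : ℝ) ^ 4 ≤ √N := by
    calc (R : ℝ) ^ 4 ≤ ((N : ℝ) ^ (1 / 8 : ℝ)) ^ 4 := by gcongr
      _ = √N := by
        rw [← Real.rpow_natCast, ← Real.rpow_mul hNpos.le, Real.sqrt_eq_rpow]; norm_num
  have hRs : (R : ℝ) ≤ √N := by
    refine le_trans ?_ hR4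
    exact_mod_cast Nat.le_self_pow (by norm_num) R
  have hRlog : Real.log N / 8 ≤ Real.log (R + 1) := by
    have : Real.log ((N : ℝ) ^ (1 / 8 : ℝ)) ≤ Real.log (R + 1) :=
      Real.log_le_log (by positivity) (Nat.lt_floor_add_one _).le
    rw [Real.log_rpow hNpos] at this
    linarith
  have hL := log_le_sum_one_div_totient q R hq
  have hS := card_primes_le_selberg q N R hq hR0
  set L := ∑ d ∈ Icc 1 R with Squarefree d ∧ Nat.Coprime d q, 1 / (Nat.totient d : ℝ)
  have hcard : #{p ∈ range (x + 1) | p.Prime ∧ q ∣ p - 1}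
      ≤ #{n ∈ Ioc 0 N | (q * n + 1).Prime} := by
    refine card_le_card_of_surjOn (fun n => q * n + 1) ?_
    intro p hp
    obtain ⟨h1, h2, c, hc⟩ := mem_filter.1 (mem_coe.1 hp)
    rw [mem_range] at h1
    have hp2 := h2.two_le
    have hpc : p = q * c + 1 := by omega
    have hc0 : 0 < c := by
      rcases Nat.eq_zero_or_pos c with rfl | h
      · simp at hc; omega
      · exact h
    refine ⟨c, mem_coe.2 (mem_filter.2 ⟨mem_Ioc.2 ⟨hc0, ?_⟩, hpc ▸ h2⟩), hpc.symm⟩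
    rw [hN, Nat.le_div_iff_mul_le hq.pos, mul_comm]
    omega
  have h1 : (N : ℝ) / L ≤ 32 * (N / Real.log N) := by
    calc (N : ℝ) / L ≤ N / (Real.log N / 32) := by
          gcongr; linarith
      _ = _ := by field_simp
  have h2 : √(N : ℝ) ≤ 2 * (N / Real.log N) := by
    rw [← mul_div_assoc, le_div_iff₀ hlogN]
    have h3 := log_le_two_mul_sqrt hNpos
    have h4 := Real.mul_self_sqrt hNpos.le
    nlinarith [Real.sqrt_nonneg (N : ℝ)]
  have h3 : (N : ℝ) / Real.log N ≤ 4 * ((x / q) / Real.log x) := by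
    have h4 : (N : ℝ) ≤ x / q := Nat.cast_div_le
    rw [← mul_div_assoc, div_le_div_iff₀ hlogN hlogx]
    nlinarith
  have h5 : (#{p ∈ range (x + 1) | p.Prime ∧ q ∣ p - 1} : ℝ)
      ≤ #{n ∈ Ioc 0 N | (q * n + 1).Prime} := by exact_mod_cast hcard
  rw [mul_div_assoc]
  linarith

open Finset in
theorem sum_log_primeFactors_le_log {n : ℕ} (hn : n ≠ 0) :
    ∑ q ∈ n.primeFactors, Real.log q ≤ Real.log n := by
  rw [← Real.log_prod fun q hq => by exact_mod_cast (Nat.prime_of_mem_primeFactors hq).ne_zero]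
  have h := Nat.le_of_dvd (Nat.pos_of_ne_zero hn) (Nat.prod_primeFactors_dvd n)
  rw [← Nat.cast_prod]
  refine Real.log_le_log ?_ (Nat.cast_le.2 h)
  exact Nat.cast_pos.2 (prod_pos fun q hq => (Nat.prime_of_mem_primeFactors hq).pos)

open Finset in
theorem sum_log_div_prime_le (N : ℕ) (hN : 0 < N) :
    ∑ q ∈ Ioc 0 N with q.Prime, Real.log q / q ≤ Real.log N + Real.log 4 := by
  have hN' : (0 : ℝ) < N := by exact_mod_cast hN
  have h1 : ∑ n ∈ Ioc 0 N, ∑ q ∈ Ioc 0 N with q.Prime, (if q ∣ n then Real.log q else 0)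
      ≤ N * Real.log N := by
    calc _ ≤ ∑ n ∈ Ioc 0 N, Real.log N := by
          refine sum_le_sum fun n hn => ?_
          rw [mem_Ioc] at hn
          rw [← sum_filter]
          have e : ((Ioc 0 N).filter Nat.Prime).filter (· ∣ n) = n.primeFactors := by
            ext q
            simp only [mem_filter, mem_Ioc, Nat.mem_primeFactors]
            constructor
            · rintro ⟨⟨_, h⟩, h2⟩; exact ⟨h, h2, by omega⟩
            · rintro ⟨h, h2, _⟩; exact ⟨⟨⟨h.pos, (Nat.le_of_dvd hn.1 h2).trans hn.2⟩, h⟩, h2⟩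
          rw [e]
          refine (sum_log_primeFactors_le_log (by omega)).trans ?_
          exact Real.log_le_log (by exact_mod_cast hn.1) (by exact_mod_cast hn.2)
      _ = _ := by simp
  rw [sum_comm] at h1
  have h2 : ∀ q ∈ (Ioc 0 N).filter Nat.Prime, (N : ℝ) * (Real.log q / q) - Real.log q
      ≤ ∑ n ∈ Ioc 0 N, (if q ∣ n then Real.log q else 0) := by
    intro q hq
    have hqp := (mem_filter.1 hq).2
    rw [← sum_filter, sum_const, nsmul_eq_mul, Nat.Ioc_filter_dvd_card_eq_div]
    have h3 : (N : ℝ) / q - 1 ≤ (N / q : ℕ) := by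
      have := Nat.lt_floor_add_one ((N : ℝ) / q)
      rw [Nat.floor_div_eq_div] at this
      linarith
    have h4 : 0 ≤ Real.log q := Real.log_natCast_nonneg q
    calc _ = ((N : ℝ) / q - 1) * Real.log q := by ring
      _ ≤ _ := by gcongr
  have h3 := (sum_le_sum h2).trans h1
  rw [sum_sub_distrib, ← mul_sum] at h3
  have h4 := Chebyshev.theta_le_log4_mul_x (x := N) hN'.le
  rw [Chebyshev.theta, Nat.floor_natCast] at h4
  have h5 : (N : ℝ) * ∑ q ∈ Ioc 0 N with q.Prime, Real.log q / q
      ≤ N * (Real.log N + Real.log 4) := by linarith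
  exact le_of_mul_le_mul_left h5 hN'

open Finset in
theorem sum_primes_sum_log_primeFactors_le (x y : ℕ) (hx : 9 ≤ x) (hy : 0 < y)
    (hyx : y ^ 2 ≤ x) :
    ∑ p ∈ range (x + 1) with p.Prime, ∑ q ∈ (p - 1).primeFactors with q ≤ y, Real.log q
      ≤ 144 * x / Real.log x * (Real.log y + Real.log 4) := by
  have hlogx : 0 < Real.log x := Real.log_pos (by exact_mod_cast (by omega : 1 < x))
  have e : ∀ p ∈ (range (x + 1)).filter Nat.Prime,
      ∑ q ∈ (p - 1).primeFactors with q ≤ y, Real.log q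
      = ∑ q ∈ Ioc 0 y with q.Prime, if q ∣ p - 1 then Real.log q else 0 := by
    intro p hp
    have hp2 := (mem_filter.1 hp).2.two_le
    rw [← sum_filter]
    refine sum_congr ?_ fun _ _ => rfl
    ext q
    simp only [mem_filter, mem_Ioc, Nat.mem_primeFactors]
    constructor
    · rintro ⟨⟨h1, h2, _⟩, h3⟩; exact ⟨⟨⟨h1.pos, h3⟩, h1⟩, h2⟩
    · rintro ⟨⟨⟨_, h3⟩, h1⟩, h2⟩; exact ⟨⟨h1, h2, by omega⟩, h3⟩
  rw [sum_congr rfl e, sum_comm]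
  calc _ ≤ ∑ q ∈ Ioc 0 y with q.Prime, 144 * x / Real.log x * (Real.log q / q) := by
        refine sum_le_sum fun q hq => ?_
        obtain ⟨h1, h2⟩ := mem_filter.1 hq
        rw [mem_Ioc] at h1
        rw [← sum_filter, sum_const, nsmul_eq_mul, filter_filter]
        have h3 := card_primes_modEq_one_le q x h2
          ((Nat.pow_le_pow_left h1.2 2).trans hyx) hx
        calc _ ≤ 144 * (x / q) / Real.log x * Real.log q := by
              gcongr
          _ = _ := by ring
    _ ≤ _ := by
        rw [← mul_sum]
        have := sum_log_div_prime_le y hy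
        gcongr

open Finset in
/-- Few primes `p ≤ x` have a large contribution of primes `q ≤ y` to `log (p - 1)`. -/
theorem card_primes_smooth_part_le (x y : ℕ) (hx : 9 ≤ x) (hy : 0 < y) (hyx : y ^ 2 ≤ x)
    (H : ℝ) (hH : 0 < H) :
    (#{p ∈ range (x + 1) | p.Prime ∧
      H ≤ ∑ q ∈ (p - 1).primeFactors with q ≤ y, Real.log q} : ℝ)
      ≤ 144 * x / Real.log x * (Real.log y + Real.log 4) / H := by
  rw [le_div_iff₀ hH]
  refine le_trans ?_ (sum_primes_sum_log_primeFactors_le x y hx hy hyx)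
  rw [← filter_filter, ← nsmul_eq_mul]
  refine le_trans (card_nsmul_le_sum _ (fun p => ∑ q ∈ (p - 1).primeFactors with q ≤ y, Real.log q)
    H fun p hp => (mem_filter.1 hp).2) ?_
  exact sum_le_sum_of_subset_of_nonneg (filter_subset _ _)
    fun _ _ _ => sum_nonneg fun q _ => Real.log_natCast_nonneg q

open Finset Classical in
theorem card_square_dvd_pred_le (x D : ℕ) :
    (#{p ∈ range (x + 1) | 2 ≤ p ∧ ∃ d, D < d ∧ d ^ 2 ∣ p - 1} : ℝ) ≤ 2 * x / (D + 1) := by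
  have hsub : (range (x + 1)).filter (fun p => 2 ≤ p ∧ ∃ d, D < d ∧ d ^ 2 ∣ p - 1) ⊆
      (Ioo D (x + 1)).biUnion fun d => ((Ioc 0 x).filter (d ^ 2 ∣ ·)).image (· + 1) := by
    intro p hp
    obtain ⟨h1, h2, d, h3, h4⟩ := mem_filter.1 hp
    rw [mem_range] at h1
    have h5 := Nat.le_of_dvd (by omega) h4
    have h6 := Nat.le_self_pow (two_ne_zero) d
    refine mem_biUnion.2 ⟨d, mem_Ioo.2 ⟨h3, by omega⟩, mem_image.2 ⟨p - 1, mem_filter.2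
      ⟨mem_Ioc.2 ⟨by omega, by omega⟩, h4⟩, by omega⟩⟩
  have h1 : (#{p ∈ range (x + 1) | 2 ≤ p ∧ ∃ d, D < d ∧ d ^ 2 ∣ p - 1} : ℝ)
      ≤ ∑ d ∈ Ioo D (x + 1), (x : ℝ) * ((d : ℝ) ^ 2)⁻¹ := by
    have h2 := (card_le_card hsub).trans card_biUnion_le
    refine (Nat.cast_le.2 h2).trans ?_
    rw [Nat.cast_sum]
    refine sum_le_sum fun d _ => ?_
    refine (Nat.cast_le.2 card_image_le).trans ?_
    rw [Nat.Ioc_filter_dvd_card_eq_div]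
    refine Nat.cast_div_le.trans (le_of_eq ?_)
    push_cast; rw [div_eq_mul_inv]
  refine h1.trans ?_
  rw [← mul_sum]
  have := sum_Ioo_inv_sq_le (α := ℝ) D (x + 1)
  calc _ ≤ (x : ℝ) * (2 / (D + 1)) := by gcongr
    _ = _ := by ring

open Finset in
/-- If every prime factor of `i` is at most `y` and `i` divides `d ^ 2 * k` with `k` squarefree,
then `i` is bounded by the primes up to `y` of `d ^ 2 * k` and by `d`. -/
theorem log_le_sum_log_primeFactors_add {n i d k y : ℕ} (hn : n ≠ 0) (hdk : d ^ 2 * k = n)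
    (hk : Squarefree k) (hi : i ∣ n) (hy : ∀ q, q.Prime → q ∣ i → q ≤ y) :
    Real.log i ≤ ∑ q ∈ n.primeFactors with q ≤ y, Real.log q + 2 * Real.log d := by
  have hd0 : d ≠ 0 := by rintro rfl; simp at hdk; exact hn hdk.symm
  have hi0 : i ≠ 0 := fun h => hn (by simpa [h] using hi)
  set g := Nat.gcd i k with hg
  have hg0 : g ≠ 0 := Nat.gcd_ne_zero_left hi0
  have hgsq : Squarefree g := hk.squarefree_of_dvd (Nat.gcd_dvd_right i k)
  have h1 : i ∣ d ^ 2 * g := by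
    have : i ∣ Nat.gcd (d ^ 2 * i) (d ^ 2 * k) :=
      Nat.dvd_gcd (dvd_mul_left _ _) (hdk ▸ hi)
    rwa [Nat.gcd_mul_left] at this
  have h2 : i ≤ d ^ 2 * g := Nat.le_of_dvd (by positivity) h1
  have h3 : Real.log i ≤ 2 * Real.log d + Real.log g := by
    have h4 : Real.log i ≤ Real.log ((d : ℝ) ^ 2 * g) :=
      Real.log_le_log (by positivity) (by exact_mod_cast h2)
    rwa [Real.log_mul (by positivity) (by positivity), Real.log_pow] at h4
  have h4 : Real.log g ≤ ∑ q ∈ n.primeFactors with q ≤ y, Real.log q := by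
    have h5 : Real.log g = ∑ q ∈ g.primeFactors, Real.log q := by
      rw [← Real.log_prod fun q hq => by exact_mod_cast (Nat.prime_of_mem_primeFactors hq).ne_zero]
      rw [← Nat.cast_prod, Nat.prod_primeFactors_of_squarefree hgsq]
    rw [h5]
    refine sum_le_sum_of_subset_of_nonneg ?_ fun q _ _ => Real.log_natCast_nonneg q
    intro q hq
    obtain ⟨q1, q2, _⟩ := Nat.mem_primeFactors.1 hq
    have q3 : q ∣ i := q2.trans (Nat.gcd_dvd_left i k)
    exact mem_filter.2 ⟨Nat.mem_primeFactors.2 ⟨q1, q3.trans hi, hn⟩, hy q q1 q3⟩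
  linarith

/-- Every element of `S` has a prime factor dividing no other element of `S`. -/
def HasPrivatePrimes (S : Finset ℕ) : Prop :=
  ∀ b ∈ S, ∃ r : ℕ, r.Prime ∧ r ∣ b ∧ ∀ c ∈ S, c ≠ b → ¬ r ∣ c

theorem HasPrivatePrimes.mono {S S' : Finset ℕ} (h : HasPrivatePrimes S) (hS : S' ⊆ S) :
    HasPrivatePrimes S' := fun b hb => by
  obtain ⟨r, h1, h2, h3⟩ := h b (hS hb)
  exact ⟨r, h1, h2, fun c hc => h3 c (hS hc)⟩

open Finset in
theorem HasPrivatePrimes.prod_pow_ne {S : Finset ℕ} (h : HasPrivatePrimes S) (z : S → ℤ)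
    (hz : z ≠ 0) :
    ∏ b : S, (b : ℕ) ^ (z b).toNat ≠ ∏ b : S, (b : ℕ) ^ (-z b).toNat := by
  have key : ∀ u v : S → ℕ, (∏ b : S, (b : ℕ) ^ u b = ∏ b : S, (b : ℕ) ^ v b) →
      ∀ b, u b ≠ 0 → v b ≠ 0 := by
    intro u v huv b hub hvb
    obtain ⟨r, r1, r2, r3⟩ := h b b.2
    have h1 : r ∣ ∏ b : S, (b : ℕ) ^ u b :=
      (dvd_pow r2 hub).trans (dvd_prod_of_mem (fun b : S => (b : ℕ) ^ u b) (mem_univ b))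
    rw [huv] at h1
    obtain ⟨c, _, hc⟩ := (r1.prime.dvd_finsetProd_iff _).1 h1
    by_cases hcb : c = b
    · subst hcb; rw [hvb, pow_zero] at hc; exact r1.one_lt.ne' (Nat.dvd_one.1 hc)
    · exact r3 c c.2 (fun e => hcb (Subtype.ext e)) (r1.dvd_of_dvd_pow hc)
  intro he
  apply hz
  funext b
  have h1 := key _ _ he b
  have h2 := key _ _ he.symm b
  simp only [Pi.zero_apply]
  omega

theorem card_primeFactors_le_of_le_two_pow {n E : ℕ} (hn : n ≠ 0) (h : n ≤ 2 ^ E) :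
    n.primeFactors.card ≤ E := by
  have h1 : 2 ^ n.primeFactors.card ≤ ∏ p ∈ n.primeFactors, p :=
    Finset.pow_card_le_prod _ _ _ fun p hp => (Nat.prime_of_mem_primeFactors hp).two_le
  have h2 := Nat.le_of_dvd (Nat.pos_of_ne_zero hn) (Nat.prod_primeFactors_dvd n)
  exact (Nat.pow_le_pow_iff_right (by norm_num)).1 (h1.trans (h2.trans h))

open Finset in
/-- If the powers of the elements of `S` lie in a subgroup of small order modulo `p`, then
some nontrivial small relation holds modulo `p`. -/
theorem exists_relation_mod_prime {S : Finset ℕ} {B d p : ℕ} (hp : p.Prime) (hd : 0 < d)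
    (hdB : d < (B + 1) ^ #S) (hS : ∀ b ∈ S, (b : ZMod p) ^ d = 1) :
    ∃ z : S → ℤ, z ≠ 0 ∧ (∀ b, z b ∈ Icc (-B : ℤ) B) ∧
      (∏ b : S, (b : ZMod p) ^ (z b).toNat) = ∏ b : S, (b : ZMod p) ^ (-z b).toNat := by
  classical
  have := Fact.mk hp
  have hcard : #(Polynomial.nthRootsFinset d (1 : ZMod p))
      < #(Fintype.piFinset fun _ : S => range (B + 1)) := by
    rw [Fintype.card_piFinset, prod_const, card_range, card_univ, Fintype.card_coe]
    refine lt_of_le_of_lt ?_ hdB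
    rw [Polynomial.nthRootsFinset_def]
    exact (Multiset.toFinset_card_le _).trans (Polynomial.card_nthRoots d 1)
  obtain ⟨e, he, e', he', hne, heq⟩ := exists_ne_map_eq_of_card_lt_of_maps_to hcard
    (f := fun e => ∏ b : S, ((b : ℕ) : ZMod p) ^ e b) (by
      intro e _
      simp only [mem_coe]
      rw [Polynomial.mem_nthRootsFinset hd, ← prod_pow]
      refine prod_eq_one fun b _ => ?_
      rw [pow_right_comm, hS b b.2, one_pow])
  simp only [Fintype.mem_piFinset, mem_range] at he he'
  refine ⟨fun b => (e b : ℤ) - e' b, ?_, ?_, ?_⟩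
  · intro h
    apply hne
    funext b
    have := congrFun h b
    simp only [Pi.zero_apply] at this
    omega
  · intro b
    have := he b
    have := he' b
    rw [mem_Icc]; dsimp only; constructor <;> omega
  · have hb0 : ∀ b : S, ((b : ℕ) : ZMod p) ≠ 0 := by
      intro b hb
      have := hS b b.2
      rw [hb, zero_pow hd.ne'] at this
      exact zero_ne_one this
    have hm0 : ∏ b : S, ((b : ℕ) : ZMod p) ^ min (e b) (e' b) ≠ 0 :=
      prod_ne_zero_iff.2 fun b _ => pow_ne_zero _ (hb0 b)
    apply mul_left_cancel₀ hm0
    rw [← prod_mul_distrib, ← prod_mul_distrib]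
    have h1 : ∀ b : S, min (e b) (e' b) + ((e b : ℤ) - e' b).toNat = e b := by intro b; omega
    have h2 : ∀ b : S, min (e b) (e' b) + (-((e b : ℤ) - e' b)).toNat = e' b := by
      intro b; omega
    simp only [← pow_add, h1, h2]
    exact heq

open Finset in
/-- Few primes `p` admit a small common exponent `d` with `b ^ d = 1` modulo `p` for all `b ∈ S`. -/
theorem HasPrivatePrimes.card_primes_le {S : Finset ℕ} (h : HasPrivatePrimes S) {A B : ℕ}
    (hA : ∀ b ∈ S, b ≤ A) (P : Finset ℕ) (hP : ∀ p ∈ P, p.Prime ∧ ∃ d, 0 < d ∧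
      d < (B + 1) ^ #S ∧ ∀ b ∈ S, (b : ZMod p) ^ d = 1) :
    #P ≤ (2 * B + 1) ^ #S * (A * (B * #S)) := by
  classical
  set Z := (Fintype.piFinset fun _ : S => Icc (-B : ℤ) B).filter (· ≠ 0) with hZ
  set N : (S → ℤ) → ℕ := fun z => ((∏ b : S, (b : ℕ) ^ (z b).toNat : ℕ)
    - (∏ b : S, (b : ℕ) ^ (-z b).toNat : ℕ) : ℤ).natAbs with hN
  have hN0 : ∀ z ∈ Z, N z ≠ 0 := by
    intro z hz
    have h1 := h.prod_pow_ne z (mem_filter.1 hz).2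
    simp only [hN]
    omega
  have hbound : ∀ u : S → ℕ, (∀ b, u b ≤ B) → ∏ b : S, (b : ℕ) ^ u b ≤ 2 ^ (A * (B * #S)) := by
    intro u hu
    calc ∏ b : S, (b : ℕ) ^ u b ≤ ∏ b : S, (2 ^ A) ^ B := by
          refine prod_le_prod' fun b _ => ?_
          have h1 : (b : ℕ) ≤ 2 ^ A := (hA b b.2).trans Nat.lt_two_pow_self.le
          exact (Nat.pow_le_pow_left h1 _).trans (Nat.pow_le_pow_right (by positivity) (hu b))
      _ = _ := by simp [← pow_mul, mul_assoc]
  have hNle : ∀ z ∈ Z, N z ≤ 2 ^ (A * (B * #S)) := by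
    intro z hz
    have h0 := Fintype.mem_piFinset.1 (mem_filter.1 hz).1
    have h1 := hbound (fun b => (z b).toNat) fun b => by
      have := mem_Icc.1 (h0 b); omega
    have h2 := hbound (fun b => (-z b).toNat) fun b => by
      have := mem_Icc.1 (h0 b); omega
    simp only [hN]
    omega
  have hsub : P ⊆ Z.biUnion fun z => (N z).primeFactors := by
    intro p hp
    obtain ⟨hpp, d, hd, hdB, hb⟩ := hP p hp
    obtain ⟨z, z1, z2, z3⟩ := exists_relation_mod_prime hpp hd hdB hb
    have hzZ : z ∈ Z := mem_filter.2 ⟨Fintype.mem_piFinset.2 z2, z1⟩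
    refine mem_biUnion.2 ⟨z, hzZ, Nat.mem_primeFactors.2 ⟨hpp, ?_, hN0 z hzZ⟩⟩
    simp only [hN]
    rw [← Int.natCast_dvd, ← ZMod.intCast_zmod_eq_zero_iff_dvd _ p]
    push_cast
    rw [z3, sub_self]
  calc #P ≤ ∑ z ∈ Z, #(N z).primeFactors := (card_le_card hsub).trans card_biUnion_le
    _ ≤ ∑ z ∈ Z, A * (B * #S) :=
        sum_le_sum fun z hz => card_primeFactors_le_of_le_two_pow (hN0 z hz) (hNle z hz)
    _ = #Z * (A * (B * #S)) := by simp
    _ ≤ _ := by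
        gcongr
        refine (card_filter_le _ _).trans (le_of_eq ?_)
        rw [Fintype.card_piFinset, prod_const, Int.card_Icc, card_univ, Fintype.card_coe]
        congr 1
        omega

open Finset Classical in
theorem choose_le_pow_of_large_primes (a s : ℕ) (ha : 0 < a) (hs : 0 < s) :
    (a + s - 1).choose s ≤ (a + s - 1) ^ (#{p ∈ range s | p.Prime}
      + #{b ∈ Ico a (a + s) | ∃ r, r.Prime ∧ s ≤ r ∧ r ∣ b}) := by
  set n := a + s - 1 with hn
  set c := n.choose s with hc
  have hc0 : c ≠ 0 := (Nat.choose_pos (by omega)).ne'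
  have hn0 : 0 < n := by omega
  set E := (Ico a (a + s)).filter (fun b => ∃ r, r.Prime ∧ s ≤ r ∧ r ∣ b) with hE
  have hcdvd : c ∣ ∏ b ∈ Ico a (a + s), b := by
    have h1 := Nat.ascFactorial_eq_factorial_mul_choose' a s
    have h2 : ∏ b ∈ Ico a (a + s), b = a.ascFactorial s := by
      rw [Nat.ascFactorial_eq_prod_range, prod_Ico_eq_prod_range]; simp
    rw [h2, h1]; exact dvd_mul_left _ _
  have hlarge : ∏ p ∈ c.primeFactors with ¬ p < s, p ^ c.factorization p ∣ ∏ b ∈ E, b := by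
    refine Finset.prod_dvd_of_isRelPrime ?_ ?_
    · intro p hp q hq hpq
      have hp := (mem_filter.1 (mem_coe.1 hp)).1
      have hq := (mem_filter.1 (mem_coe.1 hq)).1
      exact Nat.coprime_iff_isRelPrime.1 (Nat.Coprime.pow _ _ ((Nat.coprime_primes
        (Nat.prime_of_mem_primeFactors hp)
        (Nat.prime_of_mem_primeFactors hq)).2 hpq))
    · intro p hp
      obtain ⟨hp, hps⟩ := mem_filter.1 hp
      have hpp := Nat.prime_of_mem_primeFactors hp
      have h1 : p ^ c.factorization p ∣ ∏ b ∈ Ico a (a + s), b :=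
        (Nat.ordProj_dvd c p).trans hcdvd
      rw [← prod_filter_mul_prod_filter_not (Ico a (a + s))
        (fun b => ∃ r, r.Prime ∧ s ≤ r ∧ r ∣ b)] at h1
      refine Nat.Coprime.dvd_of_dvd_mul_right ?_ h1
      refine Nat.Coprime.pow_left _ (Nat.Coprime.prod_right fun b hb => ?_)
      rw [hpp.coprime_iff_not_dvd]
      intro h
      exact (mem_filter.1 hb).2 ⟨p, hpp, by omega, h⟩
  have hE1 : ∏ b ∈ E, b ≤ n ^ #E := by
    refine prod_le_pow_card _ _ _ fun b hb => ?_
    have := mem_Ico.1 (mem_filter.1 hb).1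
    omega
  have hE0 : 0 < ∏ b ∈ E, b := prod_pos fun b hb => by
    have := mem_Ico.1 (mem_filter.1 hb).1
    omega
  have hsmall : ∏ p ∈ c.primeFactors with p < s, p ^ c.factorization p
      ≤ n ^ #{p ∈ range s | p.Prime} := by
    calc _ ≤ n ^ #{p ∈ c.primeFactors | p < s} :=
          prod_le_pow_card _ _ _ fun p _ => Nat.pow_factorization_choose_le hn0
      _ ≤ _ := by
          refine Nat.pow_le_pow_right hn0 (card_le_card ?_)
          intro p hp
          obtain ⟨h1, h2⟩ := mem_filter.1 hp
          exact mem_filter.2 ⟨mem_range.2 h2, Nat.prime_of_mem_primeFactors h1⟩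
  calc c = ∏ p ∈ c.primeFactors, p ^ c.factorization p := (Nat.prod_factorization_pow_eq_self hc0).symm
    _ = _ := (prod_filter_mul_prod_filter_not _ (· < s) _).symm
    _ ≤ n ^ #{p ∈ range s | p.Prime} * n ^ #E :=
        Nat.mul_le_mul hsmall ((Nat.le_of_dvd hE0 hlarge).trans hE1)
    _ = _ := (pow_add _ _ _).symm

open Finset in
theorem card_primes_range_le (s : ℕ) (hs : 3 ≤ s) :
    2 * #{p ∈ range s | p.Prime} ≤ s + 2 := by
  have h := Nat.primeCounting'_add_le (a := 2) (k := 3) (by norm_num) (by norm_num) (s - 3)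
  rw [Nat.add_sub_cancel' hs, Nat.totient_two] at h
  have h3 : Nat.primeCounting' 3 = 1 := by decide
  rw [h3, Nat.primeCounting', Nat.count_eq_card_filter_range] at h
  omega

open Finset Classical in
theorem le_card_large_primes (a s : ℕ) (hs : 3 ≤ s) (ha : s ^ 8 ≤ a) :
    s ≤ 4 * #{b ∈ Ico a (a + s) | ∃ r, r.Prime ∧ s ≤ r ∧ r ∣ b} + 4 := by
  have hsa : s ≤ a := (Nat.le_self_pow (by norm_num) s).trans ha
  have h1 := choose_le_pow_of_large_primes a s (by omega) (by omega)
  have h2 := card_primes_range_le s hs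
  set e := #{p ∈ range s | p.Prime} with he
  set f := #{b ∈ Ico a (a + s) | ∃ r, r.Prime ∧ s ≤ r ∧ r ∣ b} with hf
  set n := a + s - 1 with hn
  have h3 : a ^ s ≤ s ^ s * n.choose s := by
    have h4 : a ^ s ≤ a.ascFactorial s := Nat.pow_succ_le_ascFactorial a s
    rw [Nat.ascFactorial_eq_factorial_mul_choose'] at h4
    exact h4.trans (Nat.mul_le_mul_right _ (Nat.factorial_le_pow s))
  have h4 : n ^ s ≤ (s * s) ^ s * n.choose s := by
    calc n ^ s ≤ (s * a) ^ s := Nat.pow_le_pow_left (by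
          have := Nat.mul_le_mul_right a hs
          omega) s
      _ = s ^ s * a ^ s := mul_pow _ _ _
      _ ≤ s ^ s * (s ^ s * n.choose s) := Nat.mul_le_mul_left _ h3
      _ = _ := by rw [mul_pow]; ring
  have h5 : n ^ (4 * s) ≤ n ^ (s + 4 * (e + f)) := by
    calc n ^ (4 * s) = (n ^ s) ^ 4 := by rw [← pow_mul, mul_comm]
      _ ≤ ((s * s) ^ s * n ^ (e + f)) ^ 4 :=
          Nat.pow_le_pow_left (h4.trans (Nat.mul_le_mul_left _ h1)) 4
      _ = (s ^ 8) ^ s * n ^ (4 * (e + f)) := by ring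
      _ ≤ n ^ s * n ^ (4 * (e + f)) :=
          Nat.mul_le_mul_right _ (Nat.pow_le_pow_left (by omega) s)
      _ = _ := (pow_add _ _ _).symm
  have h6 := (Nat.pow_le_pow_iff_right (by omega : 1 < n)).1 h5
  omega

open Finset Classical in
theorem hasPrivatePrimes_large_primes (a s : ℕ) :
    HasPrivatePrimes {b ∈ Ico a (a + s) | ∃ r, r.Prime ∧ s ≤ r ∧ r ∣ b} := by
  intro b hb
  obtain ⟨hb, r, r1, r2, r3⟩ := mem_filter.1 hb
  refine ⟨r, r1, r3, fun c hc hcb hrc => ?_⟩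
  have hc := (mem_filter.1 hc).1
  rw [mem_Ico] at hb hc
  rcases lt_or_gt_of_ne hcb with h | h
  · have := Nat.le_of_dvd (by omega) (Nat.dvd_sub r3 hrc); omega
  · have := Nat.le_of_dvd (by omega) (Nat.dvd_sub hrc r3); omega

open Finset in
theorem hasPrivatePrimes_primes (s : Finset ℕ) : HasPrivatePrimes {p ∈ s | p.Prime} := by
  intro b hb
  have hbp := (mem_filter.1 hb).2
  refine ⟨b, hbp, dvd_rfl, fun c hc hcb h => hcb ?_⟩
  exact ((Nat.prime_dvd_prime_iff_eq hbp (mem_filter.1 hc).2).1 h).symm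

theorem le_primeCounting {x : ℕ} (hx : 200 ≤ x) :
    (x : ℝ) / (2 * Real.log x) ≤ Nat.primeCounting x := by
  have hx' : (200 : ℝ) ≤ x := by exact_mod_cast hx
  have hlog : 0 < Real.log x := Real.log_pos (by linarith)
  refine le_trans ?_ (Chebyshev.pi_ge x)
  have h1 : Real.log (x + 1) ≤ 0.19 * x := by
    refine (log_le_two_mul_sqrt (by positivity)).trans ?_
    have : √((x : ℝ) + 1) ≤ 0.095 * x := by
      rw [Real.sqrt_le_left (by positivity)]
      nlinarith
    linarith
  have h2 := Real.log_two_gt_d9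
  rw [← div_div]
  gcongr
  nlinarith

open Finset Filter in
/-- Every interval of `m` positive integers contains a large set with private primes. -/
theorem eventually_exists_hasPrivatePrimes :
    ∀ᶠ m : ℕ in atTop, ∀ a : ℕ, 0 < a → ∃ S ⊆ Ico a (a + m),
      (m : ℝ) ^ (1 / 32 : ℝ) ≤ #S ∧ HasPrivatePrimes S := by
  classical
  have hlog := ((isLittleO_log_rpow_atTop (show (0 : ℝ) < 1 / 2 by norm_num)).bound
    (show (0 : ℝ) < 1 / 4 by norm_num)).natCast_atTop
  filter_upwards [hlog, eventually_ge_atTop (5 ^ 32)] with m hlog hm a ha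
  have hm1 : ((5 : ℝ) ^ 32) ≤ m := by exact_mod_cast hm
  have hm0 : (0 : ℝ) < m := lt_of_lt_of_le (by norm_num) hm1
  set t := (m : ℝ) ^ (1 / 32 : ℝ) with ht
  have htpow : ∀ k : ℕ, t ^ k = (m : ℝ) ^ ((k : ℝ) / 32) := by
    intro k
    rw [ht, ← Real.rpow_natCast, ← Real.rpow_mul hm0.le]
    congr 1; ring
  have ht5 : 5 ≤ t := by
    have h1 : ((5 : ℝ) ^ 32) ^ (1 / 32 : ℝ) ≤ t :=
      Real.rpow_le_rpow (by norm_num) hm1 (by norm_num)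
    rw [← Real.rpow_natCast, ← Real.rpow_mul (by norm_num)] at h1
    norm_num at h1
    exact h1
  have ht32 : t ^ 32 = m := by rw [htpow]; norm_num
  set s := ⌊t ^ 2⌋₊ with hs
  have hs1 : (s : ℝ) ≤ t ^ 2 := Nat.floor_le (by positivity)
  have hs2 : t ^ 2 < s + 1 := Nat.lt_floor_add_one _
  have hs3 : 3 ≤ s := Nat.le_floor (by push_cast; nlinarith)
  have hs16 : (s : ℝ) ^ 8 ≤ t ^ 16 := by
    calc (s : ℝ) ^ 8 ≤ (t ^ 2) ^ 8 := by gcongr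
      _ = _ := by ring
  have hsm : s ≤ m := by
    have : (s : ℝ) ≤ m := by
      rw [← ht32]
      exact hs1.trans (pow_le_pow_right₀ (by linarith) (by norm_num))
    exact_mod_cast this
  rcases le_or_gt (s ^ 8) a with h | h
  · refine ⟨_, ?_, ?_, hasPrivatePrimes_large_primes a s⟩
    · exact (filter_subset _ _).trans (Ico_subset_Ico_right (by omega))
    · have h1 := le_card_large_primes a s hs3 h
      have h2 : (s : ℝ) ≤ 4 * (#{b ∈ Ico a (a + s) | ∃ r, r.Prime ∧ s ≤ r ∧ r ∣ b} : ℝ) + 4 := by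
        exact_mod_cast h1
      nlinarith
  · refine ⟨_, filter_subset _ _, ?_, hasPrivatePrimes_primes (Ico a (a + m))⟩
    have h1 : Nat.primeCounting m ≤ #{p ∈ Ico a (a + m) | p.Prime} + a := by
      rw [Nat.primeCounting, Nat.primeCounting', Nat.count_eq_card_filter_range]
      have hsub : (range (m + 1)).filter (fun p => p.Prime)
          ⊆ (Ico a (a + m)).filter (fun p => p.Prime) ∪ range a := by
        intro p hp
        obtain ⟨h1, h2⟩ := mem_filter.1 hp
        rw [mem_range] at h1
        rw [mem_union, mem_filter, mem_Ico, mem_range]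
        by_cases hpa : p < a
        · exact Or.inr hpa
        · exact Or.inl ⟨⟨by omega, by omega⟩, h2⟩
      have := (card_le_card hsub).trans (card_union_le _ _)
      rwa [card_range] at this
    have h2 := le_primeCounting (x := m) (le_trans (by norm_num) hm)
    have h3 : (Nat.primeCounting m : ℝ) ≤ (#{p ∈ Ico a (a + m) | p.Prime} : ℝ) + t ^ 16 := by
      have h4 : (a : ℝ) ≤ s ^ 8 := by exact_mod_cast h.le
      have h5 : (Nat.primeCounting m : ℝ) ≤ (#{p ∈ Ico a (a + m) | p.Prime} : ℝ) + a := by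
        exact_mod_cast h1
      linarith
    have hlogpos : 0 < Real.log m := Real.log_pos (lt_of_lt_of_le (by norm_num) hm1)
    have h6 : Real.log m ≤ 1 / 4 * t ^ 16 := by
      rw [Real.norm_of_nonneg hlogpos.le, Real.norm_of_nonneg (by positivity)] at hlog
      rw [htpow]
      norm_num at hlog ⊢
      exact hlog
    have h7 : 2 * t ^ 16 ≤ m / (2 * Real.log m) := by
      rw [le_div_iff₀ (by positivity)]
      have e : (m : ℝ) = t ^ 16 * t ^ 16 := by rw [← ht32]; ring
      have h0 : (0 : ℝ) < t ^ 16 := by positivity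
      nlinarith [mul_le_mul_of_nonneg_left h6 h0.le]
    have h8 : t ≤ t ^ 16 := le_self_pow₀ (by linarith) (by norm_num)
    linarith

theorem orderOf_natCast_dvd_pred {p b : ℕ} (hp : p.Prime) (hb : ¬ p ∣ b) :
    orderOf (b : ZMod p) ∣ p - 1 := by
  have : Fact p.Prime := ⟨hp⟩
  refine orderOf_dvd_of_pow_eq_one (ZMod.pow_card_sub_one_eq_one ?_)
  rwa [Ne, ZMod.natCast_eq_zero_iff]

open Finset in
theorem card_large_primeFactors_lt {n y K : ℕ} (hn : n ≠ 0) (h : n < y ^ K) :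
    #{q ∈ n.primeFactors | y < q} < K := by
  by_contra! hK
  have hy : 0 < y ∨ K = 0 := by
    rcases Nat.eq_zero_or_pos y with rfl | hy
    · right
      by_contra hK0
      rw [zero_pow hK0] at h
      omega
    · exact Or.inl hy
  rcases hy with hy | rfl
  · have h1 : y ^ #{q ∈ n.primeFactors | y < q} ≤ ∏ q ∈ n.primeFactors with y < q, q :=
      pow_card_le_prod _ _ _ fun q hq => (mem_filter.1 hq).2.le
    have h2 : ∏ q ∈ n.primeFactors with y < q, q ≤ n :=
      Nat.le_of_dvd (Nat.pos_of_ne_zero hn)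
        ((prod_dvd_prod_of_subset _ _ _ (filter_subset _ _)).trans (Nat.prod_primeFactors_dvd n))
    have h3 : y ^ K ≤ y ^ #{q ∈ n.primeFactors | y < q} := Nat.pow_le_pow_right hy hK
    omega
  · simp at h
    omega

open Finset in
/-- If all elements of `S` have small order modulo `p`, then either `p - 1` has a large square
divisor, or it has a large smooth part, or many elements of `S` satisfy `b ^ d = 1` for a common
small exponent `d`. -/
theorem exists_square_or_smooth_or_common_exponent {p y D K k : ℕ} {S : Finset ℕ} {W : ℝ}
    (hp : p.Prime) (hS : ∀ b ∈ S, ¬ p ∣ b) (hW : 0 < W)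
    (hord : ∀ b ∈ S, (orderOf (b : ZMod p) : ℝ) ≤ W) (hpy : p ≤ y ^ K) (hk : 0 < k)
    (hcard : K * k ≤ #S) :
    (∃ d, D < d ∧ d ^ 2 ∣ p - 1) ∨
    Real.log ((p - 1 : ℕ) / W) - 2 * Real.log D
      ≤ ∑ q ∈ (p - 1).primeFactors with q ≤ y, Real.log q ∨
    ∃ S' ⊆ S, #S' = k ∧ ∃ d, 0 < d ∧ d * y ≤ p - 1 ∧ ∀ b ∈ S', (b : ZMod p) ^ d = 1 := by
  have hn : p - 1 ≠ 0 := by have := hp.two_le; omega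
  obtain ⟨e, d, hde, he⟩ := Nat.sq_mul_squarefree (p - 1)
  rcases lt_or_ge D d with hD | hD
  · exact Or.inl ⟨d, hD, hde ▸ dvd_mul_right _ _⟩
  right
  have hd0 : d ≠ 0 := by rintro rfl; simp at hde; omega
  have hdvd : ∀ b ∈ S, orderOf (b : ZMod p) ∣ p - 1 := fun b hb =>
    orderOf_natCast_dvd_pred hp (hS b hb)
  have hopos : ∀ b ∈ S, 0 < orderOf (b : ZMod p) := fun b hb =>
    Nat.pos_of_dvd_of_pos (hdvd b hb) (Nat.pos_of_ne_zero hn)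
  by_cases hsm : ∃ b ∈ S, ∀ q, q.Prime → q ∣ (p - 1) / orderOf (b : ZMod p) → q ≤ y
  · left
    obtain ⟨b, hb, hq⟩ := hsm
    have h1 := log_le_sum_log_primeFactors_add hn hde he (Nat.div_dvd_of_dvd (hdvd b hb)) hq
    have ho : (0 : ℝ) < orderOf (b : ZMod p) := by exact_mod_cast hopos b hb
    have hn' : (0 : ℝ) < (p - 1 : ℕ) := by exact_mod_cast Nat.pos_of_ne_zero hn
    rw [Nat.cast_div (hdvd b hb) ho.ne'] at h1
    have h2 : Real.log ((p - 1 : ℕ) / W) ≤ Real.log ((p - 1 : ℕ) / orderOf (b : ZMod p)) :=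
      Real.log_le_log (by positivity) (div_le_div_of_nonneg_left hn'.le ho (hord b hb))
    have h3 : Real.log d ≤ Real.log D :=
      Real.log_le_log (by exact_mod_cast Nat.pos_of_ne_zero hd0) (by exact_mod_cast hD)
    linarith
  · right
    push Not at hsm
    choose! q hqp hqd hqy using hsm
    have hK : 0 < K := by
      rcases Nat.eq_zero_or_pos K with rfl | hK
      · have := hp.two_le
        simp at hpy
        omega
      · exact hK
    have hSne : S.Nonempty := card_pos.1 (lt_of_lt_of_le (Nat.mul_pos hK hk) hcard)
    have hmaps : ∀ b ∈ S, q b ∈ (p - 1).primeFactors.filter (fun q => y < q) := fun b hb =>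
      mem_filter.2 ⟨Nat.mem_primeFactors.2 ⟨hqp b hb,
        (hqd b hb).trans (Nat.div_dvd_of_dvd (hdvd b hb)), hn⟩, hqy b hb⟩
    have hQ := card_large_primeFactors_lt (y := y) (K := K) hn (by have := hp.two_le; omega)
    obtain ⟨r, hr, hrc⟩ := exists_le_card_fiber_of_mul_le_card_of_maps_to (n := k) hmaps
      ⟨_, hmaps _ hSne.choose_spec⟩ ((Nat.mul_le_mul_right k hQ.le).trans hcard)
    obtain ⟨S', hS', hS'c⟩ := exists_subset_card_eq hrc
    obtain ⟨hr1, hr2⟩ := mem_filter.1 hr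
    have hrd := Nat.dvd_of_mem_primeFactors hr1
    have hrp := Nat.prime_of_mem_primeFactors hr1
    refine ⟨S', hS'.trans (filter_subset _ _), hS'c, (p - 1) / r,
      Nat.div_pos (Nat.le_of_dvd (Nat.pos_of_ne_zero hn) hrd) hrp.pos, ?_, fun b hb => ?_⟩
    · calc (p - 1) / r * y ≤ (p - 1) / r * r := Nat.mul_le_mul_left _ hr2.le
        _ ≤ p - 1 := Nat.div_mul_le_self _ _
    · obtain ⟨hbS, rfl⟩ := mem_filter.1 (hS' hb)
      apply orderOf_dvd_iff_pow_eq_one.1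
      obtain ⟨c, hc⟩ := hqd b hbS
      refine ⟨c, Nat.div_eq_of_eq_mul_left hrp.pos ?_⟩
      rw [← Nat.mul_div_cancel' (hdvd b hbS), hc]
      ring

open Finset Classical in
/-- A bound for the number of primes modulo which all elements of `S` have small order. -/
theorem card_primes_small_orders_le {x y D K k A B L : ℕ} {S : Finset ℕ} {W H : ℝ}
    (hpriv : HasPrivatePrimes S) (hS : ∀ b ∈ S, 0 < b ∧ b ≤ A) (hx : 9 ≤ x) (hy : 0 < y)
    (hyx : y ^ 2 ≤ x) (hxy : x ≤ y ^ K) (hk : 0 < k) (hcard : K * k ≤ #S) (hAL : A ≤ L)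
    (hL : 0 < L) (hW : 0 < W) (hH : 0 < H) (hHL : H ≤ Real.log (L / W) - 2 * Real.log D)
    (hB : x ≤ y * (B + 1) ^ k) :
    (#{p ∈ range (x + 1) | p.Prime ∧
      ∀ b ∈ S, ¬ p ∣ b → (orderOf (b : ZMod p) : ℝ) ≤ W} : ℝ) ≤
    L + 2 * x / (D + 1) + 144 * x / Real.log x * (Real.log y + Real.log 4) / H
      + (#S).choose k * ((2 * B + 1) ^ k * (A * (B * k))) := by
  set P := {p ∈ range (x + 1) | p.Prime ∧
      ∀ b ∈ S, ¬ p ∣ b → (orderOf (b : ZMod p) : ℝ) ≤ W} with hP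
  set P1 := {p ∈ range (x + 1) | 2 ≤ p ∧ ∃ d, D < d ∧ d ^ 2 ∣ p - 1} with hP1
  set P2 := {p ∈ range (x + 1) | p.Prime ∧
    H ≤ ∑ q ∈ (p - 1).primeFactors with q ≤ y, Real.log q} with hP2
  let P3 : Finset ℕ → Finset ℕ := fun S' => {p ∈ range (x + 1) | p.Prime ∧
    ∃ d, 0 < d ∧ d < (B + 1) ^ #S' ∧ ∀ b ∈ S', (b : ZMod p) ^ d = 1}
  have hsub : P ⊆ Icc 1 L ∪ P1 ∪ P2 ∪ (powersetCard k S).biUnion P3 := by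
    intro p hpP
    obtain ⟨hpx, hp, hord⟩ := mem_filter.1 hpP
    rw [mem_union, mem_union, mem_union]
    rcases le_or_gt p L with hpL | hpL
    · exact Or.inl (Or.inl (Or.inl (mem_Icc.2 ⟨hp.one_le, hpL⟩)))
    have hpx' : p ≤ x := by have := mem_range.1 hpx; omega
    have hnd : ∀ b ∈ S, ¬ p ∣ b := fun b hb h => by
      have := Nat.le_of_dvd (hS b hb).1 h
      have := (hS b hb).2
      omega
    rcases exists_square_or_smooth_or_common_exponent (D := D) hp hnd hW
      (fun b hb => hord b hb (hnd b hb)) (hpx'.trans hxy) hk hcard with h | h | h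
    · exact Or.inl (Or.inl (Or.inr (mem_filter.2 ⟨hpx, hp.two_le, h⟩)))
    · refine Or.inl (Or.inr (mem_filter.2 ⟨hpx, hp, ?_⟩))
      have h1 : (L : ℝ) ≤ (p - 1 : ℕ) := by exact_mod_cast (by omega : L ≤ p - 1)
      have h0 : (0 : ℝ) < L := by exact_mod_cast hL
      have h2 : Real.log (L / W) ≤ Real.log ((p - 1 : ℕ) / W) :=
        Real.log_le_log (by positivity) (by gcongr)
      linarith
    · obtain ⟨S', hS', hS'k, d, hd, hdy, hpow⟩ := h
      refine Or.inr (mem_biUnion.2 ⟨S', mem_powersetCard.2 ⟨hS', hS'k⟩,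
        mem_filter.2 ⟨hpx, hp, d, hd, ?_, hpow⟩⟩)
      rw [hS'k]
      have := hp.two_le
      refine Nat.lt_of_mul_lt_mul_left (a := y) ?_
      rw [mul_comm y d]
      omega
  have hP3 : ∀ S' ∈ powersetCard k S, #(P3 S') ≤ (2 * B + 1) ^ k * (A * (B * k)) := by
    intro S' hS'
    obtain ⟨h1, h2⟩ := mem_powersetCard.1 hS'
    have := (hpriv.mono h1).card_primes_le (fun b hb => (hS b (h1 hb)).2) (P3 S')
      (B := B) fun p hp => (mem_filter.1 hp).2
    rwa [h2] at this
  have hc3 : #((powersetCard k S).biUnion P3) ≤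
      (#S).choose k * ((2 * B + 1) ^ k * (A * (B * k))) := by
    rw [← card_powersetCard]
    exact card_biUnion_le_card_mul _ _ _ hP3
  have hc1 : (#P1 : ℝ) ≤ _ := card_square_dvd_pred_le x D
  have hc2 : (#P2 : ℝ) ≤ 144 * x / Real.log x * (Real.log y + Real.log 4) / H := by
    convert card_primes_smooth_part_le x y hx hy hyx H hH using 1
  have hc : #P ≤ L + #P1 + #P2 + (#S).choose k * ((2 * B + 1) ^ k * (A * (B * k))) := by
    refine (card_le_card hsub).trans ((card_union_le _ _).trans (add_le_add ?_ hc3))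
    refine (card_union_le _ _).trans (add_le_add_left ((card_union_le _ _).trans ?_) _)
    simp
  have hc' : (#P : ℝ) ≤ L + #P1 + #P2 + (#S).choose k * ((2 * B + 1) ^ k * (A * (B * k))) := by
    exact_mod_cast hc
  linarith

open Filter in
theorem eventually_rpow_le_primeCounting {α ε : ℝ} (c : ℝ) (hα : α < 1) (hc : 0 ≤ c)
    (hε : 0 < ε) : ∀ᶠ T : ℝ in atTop, c * T ^ α ≤ ε * Nat.primeCounting ⌊T⌋₊ := by
  have hδ : 0 < ε / (4 * (c + 1)) := by positivity
  filter_upwards [(isLittleO_log_rpow_atTop (sub_pos.2 hα)).bound hδ, eventually_ge_atTop 400]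
    with T hlog hT
  have hT0 : 0 < T := by linarith
  have hlT : 0 < Real.log T := Real.log_pos (by linarith)
  rw [Real.norm_of_nonneg hlT.le, Real.norm_of_nonneg (by positivity)] at hlog
  have hx1 : (⌊T⌋₊ : ℝ) ≤ T := Nat.floor_le hT0.le
  have hx2 : T < ⌊T⌋₊ + 1 := Nat.lt_floor_add_one T
  have hx : 200 ≤ ⌊T⌋₊ := Nat.le_floor (by push_cast; linarith)
  have hxr : (200 : ℝ) ≤ ⌊T⌋₊ := by exact_mod_cast hx
  have hlx : 0 < Real.log ⌊T⌋₊ := Real.log_pos (by linarith)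
  have hlxT : Real.log ⌊T⌋₊ ≤ Real.log T := Real.log_le_log (by linarith) hx1
  have h1 : T ^ α * T ^ (1 - α) = T := by
    rw [← Real.rpow_add hT0]; simp
  have h2 : c * T ^ α ≤ ε * (T / (4 * Real.log T)) := by
    rw [← mul_div_assoc, le_div_iff₀ (by positivity)]
    calc c * T ^ α * (4 * Real.log T)
        ≤ c * T ^ α * (4 * (ε / (4 * (c + 1)) * T ^ (1 - α))) := by gcongr
      _ = c / (c + 1) * (ε * (T ^ α * T ^ (1 - α))) := by field_simp
      _ ≤ 1 * (ε * (T ^ α * T ^ (1 - α))) := by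
          gcongr
          rw [div_le_one (by positivity)]; linarith
      _ = ε * T := by rw [h1, one_mul]
  have h3 : T / (4 * Real.log T) ≤ ⌊T⌋₊ / (2 * Real.log ⌊T⌋₊) := by
    calc T / (4 * Real.log T) = (T / 2) / (2 * Real.log T) := by field_simp; norm_num
      _ ≤ ⌊T⌋₊ / (2 * Real.log ⌊T⌋₊) := by gcongr; linarith
  exact h2.trans (mul_le_mul_of_nonneg_left (h3.trans (le_primeCounting hx)) hε.le)

open Filter in
theorem eventually_le_rpow {s : ℝ} (hs : 0 < s) (c : ℝ) : ∀ᶠ T : ℝ in atTop, c ≤ T ^ s :=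
  (tendsto_rpow_atTop hs).eventually_ge_atTop c

open Filter Finset Classical in
theorem eventually_card_primes_small_orders_le {S : Finset ℕ} (hpriv : HasPrivatePrimes S)
    (hS : ∀ b ∈ S, 0 < b) {θ μ : ℝ} (hθ : 0 < θ) (hθ1 : θ ≤ 1) (hμ : 1 ≤ μ)
    (hcard : 64 * μ ^ 2 / θ ^ 2 ≤ #S) :
    ∀ᶠ T : ℝ in atTop, (#{p ∈ range (⌊T⌋₊ + 1) | p.Prime ∧
      ∀ b ∈ S, ¬ p ∣ b → (orderOf (b : ZMod p) : ℝ) ≤ T ^ (1 - θ)} : ℝ)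
      ≤ 579 * Nat.primeCounting ⌊T⌋₊ / μ := by
  obtain ⟨u, hu⟩ : ∃ u, u = θ / (4 * μ) := ⟨_, rfl⟩
  have hu0 : 0 < u := by rw [hu]; positivity
  have hu1 : u ≤ 1 / 4 := by
    rw [hu, div_le_div_iff₀ (by positivity) (by norm_num)]; linarith
  obtain ⟨k, hk⟩ : ∃ k, k = ⌈1 / u⌉₊ := ⟨_, rfl⟩
  have hk1 : 1 / u ≤ k := hk ▸ Nat.le_ceil _
  have hk2 : (k : ℝ) < 1 / u + 1 := hk ▸ Nat.ceil_lt_add_one (by positivity)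
  have huk : 1 ≤ u * k := by
    rw [div_le_iff₀ hu0] at hk1; linarith
  have hinv : 1 ≤ 1 / u := by rw [le_div_iff₀ hu0]; linarith
  have hk0 : (0 : ℝ) < k := by linarith
  have hkk : k * k ≤ #S := by
    have h1 : (k : ℝ) * k ≤ 64 * μ ^ 2 / θ ^ 2 := by
      calc (k : ℝ) * k ≤ (2 * (1 / u)) * (2 * (1 / u)) := by gcongr <;> linarith
        _ = 64 * μ ^ 2 / θ ^ 2 := by rw [hu]; field_simp; norm_num
    exact_mod_cast h1.trans hcard
  obtain ⟨A, hA⟩ : ∃ A : ℕ, ∀ b ∈ S, b ≤ A := ⟨S.sup id, fun b hb => le_sup (f := id) hb⟩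
  obtain ⟨β, hβ⟩ : ∃ β, β = (1 - u) / k := ⟨_, rfl⟩
  have hβ0 : 0 < β := by rw [hβ]; exact div_pos (by linarith) hk0
  have hβu : β < u := by rw [hβ, div_lt_iff₀ hk0]; linarith
  have hμ0 : 0 < μ := by linarith
  have hinvμ : 0 < 1 / μ := by positivity
  filter_upwards [eventually_ge_atTop 400,
    eventually_le_rpow (s := 1 - θ / 4) (by linarith) (A + 2),
    eventually_le_rpow (s := 1 - 2 * u) (by linarith) 8,
    Real.tendsto_log_atTop.eventually_ge_atTop (4 / θ * Real.log 2),
    Real.tendsto_log_atTop.eventually_ge_atTop (1 / u * (3 * Real.log 2)),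
    eventually_rpow_le_primeCounting (α := 1 - θ / 4) 1 (by linarith) zero_le_one hinvμ,
    eventually_rpow_le_primeCounting (α := 1 - θ / 8) 2 (by linarith) zero_le_two hinvμ,
    eventually_rpow_le_primeCounting (α := 1 - u + β) ((#S).choose k * (3 ^ k * (A * k)))
      (by linarith) (by positivity) hinvμ] with T hT hTA hTu hlog1 hlog2 hp1 hp2 hp3
  have hT0 : 0 < T := by linarith
  have hT1 : 1 ≤ T := by linarith
  have hx1 : (⌊T⌋₊ : ℝ) ≤ T := Nat.floor_le hT0.le
  have hx2 : T < ⌊T⌋₊ + 1 := Nat.lt_floor_add_one T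
  have hx : 200 ≤ ⌊T⌋₊ := Nat.le_floor (by push_cast; linarith)
  have hxr : (200 : ℝ) ≤ ⌊T⌋₊ := by exact_mod_cast hx
  have hl2 : 0 < Real.log 2 := Real.log_pos (by norm_num)
  have hl4 : Real.log 4 = 2 * Real.log 2 := by
    rw [show (4 : ℝ) = 2 ^ 2 by norm_num, Real.log_pow]; norm_num
  have hlT : 0 < Real.log T := Real.log_pos (by linarith)
  have hlx : 0 < Real.log ⌊T⌋₊ := Real.log_pos (by linarith)
  have hone : ∀ s : ℝ, 0 < s → 1 ≤ T ^ s := fun s hs => Real.one_le_rpow hT1 hs.le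
  set x := ⌊T⌋₊ with hxdef
  obtain ⟨y, hy⟩ : ∃ y, y = ⌈T ^ u⌉₊ := ⟨_, rfl⟩
  have hy1 : T ^ u ≤ y := hy ▸ Nat.le_ceil _
  have hy2 : (y : ℝ) ≤ 2 * T ^ u := by
    have h1 : (y : ℝ) < T ^ u + 1 := hy ▸ Nat.ceil_lt_add_one (by positivity)
    linarith [hone u hu0]
  have hy0 : (0 : ℝ) < y := by linarith [hone u hu0]
  obtain ⟨L, hL⟩ : ∃ L, L = ⌊T ^ (1 - θ / 4)⌋₊ := ⟨_, rfl⟩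
  have hL1 : (L : ℝ) ≤ T ^ (1 - θ / 4) := hL ▸ Nat.floor_le (by positivity)
  have hL2 : T ^ (1 - θ / 4) < L + 1 := hL ▸ Nat.lt_floor_add_one _
  have hA0 : (0 : ℝ) ≤ A := Nat.cast_nonneg A
  obtain ⟨D, hD⟩ : ∃ D, D = ⌊T ^ (θ / 8)⌋₊ := ⟨_, rfl⟩
  have hD1 : (D : ℝ) ≤ T ^ (θ / 8) := hD ▸ Nat.floor_le (by positivity)
  have hD2 : T ^ (θ / 8) < D + 1 := hD ▸ Nat.lt_floor_add_one _
  have hD0 : (0 : ℝ) < D := by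
    have : 1 ≤ D := hD ▸ Nat.le_floor (by simpa using hone _ (by positivity))
    exact_mod_cast this
  obtain ⟨B, hB⟩ : ∃ B, B = ⌊T ^ β⌋₊ := ⟨_, rfl⟩
  have hB1 : (B : ℝ) ≤ T ^ β := hB ▸ Nat.floor_le (by positivity)
  have hB2 : T ^ β < B + 1 := hB ▸ Nat.lt_floor_add_one _
  have hTβ : (T ^ β) ^ k = T ^ (1 - u) := by
    rw [← Real.rpow_mul_natCast hT0.le, hβ, div_mul_cancel₀ _ hk0.ne']
  have hyx : y ^ 2 ≤ x := by
    have h1 : T ^ u * T ^ u * T ^ (1 - 2 * u) = T := by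
      rw [← Real.rpow_add hT0, ← Real.rpow_add hT0]
      ring_nf
      exact Real.rpow_one T
    have h2 : (y : ℝ) ^ 2 ≤ x := by
      have h3 : (y : ℝ) ^ 2 ≤ (2 * T ^ u) ^ 2 := by gcongr
      have h4 : T ^ u * T ^ u * 8 ≤ T ^ u * T ^ u * T ^ (1 - 2 * u) := by gcongr
      linarith
    exact_mod_cast h2
  have hxy : x ≤ y ^ k := by
    have h1 : (x : ℝ) ≤ y ^ k := by
      calc (x : ℝ) ≤ T := hx1
        _ = T ^ (1 : ℝ) := (Real.rpow_one T).symm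
        _ ≤ T ^ (u * k) := Real.rpow_le_rpow_of_exponent_le hT1 huk
        _ = (T ^ u) ^ k := Real.rpow_mul_natCast hT0.le _ _
        _ ≤ y ^ k := by gcongr
    exact_mod_cast h1
  have hxB : x ≤ y * (B + 1) ^ k := by
    have h1 : (x : ℝ) ≤ y * (B + 1) ^ k := by
      calc (x : ℝ) ≤ T := hx1
        _ = T ^ u * T ^ (1 - u) := by rw [← Real.rpow_add hT0]; simp
        _ = T ^ u * (T ^ β) ^ k := by rw [hTβ]
        _ ≤ y * (B + 1) ^ k := by gcongr
    exact_mod_cast h1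
  have hlogL : (1 - θ / 4) * Real.log T - Real.log 2 ≤ Real.log L := by
    rw [← Real.log_rpow hT0, ← Real.log_div (by positivity) (by norm_num)]
    exact Real.log_le_log (by positivity) (by linarith)
  have hlogD : Real.log D ≤ θ / 8 * Real.log T := by
    rw [← Real.log_rpow hT0]
    exact Real.log_le_log hD0 hD1
  have hlogy : Real.log y ≤ Real.log 2 + u * Real.log T := by
    rw [← Real.log_rpow hT0, ← Real.log_mul (by norm_num) (by positivity)]
    exact Real.log_le_log hy0 hy2
  have hL0 : (0 : ℝ) < L := by linarith
  have hHL : θ / 4 * Real.log T ≤ Real.log (L / T ^ (1 - θ)) - 2 * Real.log D := by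
    rw [Real.log_div hL0.ne' (by positivity), Real.log_rpow hT0]
    have : Real.log 2 ≤ θ / 4 * Real.log T := by
      have := mul_le_mul_of_nonneg_left hlog1 (by positivity : 0 ≤ θ / 4)
      have e : θ / 4 * (4 / θ * Real.log 2) = Real.log 2 := by field_simp
      linarith
    linarith
  have hmain := card_primes_small_orders_le (x := x) (y := y) (D := D) (K := k) (k := k) (A := A)
    (B := B) (L := L) (W := T ^ (1 - θ)) (H := θ / 4 * Real.log T) hpriv
    (fun b hb => ⟨hS b hb, hA b hb⟩) (by omega) (by exact_mod_cast hy0) hyx hxy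
    (by exact_mod_cast hk0) hkk
    (by
      have : (A : ℝ) ≤ L := by linarith
      exact_mod_cast this)
    (by exact_mod_cast hL0) (by positivity) (by positivity) hHL hxB
  have hb1 : (L : ℝ) ≤ 1 / μ * Nat.primeCounting x := by linarith
  have hb2 : 2 * (x : ℝ) / (D + 1) ≤ 1 / μ * Nat.primeCounting x := by
    refine le_trans ?_ hp2
    calc 2 * (x : ℝ) / (D + 1) ≤ 2 * T / T ^ (θ / 8) := by gcongr
      _ = 2 * T ^ (1 - θ / 8) := by
        rw [Real.rpow_sub hT0, Real.rpow_one, mul_div_assoc]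
  have hb3 : 144 * (x : ℝ) / Real.log x * (Real.log y + Real.log 4) / (θ / 4 * Real.log T)
      ≤ 576 * (1 / μ * Nat.primeCounting x) := by
    have h1 : Real.log y + Real.log 4 ≤ 2 * u * Real.log T := by
      have := mul_le_mul_of_nonneg_left hlog2 hu0.le
      have e : u * (1 / u * (3 * Real.log 2)) = 3 * Real.log 2 := by field_simp
      linarith
    calc 144 * (x : ℝ) / Real.log x * (Real.log y + Real.log 4) / (θ / 4 * Real.log T)
        ≤ 144 * (x : ℝ) / Real.log x * (2 * u * Real.log T) / (θ / 4 * Real.log T) := by gcongr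
      _ = 576 * (1 / μ * (x / (2 * Real.log x))) := by rw [hu]; field_simp; norm_num
      _ ≤ 576 * (1 / μ * Nat.primeCounting x) := by
        gcongr
        exact le_primeCounting hx
  have hb4 : ((#S).choose k : ℝ) * ((2 * B + 1) ^ k * (A * (B * k)))
      ≤ 1 / μ * Nat.primeCounting x := by
    refine le_trans ?_ hp3
    have h1 := hone β hβ0
    calc ((#S).choose k : ℝ) * ((2 * B + 1) ^ k * (A * (B * k)))
        ≤ (#S).choose k * ((3 * T ^ β) ^ k * (A * (T ^ β * k))) := by gcongr; linarith
      _ = (#S).choose k * (3 ^ k * (A * k)) * T ^ (1 - u + β) := by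
        rw [mul_pow, hTβ, Real.rpow_add hT0]; ring
  have e : 579 * (Nat.primeCounting x : ℝ) / μ = 579 * (1 / μ * Nat.primeCounting x) := by ring
  rw [e]
  linarith

open Finset in
theorem setOf_prime_le_eq_coe_filter {T : ℝ} (hT : 0 ≤ T) :
    {p : ℕ | p.Prime ∧ (p : ℝ) ≤ T} = ({p ∈ range (⌊T⌋₊ + 1) | p.Prime} : Finset ℕ) := by
  ext p
  simp [Nat.le_floor_iff hT, and_comm]

open Finset in
theorem ncard_primes_le {T : ℝ} (hT : 0 ≤ T) :
    Set.ncard {p : ℕ | p.Prime ∧ (p : ℝ) ≤ T} = Nat.primeCounting ⌊T⌋₊ := by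
  rw [setOf_prime_le_eq_coe_filter hT, Set.ncard_coe_finset, Nat.primeCounting, Nat.primeCounting',
    Nat.count_eq_card_filter_range]

open Filter in
theorem eventually_log_sq_mul_rpow_le :
    ∀ᶠ m : ℕ in atTop, 64 * Real.log m ^ 2 * (m : ℝ) ^ (1 / 64 : ℝ) ≤ (m : ℝ) ^ (1 / 32 : ℝ) := by
  have h := (isLittleO_log_rpow_atTop (r := 1 / 128) (by norm_num)).bound
    (c := 1 / 8) (by norm_num)
  filter_upwards [tendsto_natCast_atTop_atTop.eventually h, eventually_ge_atTop 1] with m hm h1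
  have hm1 : (1 : ℝ) ≤ m := by exact_mod_cast h1
  have hm0 : (0 : ℝ) < m := by linarith
  have hl := Real.log_nonneg hm1
  rw [Real.norm_of_nonneg hl, Real.norm_of_nonneg (by positivity)] at hm
  have e1 : (m : ℝ) ^ (1 / 64 : ℝ) = ((m : ℝ) ^ (1 / 128 : ℝ)) ^ 2 := by
    rw [← Real.rpow_mul_natCast hm0.le]; norm_num
  have e2 : (m : ℝ) ^ (1 / 32 : ℝ) = (m : ℝ) ^ (1 / 64 : ℝ) * (m : ℝ) ^ (1 / 64 : ℝ) := by
    rw [← Real.rpow_add hm0]; norm_num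
  rw [e2]
  gcongr
  calc 64 * Real.log m ^ 2 ≤ 64 * (1 / 8 * (m : ℝ) ^ (1 / 128 : ℝ)) ^ 2 := by gcongr
    _ = _ := by rw [e1]; ring

/-- There is an absolute `C > 0` such that for every positive integer `a`, integer
`m ≥ 2` and real `1 ≤ μ < log m`, there is `T₀` so that for all `T ≥ T₀` the number of primes
`p < T` with `ord_p(a+j) ≤ T^{1−m^{−1/μ}}` for all `0 ≤ j < m` with `p ∤ (a+j)` is at most
`C·π(T)/μ`. -/
theorem stmt10 :
    ∃ C : ℝ, 0 < C ∧ ∀ a : ℕ, 0 < a → ∀ m : ℕ, 2 ≤ m → ∀ μ : ℝ, 1 ≤ μ → μ < Real.log m →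
      ∃ T₀ : ℝ, ∀ T : ℝ, T₀ ≤ T →
        (Set.ncard {p : ℕ | p.Prime ∧ (p : ℝ) < T ∧
          ∀ j : ℕ, j < m → ¬ (p ∣ (a + j)) →
            (orderOf ((a + j : ℕ) : ZMod p) : ℝ) ≤ T ^ ((1 : ℝ) - (m : ℝ) ^ (-(1 / μ)))} : ℝ)
        ≤ C * (Set.ncard {p : ℕ | p.Prime ∧ (p : ℝ) ≤ T} : ℝ) / μ := by
  classical
  obtain ⟨M, hM⟩ := Filter.eventually_atTop.1
    (eventually_exists_hasPrivatePrimes.and eventually_log_sq_mul_rpow_le)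
  refine ⟨max 579 (Real.log M), lt_of_lt_of_le (by norm_num) (le_max_left _ _), ?_⟩
  intro a ha m hm μ hμ hμm
  have hμ0 : 0 < μ := by linarith
  rcases le_or_gt μ (max 579 (Real.log M)) with hμC | hμC
  · refine ⟨0, fun T hT => ?_⟩
    have hfin : {p : ℕ | p.Prime ∧ (p : ℝ) ≤ T}.Finite := by
      rw [setOf_prime_le_eq_coe_filter hT]
      exact Finset.finite_toSet _
    have h1 : (Set.ncard {p : ℕ | p.Prime ∧ (p : ℝ) < T ∧
          ∀ j : ℕ, j < m → ¬ (p ∣ (a + j)) →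
            (orderOf ((a + j : ℕ) : ZMod p) : ℝ) ≤ T ^ ((1 : ℝ) - (m : ℝ) ^ (-(1 / μ)))} : ℝ)
        ≤ Set.ncard {p : ℕ | p.Prime ∧ (p : ℝ) ≤ T} := by
      refine Nat.cast_le.2 (Set.ncard_le_ncard ?_ hfin)
      rintro p ⟨hp, hpT, -⟩
      exact ⟨hp, hpT.le⟩
    refine h1.trans ?_
    rw [le_div_iff₀ hμ0, mul_comm]
    gcongr
  have hμ579 : 579 < μ := (le_max_left _ _).trans_lt hμC
  have hm0 : (0 : ℝ) < m := by exact_mod_cast (by omega : 0 < m)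
  have hm1 : (1 : ℝ) ≤ m := by exact_mod_cast (by omega : 1 ≤ m)
  have hMm : M ≤ m := by
    by_contra! h
    have : Real.log m ≤ Real.log M :=
      Real.log_le_log hm0 (by exact_mod_cast h.le)
    linarith [(le_max_right 579 (Real.log M)).trans_lt hμC]
  obtain ⟨h1, h2⟩ := hM m hMm
  obtain ⟨S, hSsub, hScard, hSpriv⟩ := h1 a ha
  have hcard : 64 * μ ^ 2 / ((m : ℝ) ^ (-(1 / μ))) ^ 2 ≤ Finset.card S := by
    refine le_trans ?_ (h2.trans hScard)
    have e : ((m : ℝ) ^ (-(1 / μ))) ^ 2 = ((m : ℝ) ^ (2 / μ))⁻¹ := by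
      rw [← Real.rpow_mul_natCast hm0.le, ← Real.rpow_neg hm0.le]
      congr 1
      push_cast
      ring
    rw [e, div_inv_eq_mul]
    have hexp : 2 / μ ≤ 1 / 64 := by
      rw [div_le_div_iff₀ hμ0 (by norm_num)]
      linarith
    have hpow := Real.rpow_le_rpow_of_exponent_le hm1 hexp
    gcongr
  obtain ⟨T₀, hT₀⟩ := Filter.eventually_atTop.1
    (eventually_card_primes_small_orders_le hSpriv
      (fun b hb => lt_of_lt_of_le ha (Finset.mem_Ico.1 (hSsub hb)).1)
      (θ := (m : ℝ) ^ (-(1 / μ))) (by positivity)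
      (Real.rpow_le_one_of_one_le_of_nonpos hm1 (by simpa using hμ0.le)) hμ hcard)
  refine ⟨max T₀ 0, fun T hT => ?_⟩
  have hT0 : 0 ≤ T := (le_max_right _ _).trans hT
  have h3 := hT₀ T ((le_max_left _ _).trans hT)
  rw [ncard_primes_le hT0]
  refine le_trans ?_ (h3.trans ?_)
  · rw [← Set.ncard_coe_finset]
    refine Nat.cast_le.2 (Set.ncard_le_ncard ?_ (Finset.finite_toSet _))
    rintro p ⟨hp, hpT, hord⟩
    rw [Finset.mem_coe, Finset.mem_filter, Finset.mem_range]
    refine ⟨Nat.lt_succ_of_le (Nat.le_floor hpT.le), hp, fun b hb hpb => ?_⟩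
    obtain ⟨hb1, hb2⟩ := Finset.mem_Ico.1 (hSsub hb)
    have := hord (b - a) (by omega)
    rw [Nat.add_sub_cancel' hb1] at this
    exact this hpb
  · gcongr
    exact le_max_left _ _
end

section
/- Fix a real α > 0. There exists a constant C > 0 (depending only on α) such that for every ε > 0 there exists T₀ with the following property: for every real T ≥ T₀, for all but at most ε·π(T) primes p ≤ T, for every integer h with T^α ≤ h < T and every s ∈ F_p, there exists an integer x with 1 ≤ x ≤ h such that x + s ≢ 0 (mod p) and the multiplicative order of x + s in F_p^* is at least (hT)^{1/2}·exp(−C·log h/log log h). -/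
section OrderShifts

open Polynomial Finset

/-- The polynomial `∏ᵢ (X + xᵢ)`. -/
noncomputable def shiftProd {k : ℕ} (x : Fin k → ℕ) : ℤ[X] := ∏ i, (X + C (x i : ℤ))

/-- The polynomial `∏ᵢ (X + xᵢ) - ∏ᵢ (X + yᵢ)`. -/
noncomputable def shiftDiff {k : ℕ} (x y : Fin k → ℕ) : ℤ[X] := shiftProd x - shiftProd y

lemma aeval_shiftProd {R : Type*} [CommRing R] {k : ℕ} (x : Fin k → ℕ) (s : R) :
    aeval s (shiftProd x) = ∏ i, ((x i : R) + s) := by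
  simp [shiftProd, map_prod, add_comm]

lemma aeval_shiftDiff {R : Type*} [CommRing R] {k : ℕ} (x y : Fin k → ℕ) (s : R) :
    aeval s (shiftDiff x y) = ∏ i, ((x i : R) + s) - ∏ i, ((y i : R) + s) := by
  simp [shiftDiff, aeval_shiftProd]

lemma natDegree_shiftProd {k : ℕ} (x : Fin k → ℕ) : (shiftProd x).natDegree = k := by
  rw [shiftProd, natDegree_prod_of_monic _ _ fun i _ => monic_X_add_C _, sum_congr rfl fun i _ => natDegree_X_add_C _]
  simp

lemma natDegree_shiftDiff_le {k : ℕ} (x y : Fin k → ℕ) : (shiftDiff x y).natDegree ≤ k :=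
  (natDegree_sub_le _ _).trans (by simp [natDegree_shiftProd])

lemma coeff_shiftProd_mem {k M : ℕ} {x : Fin k → ℕ} (hx : ∀ i, x i ≤ M) (n : ℕ) :
    (shiftProd x).coeff n ∈ Set.Icc (0 : ℤ) ((M + 1) ^ k) := by
  have hmap : shiftProd x = (∏ i, (X + C (x i)) : ℕ[X]).map (Nat.castRingHom ℤ) := by
    simp [shiftProd, Polynomial.map_prod]
  rw [hmap, coeff_map]
  refine ⟨by simp, ?_⟩
  have h1 : (∏ i, (X + C (x i)) : ℕ[X]).coeff n ≤ (∏ i, (X + C (x i)) : ℕ[X]).eval 1 := by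
    rw [eval_eq_sum, Polynomial.sum]
    by_cases hn : n ∈ (∏ i, (X + C (x i)) : ℕ[X]).support
    · simpa using single_le_sum (f := fun m => (∏ i, (X + C (x i)) : ℕ[X]).coeff m)
        (fun _ _ => Nat.zero_le _) hn
    · rw [notMem_support_iff.1 hn]; exact Nat.zero_le _
  have h2 : (∏ i, (X + C (x i)) : ℕ[X]).eval 1 ≤ (M + 1) ^ k := by
    rw [eval_prod]
    refine (prod_le_pow_card _ _ (M + 1) fun i _ => ?_).trans (by simp)
    simpa [add_comm] using hx i
  simpa using mod_cast h1.trans h2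

lemma abs_coeff_shiftDiff_le {k M : ℕ} {x y : Fin k → ℕ} (hx : ∀ i, x i ≤ M) (hy : ∀ i, y i ≤ M)
    (n : ℕ) : |(shiftDiff x y).coeff n| ≤ (M + 1) ^ k := by
  have h1 := coeff_shiftProd_mem hx n
  have h2 := coeff_shiftProd_mem hy n
  rw [shiftDiff, coeff_sub, abs_le]
  constructor <;> linarith [h1.1, h1.2, h2.1, h2.2]

lemma abs_resultant_le {F G : ℤ[X]} {k : ℕ} {B : ℤ} (hB : 1 ≤ B) (hF : F.natDegree ≤ k)
    (hG : G.natDegree ≤ k) (hFB : ∀ n, |F.coeff n| ≤ B) (hGB : ∀ n, |G.coeff n| ≤ B) :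
    |F.resultant G| ≤ (2 * k).factorial * B ^ (2 * k) := by
  have h := Matrix.det_le (A := sylvester F G F.natDegree G.natDegree)
    (abv := (AbsoluteValue.abs : AbsoluteValue ℤ ℤ)) (x := B) (by
      intro i j
      induction j using Fin.addCases <;> simp only [sylvester, Matrix.of_apply, Fin.addCases_left,
        Fin.addCases_right] <;> split_ifs <;>
        first | exact hFB _ | exact hGB _ | (simp; omega))
  rw [Fintype.card_fin, nsmul_eq_mul] at h
  refine h.trans ?_
  have hk : F.natDegree + G.natDegree ≤ 2 * k := by omega
  gcongr

lemma exists_common_root_modulus {k M : ℕ} {x y x' y' : Fin k → ℕ}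
    (hx : ∀ i, x i ≤ M) (hy : ∀ i, y i ≤ M) (hx' : ∀ i, x' i ≤ M) (hy' : ∀ i, y' i ≤ M)
    (h0 : shiftDiff x y ≠ 0)
    (hcop : ∀ β : ℂ, aeval β (shiftDiff x y) ≠ 0 ∨ aeval β (shiftDiff x' y') ≠ 0) :
    ∃ R : ℕ, R ≠ 0 ∧ R ≤ (2 * k).factorial * ((M + 1) ^ k) ^ (2 * k) ∧
      ∀ (p : ℕ) (s : ZMod p), aeval s (shiftDiff x y) = 0 → aeval s (shiftDiff x' y') = 0 →
        p ∣ R := by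
  set F := shiftDiff x y
  set G := shiftDiff x' y'
  have hFB := abs_coeff_shiftDiff_le hx hy
  have hGB := abs_coeff_shiftDiff_le hx' hy'
  have hb := abs_resultant_le (by exact_mod_cast Nat.one_le_pow _ _ (by omega))
    (natDegree_shiftDiff_le x y) (natDegree_shiftDiff_le x' y') hFB hGB
  have hres : F.resultant G ≠ 0 := by
    have hc : IsCoprime (F.map (Int.castRingHom ℂ)) (G.map (Int.castRingHom ℂ)) := by
      rw [isCoprime_iff_aeval_ne_zero_of_isAlgClosed ℂ ℂ]
      intro a
      simpa [aeval_def, eval_map] using hcop a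
    have := resultant_ne_zero _ _ hc
    rw [natDegree_map_eq_of_injective (RingHom.injective_int _),
      natDegree_map_eq_of_injective (RingHom.injective_int _), resultant_map_map] at this
    exact fun h => this (by simp [h])
  by_cases hd : F.natDegree ≠ 0 ∨ G.natDegree ≠ 0
  · obtain ⟨u, v, -, -, huv⟩ := exists_mul_add_mul_eq_C_resultant F G le_rfl le_rfl hd
    refine ⟨(F.resultant G).natAbs, by simpa using hres, ?_, fun p s h1 h2 => ?_⟩
    · zify; exact hb
    · have := congrArg (aeval s) huv
      rw [map_add, map_mul, map_mul, h1, h2, aeval_C] at this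
      rw [← Int.natCast_dvd, ← ZMod.intCast_zmod_eq_zero_iff_dvd]
      simpa using this.symm
  · push Not at hd
    obtain ⟨c, hc⟩ := natDegree_eq_zero.1 hd.1
    have hcF : F.coeff 0 = c := by rw [← hc]; simp
    refine ⟨c.natAbs, ?_, ?_, fun p s h1 _ => ?_⟩
    · intro h; apply h0; rw [← hc]; simp [Int.natAbs_eq_zero.1 h]
    · have h1 := hFB 0
      have h2 : ((M + 1) ^ k : ℕ) ≤ (2 * k).factorial * ((M + 1) ^ k) ^ (2 * k) := by
        rcases Nat.eq_zero_or_pos k with rfl | hk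
        · simp
        · calc (M + 1) ^ k = 1 * ((M + 1) ^ k) ^ 1 := by simp
            _ ≤ _ := Nat.mul_le_mul (Nat.factorial_pos _)
              (Nat.pow_le_pow_right (by positivity) (by omega))
      refine le_trans ?_ h2
      zify
      rw [← hcF]; exact h1
    · rw [← hc, aeval_C] at h1
      rw [← Int.natCast_dvd, ← ZMod.intCast_zmod_eq_zero_iff_dvd]
      simpa using h1

lemma shiftProd_eq_of_map_eq {k p : ℕ} {x y : Fin k → ℕ} [Fact p.Prime]
    (hx : ∀ i, x i < p) (hy : ∀ i, y i < p)
    (h : (shiftDiff x y).map (Int.castRingHom (ZMod p)) = 0) : shiftDiff x y = 0 := by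
  have key : ∀ z : Fin k → ℕ, (∀ i, z i < p) →
      shiftProd z = ((((shiftProd z).map (Int.castRingHom (ZMod p))).roots.map
        fun a => (X + C (((-a).val : ℕ) : ℤ))).prod) := by
    intro z hz
    have h1 : (shiftProd z).map (Int.castRingHom (ZMod p)) =
        ((univ.val.map fun i => -(z i : ZMod p)).map fun a => X - C a).prod := by
      rw [shiftProd, Polynomial.map_prod, Multiset.map_map]
      exact prod_congr rfl fun i _ => by simp
    rw [h1, roots_multiset_prod_X_sub_C, Multiset.map_map]
    simp only [Function.comp_def, neg_neg, ZMod.val_cast_of_lt (hz _)]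
    rfl
  rw [shiftDiff, Polynomial.map_sub, sub_eq_zero] at h
  rw [shiftDiff, key x hx, key y hy, h, sub_self]

lemma card_roots_shiftDiff_le {k p : ℕ} {x y : Fin k → ℕ} [Fact p.Prime]
    (hx : ∀ i, x i < p) (hy : ∀ i, y i < p) (h0 : shiftDiff x y ≠ 0) :
    #{s : ZMod p | aeval s (shiftDiff x y) = 0} ≤ k := by
  have hne : (shiftDiff x y).map (Int.castRingHom (ZMod p)) ≠ 0 :=
    fun h => h0 (shiftProd_eq_of_map_eq hx hy h)
  calc #{s : ZMod p | aeval s (shiftDiff x y) = 0}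
      ≤ #((shiftDiff x y).map (Int.castRingHom (ZMod p))).roots.toFinset := by
        refine card_le_card fun s hs => ?_
        rw [Multiset.mem_toFinset, mem_roots hne, IsRoot, eval_map, ← (mem_filter.1 hs).2]
        rfl
    _ ≤ _ := Multiset.toFinset_card_le _
    _ ≤ _ := card_roots' _
    _ ≤ _ := natDegree_map_le
    _ ≤ k := natDegree_shiftDiff_le x y

lemma exists_irreducible_factor_of_root {F : ℤ[X]} (hF : F ≠ 0) {β : ℂ} (hβ : aeval β F = 0) :
    ∃ f : ℤ[X], f ∣ F ∧ f.natDegree ≠ 0 ∧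
      ∀ G : ℤ[X], aeval β G = 0 → ∀ γ : ℂ, aeval γ f = 0 → aeval γ G = 0 := by
  obtain ⟨m, hm, u, hu⟩ := UniqueFactorizationMonoid.exists_prime_factors F hF
  have hprod : aeval β m.prod = 0 := by
    have := congrArg (aeval β) hu
    rw [hβ, map_mul] at this
    exact (mul_eq_zero.1 this).resolve_right ((u.isUnit.map (aeval β)).ne_zero)
  rw [map_multiset_prod, Multiset.prod_eq_zero_iff, Multiset.mem_map] at hprod
  obtain ⟨f, hfm, hfβ⟩ := hprod
  have hirr := (hm f hfm).irreducible
  have hdeg : f.natDegree ≠ 0 := by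
    intro h
    obtain ⟨c, rfl⟩ := natDegree_eq_zero.1 h
    rw [aeval_C] at hfβ
    exact (hm _ hfm).ne_zero (by simpa using hfβ)
  refine ⟨f, (Multiset.dvd_prod hfm).trans ⟨u, hu.symm⟩, hdeg, fun G hG γ hγ => ?_⟩
  have hirrQ := (IsPrimitive.Int.irreducible_iff_irreducible_map_cast
    (hirr.isPrimitive hdeg)).1 hirr
  have toQ : ∀ (P : ℤ[X]) (δ : ℂ), aeval δ (P.map (Int.castRingHom ℚ)) = aeval δ P := fun P δ => by
    rw [← algebraMap_int_eq, aeval_map_algebraMap]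
  have hdvd : f.map (Int.castRingHom ℚ) ∣ G.map (Int.castRingHom ℚ) := by
    refine (EuclideanDomain.dvd_or_coprime _ (G.map (Int.castRingHom ℚ)) hirrQ).resolve_right fun hc => ?_
    rcases aeval_ne_zero_of_isCoprime hc β with h | h
    · exact h ((toQ f β).trans hfβ)
    · exact h ((toQ G β).trans hG)
  rw [← toQ]
  exact aeval_eq_zero_of_dvd_aeval_eq_zero hdvd ((toQ f γ).trans hγ)

lemma prod_eval_neg_eq {k : ℕ} {x y : Fin k → ℕ} {f : ℤ[X]}
    (h : ∀ γ : ℂ, aeval γ f = 0 → aeval γ (shiftDiff x y) = 0) :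
    ∏ i, f.eval (-(x i : ℤ)) = ∏ i, f.eval (-(y i : ℤ)) := by
  rcases eq_or_ne f 0 with rfl | hf
  · simp
  set g := f.map (Int.castRingHom ℂ) with hg
  have hg0 : g ≠ 0 := (Polynomial.map_ne_zero_iff (RingHom.injective_int _)).2 hf
  have key : ∀ z : Fin k → ℕ, ((∏ i, f.eval (-(z i : ℤ)) : ℤ) : ℂ) =
      g.leadingCoeff ^ k * (g.roots.map fun r => (-1) ^ k * ∏ i, ((z i : ℂ) + r)).prod := by
    intro z
    have h1 : ∀ i, ((f.eval (-(z i : ℤ)) : ℤ) : ℂ) =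
        g.leadingCoeff * (g.roots.map fun r => -((z i : ℂ) + r)).prod := by
      intro i
      have := (IsAlgClosed.splits g).eval_eq_prod_roots (-(z i : ℂ))
      rw [show (fun r => -((z i : ℂ) + r)) = (fun r => -(z i : ℂ) - r) by ext; ring, ← this, hg,
        eval_map]
      simpa using (eval₂_hom (p := f) (Int.castRingHom ℂ) (-(z i : ℤ))).symm
    push_cast
    rw [prod_congr rfl fun i _ => h1 i, prod_mul_distrib]
    congr 1
    · simp
    · rw [← Multiset.prod_map_prod]
      congr 1
      refine Multiset.map_congr rfl fun r _ => ?_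
      rw [prod_neg]
      simp
  have : ((∏ i, f.eval (-(x i : ℤ)) : ℤ) : ℂ) = ((∏ i, f.eval (-(y i : ℤ)) : ℤ) : ℂ) := by
    rw [key, key]
    congr 2
    refine Multiset.map_congr rfl fun r hr => ?_
    have hr' : aeval r f = 0 := by
      rw [mem_roots hg0, IsRoot, hg, eval_map] at hr
      exact hr
    have := h r hr'
    rw [aeval_shiftDiff, sub_eq_zero] at this
    rw [this]
  exact_mod_cast this

lemma card_filter_eval_dvd_le (A : Finset ℕ) {f : ℤ[X]} {k : ℕ} (hf : f.natDegree ≠ 0)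
    (hfk : f.natDegree ≤ k) {N : ℤ} (hN : N ≠ 0) :
    #(A.filter fun c : ℕ => f.eval (-(c : ℤ)) ∣ N) ≤ k * (2 * #N.natAbs.divisors) := by
  classical
  set S : Finset ℤ := N.natAbs.divisors.image (fun d : ℕ => (d : ℤ)) ∪
    N.natAbs.divisors.image (fun d : ℕ => -(d : ℤ))
  have hS : #S ≤ 2 * #N.natAbs.divisors := by
    refine (card_union_le _ _).trans ?_
    have h1 := card_image_le (s := N.natAbs.divisors) (f := fun d : ℕ => (d : ℤ))
    have h2 := card_image_le (s := N.natAbs.divisors) (f := fun d : ℕ => -(d : ℤ))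
    omega
  refine le_trans ?_ (Nat.mul_le_mul_left k hS)
  refine card_le_mul_card_image_of_maps_to (f := fun c : ℕ => f.eval (-(c : ℤ))) ?_ k ?_
  · intro c hc
    have hd := (mem_filter.1 hc).2
    have hmem : (f.eval (-(c : ℤ))).natAbs ∈ N.natAbs.divisors :=
      Nat.mem_divisors.2 ⟨Int.natAbs_dvd_natAbs.2 hd, by simpa using hN⟩
    rcases Int.natAbs_eq (f.eval (-(c : ℤ))) with h | h
    · exact mem_union_left _ (mem_image.2 ⟨_, hmem, h.symm⟩)
    · exact mem_union_right _ (mem_image.2 ⟨_, hmem, h.symm⟩)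
  · intro v _
    have hne : f - C v ≠ 0 := by
      intro h
      rw [sub_eq_zero.1 h] at hf
      simp at hf
    calc _ ≤ #(f - C v).roots.toFinset := by
          refine card_le_card_of_injOn (fun c : ℕ => -(c : ℤ)) ?_ ?_
          · intro c hc
            have := (mem_filter.1 (mem_coe.1 hc)).2
            rw [mem_coe, Multiset.mem_toFinset, mem_roots hne]
            simp [this]
          · intro a _ b _ h
            simpa using h
      _ ≤ _ := Multiset.toFinset_card_le _
      _ ≤ _ := card_roots' _
      _ = f.natDegree := by rw [natDegree_sub_C]
      _ ≤ k := hfk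

open scoped Classical in
lemma card_common_root_le {k D : ℕ} (A : Finset ℕ) {F : ℤ[X]} (hF : F ≠ 0)
    (hFk : F.natDegree ≤ k) {x : Fin k → ℕ} (hx : ∀ i, F.eval (-(x i : ℤ)) ≠ 0)
    (hD : #(∏ i, F.eval (-(x i : ℤ))).natAbs.divisors ≤ D) :
    #{y ∈ Fintype.piFinset (fun _ : Fin k => A) |
        ∃ β : ℂ, aeval β F = 0 ∧ aeval β (shiftDiff x y) = 0} ≤ k * (k * (2 * D)) ^ k := by
  set g := F.map (Int.castRingHom ℂ) with hg
  have hg0 : g ≠ 0 := (Polynomial.map_ne_zero_iff (RingHom.injective_int _)).2 hF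
  have hsub : {y ∈ Fintype.piFinset (fun _ : Fin k => A) |
        ∃ β : ℂ, aeval β F = 0 ∧ aeval β (shiftDiff x y) = 0} ⊆
      g.roots.toFinset.biUnion fun β => {y ∈ Fintype.piFinset (fun _ : Fin k => A) |
        aeval β F = 0 ∧ aeval β (shiftDiff x y) = 0} := by
    intro y hy
    obtain ⟨hyA, β, h1, h2⟩ := mem_filter.1 hy
    refine mem_biUnion.2 ⟨β, ?_, mem_filter.2 ⟨hyA, h1, h2⟩⟩
    rw [Multiset.mem_toFinset, mem_roots hg0, IsRoot, hg, eval_map]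
    exact h1
  refine (card_le_card hsub).trans ((card_biUnion_le_card_mul _ _ ((k * (2 * D)) ^ k) ?_).trans ?_)
  · intro β _
    by_cases hβ : aeval β F = 0
    swap
    · simp [hβ]
    obtain ⟨f, hfF, hfdeg, hf⟩ := exists_irreducible_factor_of_root hF hβ
    have hfk : f.natDegree ≤ k := (natDegree_le_of_dvd hfF hF).trans hFk
    have hN : ∏ i, F.eval (-(x i : ℤ)) ≠ 0 := prod_ne_zero_iff.2 fun i _ => hx i
    have hY := (card_filter_eval_dvd_le A hfdeg hfk hN).trans
      (Nat.mul_le_mul_left k (Nat.mul_le_mul_left 2 hD))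
    calc _ ≤ #(Fintype.piFinset fun _ : Fin k =>
            (A.filter fun c : ℕ => f.eval (-(c : ℤ)) ∣ ∏ i, F.eval (-(x i : ℤ)))) := by
          refine card_le_card fun y hy => ?_
          obtain ⟨hyA, -, h2⟩ := mem_filter.1 hy
          refine Fintype.mem_piFinset.2 fun j => mem_filter.2 ⟨Fintype.mem_piFinset.1 hyA j, ?_⟩
          refine (dvd_prod_of_mem (fun j => f.eval (-(y j : ℤ))) (mem_univ j)).trans ?_
          rw [← prod_eval_neg_eq (hf _ h2)]
          exact prod_dvd_prod_of_dvd _ _ fun i _ => eval_dvd hfF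
      _ = (#(A.filter fun c : ℕ => f.eval (-(c : ℤ)) ∣ ∏ i, F.eval (-(x i : ℤ)))) ^ k := by
          simp [Fintype.card_piFinset]
      _ ≤ _ := Nat.pow_le_pow_left hY k
  · refine Nat.mul_le_mul_right _ ((Multiset.toFinset_card_le _).trans ((card_roots' _).trans ?_))
    exact natDegree_map_le.trans hFk

section Energy

variable {τ F : Type*} [DecidableEq F]

lemma card_pairs_eq_sum (φ : τ → F) (U V : Finset τ) (Z : Finset F) (hU : ∀ x ∈ U, φ x ∈ Z) :
    #{q ∈ U ×ˢ V | φ q.1 = φ q.2} = ∑ z ∈ Z, #{x ∈ U | φ x = z} * #{x ∈ V | φ x = z} := by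
  rw [card_eq_sum_card_fiberwise (f := fun q : τ × τ => φ q.1) (t := Z)]
  · refine sum_congr rfl fun z _ => ?_
    rw [← card_product, filter_filter, ← filter_product]
    congr 1
    refine filter_congr fun q _ => ⟨fun h => ⟨h.2, h.1.symm.trans h.2⟩, fun h => ⟨h.1.trans h.2.symm, h.1⟩⟩
  · intro q hq
    exact hU _ (mem_product.1 (mem_filter.1 hq).1).1

lemma card_sq_le_mul_card_pairs (φ : τ → F) (U : Finset τ) (Z : Finset F)
    (hU : ∀ x ∈ U, φ x ∈ Z) : #U ^ 2 ≤ #Z * #{q ∈ U ×ˢ U | φ q.1 = φ q.2} := by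
  rw [card_pairs_eq_sum φ U U Z hU, card_eq_sum_card_fiberwise (f := φ) (t := Z) hU]
  simpa [sq] using sq_sum_le_card_mul_sum_sq (s := Z) (f := fun z => #{x ∈ U | φ x = z})

lemma card_pairs_sq_le (φ : τ → F) (U V : Finset τ) :
    #{q ∈ U ×ˢ V | φ q.1 = φ q.2} ^ 2 ≤
      #{q ∈ U ×ˢ U | φ q.1 = φ q.2} * #{q ∈ V ×ˢ V | φ q.1 = φ q.2} := by
  classical
  have hU : ∀ x ∈ U, φ x ∈ (U ∪ V).image φ := fun x hx =>
    mem_image_of_mem _ (mem_union_left _ hx)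
  have hV : ∀ x ∈ V, φ x ∈ (U ∪ V).image φ := fun x hx =>
    mem_image_of_mem _ (mem_union_right _ hx)
  rw [card_pairs_eq_sum φ U V _ hU, card_pairs_eq_sum φ U U _ hU, card_pairs_eq_sum φ V V _ hV]
  simpa [sq] using sum_mul_sq_le_sq_mul_sq ((U ∪ V).image φ)
    (fun z => #{x ∈ U | φ x = z}) (fun z => #{x ∈ V | φ x = z})

end Energy

section ProductEnergy

variable {F : Type*} [Field F] [DecidableEq F] {k : ℕ}

/-- Pairs of `k`-tuples from `A` whose images under `g` have equal products. -/
def productPairs (g : ℕ → F) (A : Finset ℕ) (k : ℕ) : Finset ((Fin k → ℕ) × (Fin k → ℕ)) :=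
  {q ∈ Fintype.piFinset (fun _ : Fin k => A) ×ˢ Fintype.piFinset (fun _ : Fin k => A) |
    ∏ i, g (q.1 i) = ∏ i, g (q.2 i)}

lemma card_pow_sq_le_mul_card_productPairs (g : ℕ → F) (A : Finset ℕ) (Z : Finset F)
    (hZ : ∀ x ∈ Fintype.piFinset (fun _ : Fin k => A), ∏ i, g (x i) ∈ Z) :
    (#A ^ k) ^ 2 ≤ #Z * #(productPairs g A k) := by
  have := card_sq_le_mul_card_pairs (fun x : Fin k → ℕ => ∏ i, g (x i)) _ Z hZ
  rwa [Fintype.card_piFinset_const] at this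

lemma card_pairs_fixed_le {g : ℕ → F} {A : Finset ℕ} (hg : ∀ a ∈ A, g a ≠ 0) (i : Fin k)
    {c c' : ℕ} (hc : c ∈ A) (hc' : c' ∈ A) :
    #{q ∈ productPairs g A k | q.1 i = c ∧ q.2 i = c} ≤
      #{q ∈ productPairs g A k | q.1 i = c' ∧ q.2 i = c'} := by
  have hmem : ∀ x ∈ Fintype.piFinset (fun _ : Fin k => A),
      Function.update x i c' ∈ Fintype.piFinset (fun _ : Fin k => A) := by
    intro x hx
    rw [Fintype.mem_piFinset] at hx ⊢
    intro j
    rcases eq_or_ne j i with rfl | h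
    · simpa using hc'
    · simpa [h] using hx j
  have hprod : ∀ x : Fin k → ℕ, x i = c →
      (∏ j, g (Function.update x i c' j)) * g c = (∏ j, g (x j)) * g c' := by
    intro x hx
    have h1 := Fintype.prod_eq_mul_prod_compl i fun j => g (Function.update x i c' j)
    have h2 := Fintype.prod_eq_mul_prod_compl i fun j => g (x j)
    rw [h1, h2, hx]
    have : ∏ j ∈ {i}ᶜ, g (Function.update x i c' j) = ∏ j ∈ {i}ᶜ, g (x j) :=
      prod_congr rfl fun j hj => by
        rw [Function.update_of_ne (by simpa using hj)]
    rw [this, Function.update_self]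
    ring
  have hback : ∀ x : Fin k → ℕ, x i = c → Function.update (Function.update x i c') i c = x := by
    intro x hx
    rw [Function.update_idem, ← hx, Function.update_eq_self]
  refine card_le_card_of_injOn
    (fun q => (Function.update q.1 i c', Function.update q.2 i c')) ?_ ?_
  · intro q hq
    obtain ⟨hq, h1, h2⟩ := mem_filter.1 (mem_coe.1 hq)
    obtain ⟨hq, h3⟩ := mem_filter.1 hq
    obtain ⟨h4, h5⟩ := mem_product.1 hq
    refine mem_coe.2 (mem_filter.2 ⟨mem_filter.2 ⟨mem_product.2 ⟨hmem _ h4, hmem _ h5⟩, ?_⟩, ?_⟩)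
    · refine mul_right_cancel₀ (hg c hc) ?_
      rw [hprod _ h1, hprod _ h2, h3]
    · simp
  · intro q hq q' hq' h
    obtain ⟨-, h1, h2⟩ := mem_filter.1 (mem_coe.1 hq)
    obtain ⟨-, h1', h2'⟩ := mem_filter.1 (mem_coe.1 hq')
    obtain ⟨e1, e2⟩ := Prod.mk.inj h
    refine Prod.ext ?_ ?_
    · rw [← hback _ h1, e1, hback _ h1']
    · rw [← hback _ h2, e2, hback _ h2']

lemma card_productPairs_coord_sq_le {g : ℕ → F} {A : Finset ℕ} (hg : ∀ a ∈ A, g a ≠ 0)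
    (i : Fin k) {c : ℕ} (hc : c ∈ A) :
    #{q ∈ productPairs g A k | q.1 i = c} ^ 2 * #A ≤ #(productPairs g A k) ^ 2 := by
  set T := Fintype.piFinset (fun _ : Fin k => A)
  set φ : (Fin k → ℕ) → F := fun x => ∏ i, g (x i)
  have h1 : #{q ∈ productPairs g A k | q.1 i = c} =
      #{q ∈ {x ∈ T | x i = c} ×ˢ T | φ q.1 = φ q.2} := by
    congr 1
    ext q
    simp only [productPairs, mem_filter, mem_product]
    tauto
  have h2 : #{q ∈ productPairs g A k | q.1 i = c ∧ q.2 i = c} =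
      #{q ∈ {x ∈ T | x i = c} ×ˢ {x ∈ T | x i = c} | φ q.1 = φ q.2} := by
    congr 1
    ext q
    simp only [productPairs, mem_filter, mem_product]
    tauto
  have h3 : #A * #{q ∈ productPairs g A k | q.1 i = c ∧ q.2 i = c} ≤ #(productPairs g A k) := by
    calc _ = ∑ _c' ∈ A, #{q ∈ productPairs g A k | q.1 i = c ∧ q.2 i = c} := by simp
      _ ≤ ∑ c' ∈ A, #{q ∈ productPairs g A k | q.1 i = c' ∧ q.2 i = c'} :=
        sum_le_sum fun c' hc' => card_pairs_fixed_le hg i hc hc'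
      _ = #(A.biUnion fun c' => {q ∈ productPairs g A k | q.1 i = c' ∧ q.2 i = c'}) := by
        rw [card_biUnion]
        intro a _ b _ hab
        refine disjoint_filter.2 fun q _ h h' => hab (h.1.symm.trans h'.1)
      _ ≤ _ := card_le_card (biUnion_subset.2 fun c' _ => filter_subset _ _)
  have h4 := card_pairs_sq_le φ {x ∈ T | x i = c} T
  rw [← h1, ← h2] at h4
  calc _ ≤ #{q ∈ productPairs g A k | q.1 i = c ∧ q.2 i = c} * #(productPairs g A k) * #A :=
        Nat.mul_le_mul_right _ h4
    _ = #A * #{q ∈ productPairs g A k | q.1 i = c ∧ q.2 i = c} * #(productPairs g A k) := by ring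
    _ ≤ _ := by rw [sq]; exact Nat.mul_le_mul_right _ h3

end ProductEnergy

/-- The polynomials `shiftDiff` attached to two pairs of tuples are nonzero and coprime. -/
def CoprimeShiftDiff {k : ℕ} (q r : (Fin k → ℕ) × (Fin k → ℕ)) : Prop :=
  shiftDiff q.1 q.2 ≠ 0 ∧ shiftDiff r.1 r.2 ≠ 0 ∧
    ∀ β : ℂ, aeval β (shiftDiff q.1 q.2) ≠ 0 ∨ aeval β (shiftDiff r.1 r.2) ≠ 0

/-- Pairs of tuples with entries in `[1, H]`. -/
def boxPairs (k H : ℕ) : Finset ((Fin k → ℕ) × (Fin k → ℕ)) :=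
  Fintype.piFinset (fun _ => Icc 1 H) ×ˢ Fintype.piFinset (fun _ => Icc 1 H)

open scoped Classical in
/-- Coprime pairs of polynomials `shiftDiff` with entries in `[1, H]`. -/
noncomputable def coprimeQuads (k H : ℕ) :
    Finset (((Fin k → ℕ) × (Fin k → ℕ)) × ((Fin k → ℕ) × (Fin k → ℕ))) :=
  {w ∈ boxPairs k H ×ˢ boxPairs k H | CoprimeShiftDiff w.1 w.2}

/-- The elements of `coprimeQuads` having `s` as a common root modulo `p`. -/
noncomputable def coprimeQuadsAt (k H p : ℕ) (s : ZMod p) :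
    Finset (((Fin k → ℕ) × (Fin k → ℕ)) × ((Fin k → ℕ) × (Fin k → ℕ))) :=
  {w ∈ coprimeQuads k H |
    aeval s (shiftDiff w.1.1 w.1.2) = 0 ∧ aeval s (shiftDiff w.2.1 w.2.2) = 0}

lemma mem_image_of_shiftDiff_eq_zero {k : ℕ} {x y : Fin k → ℕ} (h : shiftDiff x y = 0)
    (j : Fin k) : y j ∈ univ.image x := by
  have h1 : aeval (-(y j : ℤ)) (shiftDiff x y) = 0 := by simp [h]
  rw [aeval_shiftDiff, prod_eq_zero (f := fun i => ((y i : ℤ)) + -(y j : ℤ)) (mem_univ j)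
    (by simp), sub_zero, prod_eq_zero_iff] at h1
  obtain ⟨i, -, hi⟩ := h1
  exact mem_image.2 ⟨i, mem_univ _, by omega⟩

lemma card_filter_shiftDiff_eq_zero_le {k : ℕ} (A : Finset ℕ) :
    #{q ∈ Fintype.piFinset (fun _ : Fin k => A) ×ˢ Fintype.piFinset (fun _ : Fin k => A) |
      shiftDiff q.1 q.2 = 0} ≤ k ^ k * #A ^ k := by
  classical
  have hsub : {q ∈ Fintype.piFinset (fun _ : Fin k => A) ×ˢ Fintype.piFinset (fun _ : Fin k => A) |
      shiftDiff q.1 q.2 = 0} ⊆ (Fintype.piFinset (fun _ : Fin k => A)).biUnion fun x =>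
        {x} ×ˢ Fintype.piFinset (fun _ : Fin k => univ.image x) := by
    intro q hq
    obtain ⟨hq, h0⟩ := mem_filter.1 hq
    refine mem_biUnion.2 ⟨q.1, (mem_product.1 hq).1, mem_product.2 ⟨by simp, ?_⟩⟩
    exact Fintype.mem_piFinset.2 fun j => mem_image_of_shiftDiff_eq_zero h0 j
  refine (card_le_card hsub).trans ((card_biUnion_le_card_mul _ _ (k ^ k) ?_).trans ?_)
  · intro x _
    rw [card_product, card_singleton, one_mul, Fintype.card_piFinset_const]
    exact Nat.pow_le_pow_left (card_image_le.trans (by simp)) k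
  · simp [mul_comm]

lemma natAbs_prod_eval_shiftDiff_le {k H : ℕ} {x y z : Fin k → ℕ} (hx : ∀ i, x i ≤ H)
    (hy : ∀ i, y i ≤ H) (hz : ∀ i, z i ≤ H) :
    (∏ i, (shiftDiff x y).eval (-(z i : ℤ))).natAbs ≤ (2 * H ^ k) ^ k := by
  have h1 : ∀ c ≤ H, ∀ w : Fin k → ℕ, (∀ i, w i ≤ H) →
      |∏ i, ((w i : ℤ) + -(c : ℤ))| ≤ (H : ℤ) ^ k := by
    intro c hc w hw
    rw [abs_prod]
    refine (prod_le_prod (fun _ _ => abs_nonneg _) (g := fun _ => (H : ℤ)) fun i _ => ?_).trans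
      (by simp)
    have := hw i
    rw [abs_le]; constructor <;> omega
  have h2 : |∏ i, (shiftDiff x y).eval (-(z i : ℤ))| ≤ (2 * (H : ℤ) ^ k) ^ k := by
    rw [abs_prod]
    refine (prod_le_prod (fun _ _ => abs_nonneg _) (g := fun _ => (2 * (H : ℤ) ^ k))
      fun i _ => ?_).trans (by simp)
    have h3 := aeval_shiftDiff x y (-(z i : ℤ))
    rw [coe_aeval_eq_eval] at h3
    rw [h3]
    refine (abs_sub _ _).trans ?_
    have := h1 _ (hz i) x hx
    have := h1 _ (hz i) y hy
    linarith
  zify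
  exact h2

open scoped Classical in
lemma card_common_root_pairs_le {k H D p : ℕ} [Fact p.Prime] {s : ZMod p} {A : Finset ℕ}
    (hA : A ⊆ Icc 1 H) (hs : ∀ a ∈ A, (a : ZMod p) + s ≠ 0)
    (hD : ∀ n : ℕ, n ≠ 0 → n ≤ (2 * H ^ k) ^ k → #n.divisors ≤ D)
    {q : (Fin k → ℕ) × (Fin k → ℕ)}
    (hq : q ∈ productPairs (fun a => (a : ZMod p) + s) A k) (hq0 : shiftDiff q.1 q.2 ≠ 0) :
    (#{r ∈ productPairs (fun a => (a : ZMod p) + s) A k |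
      ∃ β : ℂ, aeval β (shiftDiff q.1 q.2) = 0 ∧ aeval β (shiftDiff r.1 r.2) = 0} : ℝ) ≤
      #A ^ k * (k * (k * (2 * D)) ^ k) +
        k ^ 2 * (#(productPairs (fun a => (a : ZMod p) + s) A k) / √(#A)) := by
  set E := productPairs (fun a => (a : ZMod p) + s) A k with hE
  set F := shiftDiff q.1 q.2 with hF
  set T := Fintype.piFinset (fun _ : Fin k => A) with hT
  obtain ⟨hqT, -⟩ := mem_filter.1 hq
  obtain ⟨hq1, hq2⟩ := mem_product.1 hqT
  have hle : ∀ x ∈ T, ∀ i, x i ≤ H := fun x hx i =>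
    (mem_Icc.1 (hA (Fintype.mem_piFinset.1 hx i))).2
  set Z := A.filter fun c : ℕ => F.eval (-(c : ℤ)) = 0 with hZ
  have hZk : #Z ≤ k := by
    calc #Z ≤ #F.roots.toFinset := by
          refine card_le_card_of_injOn (fun c : ℕ => -(c : ℤ)) ?_ ?_
          · intro c hc
            have := (mem_filter.1 (mem_coe.1 hc)).2
            rw [mem_coe, Multiset.mem_toFinset, mem_roots hq0]
            exact this
          · intro a _ b _ h
            simpa using h
      _ ≤ _ := Multiset.toFinset_card_le _
      _ ≤ _ := card_roots' _
      _ ≤ k := natDegree_shiftDiff_le _ _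
  set T' := {x ∈ T | ∀ i, F.eval (-(x i : ℤ)) ≠ 0} with hT'
  set U := T'.biUnion fun x => ({x} : Finset (Fin k → ℕ)) ×ˢ {y ∈ T |
    ∃ β : ℂ, aeval β F = 0 ∧ aeval β (shiftDiff x y) = 0} with hU
  set V := (univ : Finset (Fin k)).biUnion fun i => Z.biUnion fun c => {r ∈ E | r.1 i = c} with hV
  have hsub : {r ∈ E | ∃ β : ℂ, aeval β F = 0 ∧ aeval β (shiftDiff r.1 r.2) = 0} ⊆ U ∪ V := by
    intro r hr
    obtain ⟨hrE, hβ⟩ := mem_filter.1 hr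
    obtain ⟨hr1, hr2⟩ := mem_product.1 (mem_filter.1 hrE).1
    by_cases h : ∀ i, F.eval (-(r.1 i : ℤ)) ≠ 0
    · refine mem_union_left _ (mem_biUnion.2 ⟨r.1, mem_filter.2 ⟨hr1, h⟩, mem_product.2 ⟨by simp, ?_⟩⟩)
      exact mem_filter.2 ⟨hr2, hβ⟩
    · push Not at h
      obtain ⟨i, hi⟩ := h
      refine mem_union_right _ (mem_biUnion.2 ⟨i, mem_univ _, mem_biUnion.2 ⟨r.1 i, ?_, ?_⟩⟩)
      · exact mem_filter.2 ⟨Fintype.mem_piFinset.1 hr1 i, hi⟩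
      · exact mem_filter.2 ⟨hrE, rfl⟩
  have hUc : #U ≤ #A ^ k * (k * (k * (2 * D)) ^ k) := by
    have h1 : #U ≤ #T' * (k * (k * (2 * D)) ^ k) := by
      refine card_biUnion_le_card_mul _ _ _ fun x hx => ?_
      obtain ⟨hxT, hx0⟩ := mem_filter.1 hx
      rw [card_product, card_singleton, one_mul]
      refine card_common_root_le A hq0 (natDegree_shiftDiff_le _ _) hx0 (hD _ ?_ ?_)
      · simpa [prod_eq_zero_iff] using hx0
      · exact natAbs_prod_eval_shiftDiff_le (hle _ hq1) (hle _ hq2) (hle _ hxT)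
    refine h1.trans (Nat.mul_le_mul_right _ ((card_filter_le _ _).trans ?_))
    rw [hT, Fintype.card_piFinset_const]
  have hVc : (#V : ℝ) ≤ k ^ 2 * (#E / √(#A)) := by
    have h1 : ∀ i : Fin k, ∀ c ∈ Z, (#{r ∈ E | r.1 i = c} : ℝ) ≤ #E / √(#A) := by
      intro i c hc
      have hcA : c ∈ A := (mem_filter.1 hc).1
      have h2 := card_productPairs_coord_sq_le (g := fun a => (a : ZMod p) + s) hs i hcA
      have hpos : (0 : ℝ) < #A := by exact_mod_cast card_pos.2 ⟨c, hcA⟩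
      rw [le_div_iff₀ (Real.sqrt_pos.2 hpos)]
      refine abs_le_of_sq_le_sq' ?_ (by positivity) |>.2
      rw [mul_pow, Real.sq_sqrt hpos.le]
      exact_mod_cast h2
    calc (#V : ℝ) ≤ ∑ i : Fin k, ∑ c ∈ Z, (#{r ∈ E | r.1 i = c} : ℝ) := by
          refine (Nat.cast_le.2 card_biUnion_le).trans ?_
          push_cast
          refine sum_le_sum fun i _ => (Nat.cast_le.2 card_biUnion_le).trans ?_
          push_cast
          exact le_rfl
      _ ≤ ∑ i : Fin k, ∑ c ∈ Z, (#E / √(#A) : ℝ) :=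
          sum_le_sum fun i _ => sum_le_sum fun c hc => h1 i c hc
      _ = k * (#Z * (#E / √(#A))) := by simp
      _ ≤ k * (k * (#E / √(#A))) := by
          have : (#Z : ℝ) ≤ k := by exact_mod_cast hZk
          gcongr
      _ = _ := by ring
  calc _ ≤ ((#U + #V : ℕ) : ℝ) := Nat.cast_le.2 ((card_le_card hsub).trans (card_union_le _ _))
    _ ≤ _ := by
      push_cast
      have : (#U : ℝ) ≤ #A ^ k * (k * (k * (2 * D)) ^ k) := by exact_mod_cast hUc
      linarith

lemma card_productPairs_le {k H D B p : ℕ} [Fact p.Prime] {s : ZMod p} {A : Finset ℕ}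
    (hk : 1 ≤ k) (hA : A ⊆ Icc 1 H) (hs : ∀ a ∈ A, (a : ZMod p) + s ≠ 0)
    (hAk : 64 * k ^ 4 ≤ #A) (hD1 : 1 ≤ D)
    (hD : ∀ n : ℕ, n ≠ 0 → n ≤ (2 * H ^ k) ^ k → #n.divisors ≤ D)
    (hB : #(coprimeQuadsAt k H p s) ≤ B) :
    #(productPairs (fun a => (a : ZMod p) + s) A k) ^ 2 ≤ 16 * B ∨
      #(productPairs (fun a => (a : ZMod p) + s) A k) ≤ 16 * (k * (k * (2 * D)) ^ k) * #A ^ k := by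
  classical
  set E := productPairs (fun a => (a : ZMod p) + s) A k with hE
  set S := {q ∈ E | shiftDiff q.1 q.2 ≠ 0} with hS
  set Q : ℕ := k * (k * (2 * D)) ^ k with hQ
  have htriv : #E ≤ #S + k ^ k * #A ^ k := by
    have h1 : #S + #{q ∈ E | ¬ shiftDiff q.1 q.2 ≠ 0} = #E := card_filter_add_card_filter_not _
    have h2 : #{q ∈ E | ¬ shiftDiff q.1 q.2 ≠ 0} ≤ k ^ k * #A ^ k := by
      refine le_trans (card_le_card ?_) (card_filter_shiftDiff_eq_zero_le A)
      intro q hq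
      obtain ⟨h3, h4⟩ := mem_filter.1 hq
      exact mem_filter.2 ⟨(mem_filter.1 h3).1, not_not.1 h4⟩
    omega
  have hbox : ∀ q ∈ E, q ∈ boxPairs k H := by
    intro q hq
    obtain ⟨h1, h2⟩ := mem_product.1 (mem_filter.1 hq).1
    exact mem_product.2 ⟨Fintype.piFinset_subset _ _ (fun _ => hA) h1,
      Fintype.piFinset_subset _ _ (fun _ => hA) h2⟩
  have hroot : ∀ q ∈ E, aeval s (shiftDiff q.1 q.2) = 0 := by
    intro q hq
    rw [aeval_shiftDiff, sub_eq_zero]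
    exact (mem_filter.1 hq).2
  have hmain : (#S : ℝ) ^ 2 ≤ B + #S * (#A ^ k * Q + k ^ 2 * (#E / √(#A))) := by
    have hcov : S ×ˢ S ⊆ coprimeQuadsAt k H p s ∪ S.biUnion fun q => {q} ×ˢ {r ∈ E |
        ∃ β : ℂ, aeval β (shiftDiff q.1 q.2) = 0 ∧ aeval β (shiftDiff r.1 r.2) = 0} := by
      intro w hw
      obtain ⟨h1, h2⟩ := mem_product.1 hw
      obtain ⟨h1E, h1z⟩ := mem_filter.1 h1
      obtain ⟨h2E, h2z⟩ := mem_filter.1 h2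
      by_cases h : CoprimeShiftDiff w.1 w.2
      · exact mem_union_left _ (mem_filter.2 ⟨mem_filter.2
          ⟨mem_product.2 ⟨hbox _ h1E, hbox _ h2E⟩, h⟩, hroot _ h1E, hroot _ h2E⟩)
      · refine mem_union_right _ (mem_biUnion.2 ⟨w.1, h1, mem_product.2 ⟨by simp,
          mem_filter.2 ⟨h2E, ?_⟩⟩⟩)
        by_contra! h'
        exact h ⟨h1z, h2z, fun β => or_iff_not_imp_left.2 fun hb => h' β (not_not.1 hb)⟩
    have h1 : #S ^ 2 ≤ B + ∑ q ∈ S, #{r ∈ E |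
        ∃ β : ℂ, aeval β (shiftDiff q.1 q.2) = 0 ∧ aeval β (shiftDiff r.1 r.2) = 0} := by
      rw [sq, ← card_product]
      refine (card_le_card hcov).trans ((card_union_le _ _).trans (add_le_add hB ?_))
      refine card_biUnion_le.trans (sum_le_sum fun q _ => ?_)
      rw [card_product, card_singleton, one_mul]
    have h2 : (#S : ℝ) ^ 2 ≤ B + ∑ q ∈ S, (#{r ∈ E |
        ∃ β : ℂ, aeval β (shiftDiff q.1 q.2) = 0 ∧ aeval β (shiftDiff r.1 r.2) = 0} : ℝ) := by
      exact_mod_cast h1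
    refine h2.trans (add_le_add le_rfl ?_)
    rw [← nsmul_eq_mul]
    refine sum_le_card_nsmul _ _ _ fun q hq => ?_
    obtain ⟨hqE, hq0⟩ := mem_filter.1 hq
    have := card_common_root_pairs_le hA hs hD hqE hq0
    rw [hQ]
    push_cast
    exact this
  have hkQ : k ^ k ≤ Q := by
    rw [hQ]
    calc k ^ k = 1 * (k * 1) ^ k := by simp
      _ ≤ _ := Nat.mul_le_mul hk (Nat.pow_le_pow_left (Nat.mul_le_mul_left _ (by omega)) _)
  have hSE : #S ≤ #E := card_filter_le _ _
  by_contra! hcon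
  obtain ⟨hc1, hc2⟩ := hcon
  have hkA : k ^ k * #A ^ k ≤ Q * #A ^ k := Nat.mul_le_mul_right _ hkQ
  have hApos : (0 : ℝ) < #A := by
    have : 0 < 64 * k ^ 4 := by positivity
    exact_mod_cast this.trans_le hAk
  have hsqrt : 8 * (k : ℝ) ^ 2 ≤ √(#A) := by
    refine Real.le_sqrt_of_sq_le ?_
    have : (64 * k ^ 4 : ℝ) ≤ #A := by exact_mod_cast hAk
    linarith [this, show (8 * (k : ℝ) ^ 2) ^ 2 = 64 * k ^ 4 by ring]
  have hfrac : (k : ℝ) ^ 2 * (#E / √(#A)) ≤ #E / 8 := by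
    rw [← mul_div_assoc, div_le_div_iff₀ (Real.sqrt_pos.2 hApos) (by norm_num)]
    nlinarith [(Nat.cast_nonneg #E : (0 : ℝ) ≤ #E)]
  have e1 : (#E : ℝ) ≤ #S + Q * #A ^ k := by exact_mod_cast htriv.trans (by omega)
  have e2 : (16 * B : ℝ) < (#E : ℝ) ^ 2 := by exact_mod_cast hc1
  have e3 : 16 * (Q : ℝ) * #A ^ k < #E := by exact_mod_cast hc2
  have e4 : (#S : ℝ) ≤ #E := by exact_mod_cast hSE
  have e0 : (0 : ℝ) ≤ #S := Nat.cast_nonneg _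
  have e5 : (0 : ℝ) ≤ #E := Nat.cast_nonneg _
  generalize (#S : ℝ) = S' at *
  generalize (#E : ℝ) = E' at *
  have e6 : (#A : ℝ) ^ k * Q + k ^ 2 * (E' / √(#A)) ≤ 3 * E' / 16 := by linarith
  have e7 : S' ^ 2 ≤ B + E' * (3 * E' / 16) :=
    hmain.trans (add_le_add le_rfl ((mul_le_mul_of_nonneg_left e6 e0).trans
      (mul_le_mul_of_nonneg_right e4 (by positivity))))
  have e8 : 15 * E' / 16 ≤ S' := by linarith
  nlinarith

lemma card_pow_le_of_prod_mem {k H D B p d : ℕ} [Fact p.Prime] {s : ZMod p} {A : Finset ℕ}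
    (hk : 1 ≤ k) (hA : A ⊆ Icc 1 H) (hd : 0 < d) (hs : ∀ a ∈ A, orderOf ((a : ZMod p) + s) = d)
    (hAk : 64 * k ^ 4 ≤ #A) (hD1 : 1 ≤ D)
    (hD : ∀ n : ℕ, n ≠ 0 → n ≤ (2 * H ^ k) ^ k → #n.divisors ≤ D)
    (hB : #(coprimeQuadsAt k H p s) ≤ B) :
    (#A ^ k) ^ 4 ≤ 16 * d ^ 2 * B ∨ #A ^ k ≤ 16 * (k * (k * (2 * D)) ^ k) * d := by
  have hs0 : ∀ a ∈ A, (a : ZMod p) + s ≠ 0 := by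
    intro a ha h
    have := hs a ha
    rw [h, orderOf_zero] at this
    omega
  have hE := card_pow_sq_le_mul_card_productPairs (k := k) (fun a => (a : ZMod p) + s) A
    (nthRootsFinset d (1 : ZMod p)) (by
      intro x hx
      rw [mem_nthRootsFinset hd, ← prod_pow]
      refine prod_eq_one fun i _ => ?_
      rw [← hs _ (Fintype.mem_piFinset.1 hx i), pow_orderOf_eq_one])
  have hcard : #(nthRootsFinset d (1 : ZMod p)) ≤ d := by
    classical
    rw [nthRootsFinset_def]
    exact (Multiset.toFinset_card_le _).trans (card_nthRoots _ _)
  set E := #(productPairs (fun a => (a : ZMod p) + s) A k)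
  have h1 : (#A ^ k) ^ 2 ≤ d * E := hE.trans (Nat.mul_le_mul_right _ hcard)
  have hApos : 0 < #A ^ k := by
    have : 0 < 64 * k ^ 4 := by positivity
    exact pow_pos (this.trans_le hAk) _
  refine (card_productPairs_le hk hA hs0 hAk hD1 hD hB).imp (fun h => ?_) (fun h => ?_)
  · calc (#A ^ k) ^ 4 = ((#A ^ k) ^ 2) ^ 2 := by ring
      _ ≤ (d * E) ^ 2 := Nat.pow_le_pow_left h1 2
      _ = d ^ 2 * E ^ 2 := by ring
      _ ≤ d ^ 2 * (16 * B) := Nat.mul_le_mul_left _ h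
      _ = _ := by ring
  · refine Nat.le_of_mul_le_mul_right ?_ hApos
    calc #A ^ k * #A ^ k = (#A ^ k) ^ 2 := by ring
      _ ≤ d * E := h1
      _ ≤ d * (16 * (k * (k * (2 * D)) ^ k) * #A ^ k) := Nat.mul_le_mul_left _ h
      _ = _ := by ring

lemma shiftDiff_add {k : ℕ} (x y : Fin k → ℕ) (t : ℕ) :
    shiftDiff (fun i => x i + t) (fun i => y i + t) = (shiftDiff x y).comp (X + C (t : ℤ)) := by
  simp only [shiftDiff, shiftProd, sub_comp, Polynomial.prod_comp]
  simp [add_assoc, add_comm (t : ℤ[X])]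

lemma shiftDiff_add_ne_zero {k : ℕ} {x y : Fin k → ℕ} (h : shiftDiff x y ≠ 0) (t : ℕ) :
    shiftDiff (fun i => x i + t) (fun i => y i + t) ≠ 0 := by
  rw [shiftDiff_add, ← taylor_apply]
  exact fun h0 => h (taylor_injective _ (h0.trans (map_zero _).symm))

lemma aeval_shiftDiff_add {R : Type*} [CommRing R] {k : ℕ} (x y : Fin k → ℕ) (t : ℕ) (s : R) :
    aeval s (shiftDiff (fun i => x i + t) (fun i => y i + t)) = aeval (s + t) (shiftDiff x y) := by
  rw [shiftDiff_add, aeval_comp]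
  simp

open scoped Classical in
lemma card_coprimeQuadsAt_shift_le {k H p t : ℕ} (ht : t ≤ H) (s : ZMod p) :
    #(coprimeQuadsAt k H p s) ≤ #(coprimeQuadsAt k (2 * H) p (s - t)) := by
  have hbox : ∀ x ∈ Fintype.piFinset (fun _ : Fin k => Icc 1 H),
      (fun i => x i + t) ∈ Fintype.piFinset (fun _ : Fin k => Icc 1 (2 * H)) := by
    intro x hx
    refine Fintype.mem_piFinset.2 fun i => ?_
    have := mem_Icc.1 (Fintype.mem_piFinset.1 hx i)
    exact mem_Icc.2 (by omega)
  refine card_le_card_of_injOn (fun w => (((fun i => w.1.1 i + t), (fun i => w.1.2 i + t)),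
    ((fun i => w.2.1 i + t), (fun i => w.2.2 i + t)))) ?_ ?_
  · intro w hw
    obtain ⟨hw1, hw2, hw3⟩ := mem_filter.1 hw
    obtain ⟨hw4, hw5, hw6, hw7⟩ := mem_filter.1 hw1
    obtain ⟨hw8, hw9⟩ := mem_product.1 hw4
    obtain ⟨h1, h2⟩ := mem_product.1 hw8
    obtain ⟨h3, h4⟩ := mem_product.1 hw9
    refine mem_filter.2 ⟨mem_filter.2 ⟨mem_product.2 ⟨mem_product.2 ⟨hbox _ h1, hbox _ h2⟩,
      mem_product.2 ⟨hbox _ h3, hbox _ h4⟩⟩, shiftDiff_add_ne_zero hw5 t,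
      shiftDiff_add_ne_zero hw6 t, fun β => ?_⟩, ?_, ?_⟩
    · simp only [aeval_shiftDiff_add]
      exact hw7 _
    · simpa only [aeval_shiftDiff_add, sub_add_cancel] using hw2
    · simpa only [aeval_shiftDiff_add, sub_add_cancel] using hw3
  · rintro ⟨⟨a, b⟩, c, d⟩ - ⟨⟨a', b'⟩, c', d'⟩ - h
    simpa [funext_iff] using h

open scoped Classical in
lemma card_coprimeQuads_le (k H : ℕ) : #(coprimeQuads k H) ≤ H ^ (4 * k) := by
  refine (card_filter_le _ _).trans ?_
  simp only [boxPairs, card_product, Fintype.card_piFinset_const, Nat.card_Icc,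
    Nat.add_sub_cancel]
  exact le_of_eq (by ring)

open scoped Classical in
/-- Few primes have a residue class `s p` at which many coprime pairs vanish. -/
lemma mul_card_primes_le {k H D B : ℕ} (P : Finset ℕ) (s : ∀ p : ℕ, ZMod p)
    (hP : ∀ p ∈ P, p.Prime ∧ 2 * H < p ∧ B ≤ #(coprimeQuadsAt k H p (s p)))
    (hD : ∀ n : ℕ, n ≠ 0 → n ≤ (2 * k).factorial * ((2 * H + 1) ^ k) ^ (2 * k) →
      #n.divisors ≤ D) :
    #P * (H * B) ≤ (2 * H) ^ (4 * k) * (D * k) := by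
  have hfib : ∀ w ∈ coprimeQuads k (2 * H),
      ∑ p ∈ P, #((range H).filter fun t : ℕ => w ∈ coprimeQuadsAt k (2 * H) p (s p - t)) ≤ D * k := by
    intro w hw
    obtain ⟨hw1, hw2, hw3, hw4⟩ := mem_filter.1 hw
    have hle : ∀ x ∈ Fintype.piFinset (fun _ : Fin k => Icc 1 (2 * H)), ∀ i, x i ≤ 2 * H :=
      fun x hx i => (mem_Icc.1 (Fintype.mem_piFinset.1 hx i)).2
    obtain ⟨h12, h34⟩ := mem_product.1 hw1
    obtain ⟨h1, h2⟩ := mem_product.1 h12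
    obtain ⟨h3, h4⟩ := mem_product.1 h34
    obtain ⟨R, hR0, hRle, hR⟩ := exists_common_root_modulus (hle _ h1) (hle _ h2) (hle _ h3)
      (hle _ h4) hw2 hw4
    have hdvd : ∀ p ∈ P, #((range H).filter fun t : ℕ => w ∈ coprimeQuadsAt k (2 * H) p (s p - t)) ≠ 0 →
        p ∈ R.divisors := by
      intro p hp h
      obtain ⟨t, ht⟩ := card_ne_zero.1 h
      obtain ⟨-, h5, h6⟩ := mem_filter.1 (mem_filter.1 ht).2
      exact Nat.mem_divisors.2 ⟨hR p _ h5 h6, hR0⟩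
    have hk : ∀ p ∈ P, #((range H).filter fun t : ℕ => w ∈ coprimeQuadsAt k (2 * H) p (s p - t)) ≤ k := by
      intro p hp
      obtain ⟨hpp, hpH, -⟩ := hP p hp
      have := Fact.mk hpp
      refine le_trans ?_ (card_roots_shiftDiff_le (p := p)
        (fun i => (hle _ h1 i).trans_lt hpH) (fun i => (hle _ h2 i).trans_lt hpH) hw2)
      refine card_le_card_of_injOn (fun t : ℕ => s p - t) ?_ ?_
      · intro t ht
        exact mem_filter.2 ⟨mem_univ _, (mem_filter.1 (mem_filter.1 ht).2).2.1⟩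
      · intro t ht t' ht' h
        have h5 : (t : ZMod p) = t' := sub_right_injective h
        have h6 := mem_range.1 (mem_filter.1 ht).1
        have h7 := mem_range.1 (mem_filter.1 ht').1
        rw [ZMod.natCast_eq_natCast_iff'] at h5
        rwa [Nat.mod_eq_of_lt (by omega), Nat.mod_eq_of_lt (by omega)] at h5
    rw [← sum_filter_ne_zero]
    refine (sum_le_card_nsmul _ _ k fun p hp => hk p (mem_filter.1 hp).1).trans ?_
    rw [smul_eq_mul]
    refine Nat.mul_le_mul_right _ (le_trans (card_le_card fun p hp => ?_) (hD R hR0 hRle))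
    exact hdvd p (mem_filter.1 hp).1 (mem_filter.1 hp).2
  have hcount : ∀ p ∈ P, H * B ≤ ∑ w ∈ coprimeQuads k (2 * H),
      #((range H).filter fun t : ℕ => w ∈ coprimeQuadsAt k (2 * H) p (s p - t)) := by
    intro p hp
    have h1 : ∑ w ∈ coprimeQuads k (2 * H),
        #((range H).filter fun t : ℕ => w ∈ coprimeQuadsAt k (2 * H) p (s p - t)) =
        ∑ t ∈ range H, #{w ∈ coprimeQuads k (2 * H) |
          w ∈ coprimeQuadsAt k (2 * H) p (s p - t)} :=
      sum_card_bipartiteAbove_eq_sum_card_bipartiteBelow _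
    rw [h1]
    calc H * B = ∑ t ∈ range H, B := by simp
      _ ≤ _ := sum_le_sum fun t ht => ?_
    refine ((hP p hp).2.2.trans
      (card_coprimeQuadsAt_shift_le (mem_range.1 ht).le (s p))).trans (card_le_card fun w hw => ?_)
    exact mem_filter.2 ⟨(mem_filter.1 hw).1, hw⟩
  calc #P * (H * B) = ∑ p ∈ P, H * B := by simp
    _ ≤ _ := sum_le_sum hcount
    _ = _ := sum_comm
    _ ≤ ∑ w ∈ coprimeQuads k (2 * H), D * k := sum_le_sum hfib
    _ ≤ _ := by
      rw [sum_const, smul_eq_mul]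
      exact Nat.mul_le_mul_right _ (card_coprimeQuads_le k _)

section Asymptotics

open Real Filter

/-- The scale `exp (log T / log log T)` controlling the divisor function up to `T`. -/
noncomputable def divisorScale (T : ℝ) : ℝ := exp (log T / log (log T))

lemma divisorScale_pos (T : ℝ) : 0 < divisorScale T := exp_pos _

lemma log_sq_le_mul_eventually (c : ℝ) (hc : 0 < c) : ∀ᶠ u : ℝ in atTop, log u ^ 2 ≤ c * u := by
  have h := (isLittleO_pow_log_id_atTop (n := 2)).bound hc
  filter_upwards [h, eventually_ge_atTop 0] with u hu hu0
  simpa [abs_of_nonneg hu0] using hu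

lemma log_pow_le_divisorScale (n : ℕ) : ∀ᶠ T : ℝ in atTop, log T ^ n ≤ divisorScale T := by
  have h : ∀ᶠ u : ℝ in atTop, u ^ n ≤ exp (u / log u) := by
    filter_upwards [log_sq_le_mul_eventually (1 / (n + 1)) (by positivity),
      eventually_gt_atTop 1] with u hu hu1
    have hl : 0 < log u := log_pos hu1
    rw [← exp_log (pow_pos (by linarith : 0 < u) n), log_pow, exp_le_exp, le_div_iff₀ hl]
    rw [one_div, inv_mul_eq_div, le_div_iff₀ (by positivity)] at hu
    nlinarith [sq_nonneg (log u)]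
  exact tendsto_log_atTop.eventually h

lemma tendsto_divisorScale : Tendsto divisorScale atTop atTop :=
  tendsto_atTop_mono' _ ((log_pow_le_divisorScale 1).mono fun T hT => by simpa using hT)
    tendsto_log_atTop

lemma divisorScale_pow_le_rpow (n : ℕ) {δ : ℝ} (hδ : 0 < δ) :
    ∀ᶠ T : ℝ in atTop, divisorScale T ^ n ≤ T ^ δ := by
  have h : ∀ᶠ u : ℝ in atTop, n * (u / log u) ≤ δ * u := by
    filter_upwards [tendsto_log_atTop.eventually_ge_atTop (n / δ), eventually_gt_atTop 1]
      with u hu hu1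
    have hl : 0 < log u := log_pos hu1
    rw [← mul_div_assoc, div_le_iff₀ hl]
    rw [div_le_iff₀ hδ] at hu
    nlinarith
  filter_upwards [tendsto_log_atTop.eventually h, eventually_gt_atTop 0] with T hT hT0
  rw [divisorScale, ← exp_nat_mul, rpow_def_of_pos hT0, exp_le_exp, mul_comm (log T)]
  exact hT

lemma log_card_divisors_le {n : ℕ} (hn : n ≠ 0) {y : ℝ} (hy : 1 < y) :
    log #n.divisors ≤ y * log (1 + 2 * log n) + log n / log y := by
  have hly : 0 < log y := log_pos hy
  have hln : 0 ≤ log n := log_natCast_nonneg n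
  have hfac : (log n : ℝ) = ∑ p ∈ n.primeFactors, n.factorization p * log p := by
    conv_lhs => rw [← Nat.prod_factorization_pow_eq_self hn]
    rw [Finsupp.prod, Nat.support_factorization, Nat.cast_prod, log_prod]
    · simp
    · intro p hp
      have := (Nat.prime_of_mem_primeFactors hp).pos
      positivity
  have hterm : ∀ p ∈ n.primeFactors, 0 ≤ (n.factorization p : ℝ) * log p :=
    fun p hp => mul_nonneg (by positivity) (log_natCast_nonneg p)
  have hone : ∀ p ∈ n.primeFactors, log ((n.factorization p + 1 : ℕ) : ℝ) ≤
      (if (p : ℝ) < y then log (1 + 2 * log n) else 0) +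
        n.factorization p * log p / log y := by
    intro p hp
    have hv := hterm p hp
    have hp2 : (2 : ℝ) ≤ p := by exact_mod_cast (Nat.prime_of_mem_primeFactors hp).two_le
    have hlp : log 2 ≤ log p := log_le_log (by norm_num) hp2
    have hv0 : (0 : ℝ) ≤ n.factorization p := by positivity
    split_ifs with h
    · have h1 : (n.factorization p : ℝ) * log p ≤ log n := by
        rw [hfac]; exact single_le_sum hterm hp
      have h2 : (n.factorization p : ℝ) ≤ 2 * log n := by
        nlinarith [log_two_gt_d9]
      have h3 : log ((n.factorization p + 1 : ℕ) : ℝ) ≤ log (1 + 2 * log n) := by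
        refine log_le_log (by positivity) ?_
        push_cast; linarith
      have : 0 ≤ (n.factorization p : ℝ) * log p / log y := by positivity
      linarith
    · have h1 : log y ≤ log p := log_le_log (by linarith) (not_lt.1 h)
      have h2 : log ((n.factorization p + 1 : ℕ) : ℝ) ≤ n.factorization p := by
        refine (log_le_sub_one_of_pos (by positivity)).trans ?_
        push_cast; linarith
      have h3 : (n.factorization p : ℝ) ≤ n.factorization p * log p / log y := by
        rw [le_div_iff₀ hly]
        exact mul_le_mul_of_nonneg_left h1 hv0
      linarith
  have hsmall : (#{p ∈ n.primeFactors | ((p : ℕ) : ℝ) < y} : ℝ) ≤ y := by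
    have h1 : {p ∈ n.primeFactors | ((p : ℕ) : ℝ) < y} ⊆ Icc 1 ⌊y⌋₊ := by
      intro p hp
      obtain ⟨h2, h3⟩ := mem_filter.1 hp
      exact mem_Icc.2 ⟨(Nat.prime_of_mem_primeFactors h2).one_le, Nat.le_floor h3.le⟩
    have h2 := card_le_card h1
    rw [Nat.card_Icc, Nat.add_sub_cancel] at h2
    exact (Nat.cast_le.2 h2).trans (Nat.floor_le (by linarith))
  rw [Nat.card_divisors hn, Nat.cast_prod, log_prod (fun p _ => by positivity)]
  refine (sum_le_sum hone).trans ?_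
  rw [sum_add_distrib, ← sum_div, ← hfac, ← sum_filter, sum_const, nsmul_eq_mul]
  gcongr
  exact log_nonneg (by linarith)

lemma card_divisors_le_divisorScale (m : ℕ) : ∀ᶠ T : ℝ in atTop, ∀ n : ℕ, n ≠ 0 →
    (n : ℝ) ≤ T ^ m → (#n.divisors : ℝ) ≤ divisorScale T ^ (2 * m + 1) := by
  have h : ∀ᶠ u : ℝ in atTop, 1 < u ∧ √u * log (1 + 2 * (m * u)) + m * u / log √u ≤
      (2 * m + 1 : ℕ) * (u / log u) := by
    have h1 : ∀ᶠ u : ℝ in atTop, log √u ^ 2 ≤ (1 / 8) * √u :=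
      tendsto_sqrt_atTop.eventually (log_sq_le_mul_eventually (1 / 8) (by norm_num))
    filter_upwards [h1, eventually_gt_atTop 1, eventually_ge_atTop (1 + 2 * m : ℝ)]
      with u hu hu1 hum
    refine ⟨hu1, ?_⟩
    have hl : 0 < log u := log_pos hu1
    have hu0 : 0 < u := by linarith
    have h2 : log (1 + 2 * (m * u)) ≤ 2 * log u := by
      rw [← Nat.cast_two, ← log_pow]
      refine log_le_log (by positivity) ?_
      push_cast
      nlinarith
    rw [log_sqrt hu0.le] at hu ⊢
    have h3 : √u * (2 * log u) ≤ u / log u := by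
      rw [le_div_iff₀ hl]
      nlinarith [sq_sqrt hu0.le, sqrt_nonneg u]
    have h4 : √u * log (1 + 2 * (m * u)) ≤ √u * (2 * log u) := by gcongr
    have h5 : m * u / (log u / 2) = 2 * m * (u / log u) := by field_simp
    rw [h5]
    push_cast
    linarith
  filter_upwards [tendsto_log_atTop.eventually h, eventually_gt_atTop 0] with T hT hT0 n hn hnT
  obtain ⟨hu1, hT⟩ := hT
  have hd : (0 : ℝ) < #n.divisors := by
    exact_mod_cast card_pos.2 ⟨1, Nat.one_mem_divisors.2 hn⟩
  have hn0 : (0 : ℝ) < n := by exact_mod_cast Nat.pos_of_ne_zero hn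
  have hln : log n ≤ m * log T := by
    rw [← log_pow]; exact log_le_log hn0 hnT
  have hln0 : 0 ≤ log n := log_natCast_nonneg n
  have hy : 1 < √(log T) := by rw [lt_sqrt (by norm_num)]; linarith
  have hly : 0 < log √(log T) := log_pos hy
  rw [divisorScale, ← exp_nat_mul, ← log_le_iff_le_exp hd]
  refine (log_card_divisors_le hn hy).trans (le_trans ?_ hT)
  gcongr

lemma div_log_le_primeCounting :
    ∀ᶠ T : ℝ in atTop, T / (4 * log T) ≤ (Nat.primeCounting ⌊T⌋₊ : ℝ) := by
  have h : ∀ᶠ T : ℝ in atTop, log T ≤ (1 / 16) * T := by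
    filter_upwards [isLittleO_log_id_atTop.bound (by norm_num : (0 : ℝ) < 1 / 16),
      eventually_ge_atTop 0] with T hT hT0
    exact (le_abs_self _).trans (by simpa [abs_of_nonneg hT0] using hT)
  filter_upwards [h, eventually_ge_atTop 16] with T hT hT16
  refine le_trans ?_ (Chebyshev.pi_ge' (by linarith : 1 < T))
  have hl : 0 < log T := log_pos (by linarith)
  have h2 : log (T + 2) ≤ 2 * log T := by
    rw [← Nat.cast_two, ← log_pow]
    exact log_le_log (by positivity) (by push_cast; nlinarith)
  rw [← div_div]
  gcongr
  nlinarith [log_two_gt_d9]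

end Asymptotics

lemma pow_le_of_orderOf_lt {k H D B p : ℕ} [Fact p.Prime] {s : ZMod p} {K : ℝ}
    (hk : 1 ≤ k) (hHp : H < p) (hH : 128 * k ^ 4 * D ≤ H) (hDp : #(p - 1).divisors ≤ D)
    (hD : ∀ n : ℕ, n ≠ 0 → n ≤ (2 * H ^ k) ^ k → #n.divisors ≤ D)
    (hB : #(coprimeQuadsAt k H p s) ≤ B)
    (hK : ∀ x ∈ Icc 1 H, (x : ZMod p) + s ≠ 0 → (orderOf ((x : ZMod p) + s) : ℝ) < K) :
    ((H : ℝ) ^ k) ^ 4 ≤ ((2 * D : ℝ) ^ k) ^ 4 * (16 * K ^ 2 * B) ∨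
      (H : ℝ) ^ k ≤ (2 * D : ℝ) ^ k * (16 * (k * (k * (2 * D : ℝ)) ^ k) * K) := by
  classical
  have hp := Fact.out (p := p.Prime)
  have hp1 : p - 1 ≠ 0 := by have := hp.two_le; omega
  have hD1 : 1 ≤ D := (card_pos.2 ⟨1, Nat.one_mem_divisors.2 hp1⟩).trans_le hDp
  have hDpos : (0 : ℝ) < D := by exact_mod_cast hD1
  have hk4 : 1 ≤ k ^ 4 := Nat.one_le_pow _ _ hk
  have hH2 : 2 ≤ H := by nlinarith
  set A₀ := {x ∈ Icc 1 H | ((x : ℕ) : ZMod p) + s ≠ 0} with hA₀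
  have hzero : #{x ∈ Icc 1 H | ¬ ((x : ℕ) : ZMod p) + s ≠ 0} ≤ 1 := by
    refine card_le_one.2 fun a ha b hb => ?_
    obtain ⟨ha1, ha2⟩ := mem_filter.1 ha
    obtain ⟨hb1, hb2⟩ := mem_filter.1 hb
    have h : (a : ZMod p) = b := add_right_cancel ((not_not.1 ha2).trans (not_not.1 hb2).symm)
    rw [ZMod.natCast_eq_natCast_iff'] at h
    have ha3 := (mem_Icc.1 ha1).2
    have hb3 := (mem_Icc.1 hb1).2
    rwa [Nat.mod_eq_of_lt (by omega), Nat.mod_eq_of_lt (by omega)] at h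
  have hcard : H ≤ 2 * #A₀ := by
    have h1 : #A₀ + #{x ∈ Icc 1 H | ¬ ((x : ℕ) : ZMod p) + s ≠ 0} = #(Icc 1 H) :=
      card_filter_add_card_filter_not _
    rw [Nat.card_Icc] at h1
    omega
  have hmaps : ∀ x ∈ A₀, orderOf ((x : ZMod p) + s) ∈ (p - 1).divisors := fun x hx =>
    Nat.mem_divisors.2 ⟨orderOf_dvd_of_pow_eq_one
      (ZMod.pow_card_sub_one_eq_one (mem_filter.1 hx).2), hp1⟩
  obtain ⟨d, hd, hdA⟩ := exists_le_card_fiber_of_nsmul_le_card_of_maps_to (b := (H / (2 * D) : ℝ))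
    hmaps ⟨1, Nat.one_mem_divisors.2 hp1⟩ (by
      have h1 : (#(p - 1).divisors : ℝ) ≤ D := by exact_mod_cast hDp
      have h2 : (H : ℝ) ≤ 2 * #A₀ := by exact_mod_cast hcard
      rw [nsmul_eq_mul]
      calc (#(p - 1).divisors : ℝ) * (H / (2 * D)) ≤ D * (H / (2 * D)) := by gcongr
        _ = H / 2 := by field_simp
        _ ≤ _ := by linarith)
  set A := {x ∈ A₀ | orderOf (((x : ℕ) : ZMod p) + s) = d} with hA
  have hd0 : 0 < d := Nat.pos_of_mem_divisors hd
  have hHA : (H : ℝ) ≤ 2 * D * #A := by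
    rw [div_le_iff₀ (by positivity)] at hdA
    linarith
  have hAk : 64 * k ^ 4 ≤ #A := by
    have h1 : H ≤ 2 * D * #A := by exact_mod_cast hHA
    by_contra! h2
    have h3 : 2 * D * (#A + 1) ≤ 2 * D * (64 * k ^ 4) := Nat.mul_le_mul_left _ h2
    nlinarith
  obtain ⟨a, ha⟩ : A.Nonempty := card_pos.1 (by omega)
  have hdK : (d : ℝ) < K := by
    obtain ⟨h1, h2⟩ := mem_filter.1 ha
    obtain ⟨h3, h4⟩ := mem_filter.1 h1
    exact h2 ▸ hK a h3 h4
  have hHk : (H : ℝ) ^ k ≤ (2 * D : ℝ) ^ k * #A ^ k := by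
    rw [← mul_pow]; gcongr
  have key := card_pow_le_of_prod_mem (A := A) (d := d) (s := s) hk
    ((filter_subset _ _).trans (filter_subset _ _)) hd0
    (fun a ha => (mem_filter.1 ha).2) hAk hD1 hD hB
  refine key.imp (fun h => ?_) (fun h => ?_)
  · have h1 : ((#A : ℝ) ^ k) ^ 4 ≤ 16 * d ^ 2 * B := by exact_mod_cast h
    calc ((H : ℝ) ^ k) ^ 4 ≤ ((2 * D : ℝ) ^ k * #A ^ k) ^ 4 := by gcongr
      _ = ((2 * D : ℝ) ^ k) ^ 4 * ((#A : ℝ) ^ k) ^ 4 := mul_pow _ _ _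
      _ ≤ ((2 * D : ℝ) ^ k) ^ 4 * (16 * d ^ 2 * B) := by gcongr
      _ ≤ _ := by gcongr
  · have h1 : (#A : ℝ) ^ k ≤ 16 * (k * (k * (2 * D : ℝ)) ^ k) * d := by exact_mod_cast h
    calc (H : ℝ) ^ k ≤ (2 * D : ℝ) ^ k * #A ^ k := hHk
      _ ≤ (2 * D : ℝ) ^ k * (16 * (k * (k * (2 * D : ℝ)) ^ k) * d) := by gcongr
      _ ≤ _ := by gcongr

lemma energy_bound_false {k c e : ℕ} {L h T H D B K : ℝ} (hk : 1 ≤ k) (hL : 16 ≤ L)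
    (hkL : (k : ℝ) ≤ L) (hD0 : 0 ≤ D) (hD : D ≤ L ^ c) (hT : 0 < T) (h0 : 0 ≤ h) (hH : 0 < H)
    (hhH : h ≤ 4 * L * H) (hhT : 1 ≤ h * T) (hhk : h * T ≤ (h ^ k) ^ 2)
    (hB0 : 0 ≤ B) (hB : B ≤ H ^ (4 * k - 1) * L ^ e / T + 1)
    (hK0 : 0 ≤ K) (hK : L ^ (4 * k * (c + 3) + e + 5) * K ^ 2 ≤ h * T)
    (hor : (H ^ k) ^ 4 ≤ ((2 * D) ^ k) ^ 4 * (16 * K ^ 2 * B) ∨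
      H ^ k ≤ (2 * D) ^ k * (16 * (k * (k * (2 * D)) ^ k) * K)) : False := by
  have hL0 : 0 < L := by linarith
  have hL1 : 1 ≤ L := by linarith
  have hmain : ∀ a : ℕ, a + 1 ≤ 4 * k * (c + 3) + e + 5 → h * T ≤ L ^ a * K ^ 2 → False := by
    intro a ha h1
    have h2 : L ^ (a + 1) * K ^ 2 ≤ h * T :=
      le_trans (mul_le_mul_of_nonneg_right (pow_le_pow_right₀ hL1 ha) (sq_nonneg K)) hK
    rw [pow_succ] at h2
    nlinarith
  have h2D : 2 * D ≤ L ^ (c + 1) := by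
    rw [pow_succ]
    nlinarith [pow_pos hL0 c]
  have hhL : h ≤ L ^ 2 * H := hhH.trans (by gcongr; nlinarith)
  have hhLk : h ^ k ≤ L ^ (2 * k) * H ^ k := by
    rw [pow_mul, ← mul_pow]; gcongr
  have h2Dk : (2 * D) ^ k ≤ L ^ ((c + 1) * k) := by
    rw [pow_mul]; gcongr
  rcases hor with hor | hor
  · have h1 : (H ^ k) ^ 4 ≤ L ^ (4 * k * (c + 1) + 1) * K ^ 2 * B :=
      calc (H ^ k) ^ 4 ≤ ((2 * D) ^ k) ^ 4 * (16 * K ^ 2 * B) := hor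
        _ ≤ (L ^ ((c + 1) * k)) ^ 4 * (L * K ^ 2 * B) := by gcongr
        _ = _ := by ring
    rcases le_total (H ^ (4 * k - 1) * L ^ e / T) 1 with hcase | hcase
    · have hB2 : B ≤ L := by linarith
      refine hmain (4 * k * (c + 1) + 2 + 8 * k) (by nlinarith) ?_
      calc h * T ≤ (h * T) ^ 2 := by nlinarith
        _ ≤ ((h ^ k) ^ 2) ^ 2 := by gcongr
        _ = (h ^ k) ^ 4 := by ring
        _ ≤ (L ^ (2 * k) * H ^ k) ^ 4 := by gcongr
        _ = L ^ (8 * k) * (H ^ k) ^ 4 := by ring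
        _ ≤ L ^ (8 * k) * (L ^ (4 * k * (c + 1) + 1) * K ^ 2 * B) := by gcongr
        _ ≤ L ^ (8 * k) * (L ^ (4 * k * (c + 1) + 1) * K ^ 2 * L) := by gcongr
        _ = _ := by ring
    · have hB2 : B ≤ L * (H ^ (4 * k - 1) * L ^ e / T) := by nlinarith
      have h2 : H ^ (4 * k - 1) * H = (H ^ k) ^ 4 := by
        rw [← pow_succ, ← pow_mul]; congr 1; omega
      have h3 : H ^ (4 * k - 1) * (H * T) ≤
          H ^ (4 * k - 1) * (L ^ (4 * k * (c + 1) + 2 + e) * K ^ 2) :=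
        calc H ^ (4 * k - 1) * (H * T) = (H ^ k) ^ 4 * T := by rw [← h2]; ring
          _ ≤ L ^ (4 * k * (c + 1) + 1) * K ^ 2 * (L * (H ^ (4 * k - 1) * L ^ e / T)) * T := by
            gcongr
            exact h1.trans (by gcongr)
          _ = _ := by field_simp; ring
      have h4 := le_of_mul_le_mul_left h3 (by positivity)
      refine hmain (4 * k * (c + 1) + 4 + e) (by nlinarith) ?_
      calc h * T ≤ L ^ 2 * H * T := by gcongr
        _ = L ^ 2 * (H * T) := by ring
        _ ≤ L ^ 2 * (L ^ (4 * k * (c + 1) + 2 + e) * K ^ 2) := by gcongr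
        _ = _ := by ring
  · have h1 : H ^ k ≤ L ^ ((c + 1) * k + 2 + (c + 2) * k) * K :=
      calc H ^ k ≤ (2 * D) ^ k * (16 * (k * (k * (2 * D)) ^ k) * K) := hor
        _ ≤ L ^ ((c + 1) * k) * (L * (L * (L * L ^ (c + 1)) ^ k) * K) := by gcongr
        _ = _ := by ring
    refine hmain (2 * (2 * k + ((c + 1) * k + 2 + (c + 2) * k))) (by nlinarith) ?_
    calc h * T ≤ (h ^ k) ^ 2 := hhk
      _ ≤ (L ^ (2 * k) * (L ^ ((c + 1) * k + 2 + (c + 2) * k) * K)) ^ 2 := by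
        gcongr
        exact hhLk.trans (by gcongr)
      _ = _ := by ring

/-- The threshold for the number of coprime quadruples above which a prime is exceptional. -/
noncomputable def quadThreshold (k e : ℕ) (L T : ℝ) (H : ℕ) : ℕ :=
  ⌈(H : ℝ) ^ (4 * k - 1) * L ^ e / T⌉₊

/-- An exponent `m` such that all integers whose divisors are counted are at most `T ^ m`. -/
def divisorExponent (k : ℕ) : ℕ := 2 * k ^ 2 + k ^ 2 + k + 1

lemma two_mul_pow_pow_le {k H : ℕ} {T : ℝ} (hT : 2 ≤ T) (hH : (H : ℝ) ≤ T) :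
    (((2 * H ^ k) ^ k : ℕ) : ℝ) ≤ T ^ divisorExponent k := by
  push_cast
  calc (2 * (H : ℝ) ^ k) ^ k ≤ (T * T ^ k) ^ k := by gcongr
    _ = T ^ (k ^ 2 + k) := by ring
    _ ≤ _ := pow_le_pow_right₀ (by linarith) (by unfold divisorExponent; omega)

lemma factorial_mul_pow_le {k H : ℕ} {T : ℝ} (hT : 1 ≤ T) (hH : 2 * (H : ℝ) + 1 ≤ T)
    (hk : ((2 * k).factorial : ℝ) ≤ T) :
    (((2 * k).factorial * ((2 * H + 1) ^ k) ^ (2 * k) : ℕ) : ℝ) ≤ T ^ divisorExponent k := by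
  push_cast
  calc ((2 * k).factorial : ℝ) * ((2 * (H : ℝ) + 1) ^ k) ^ (2 * k) ≤ T * (T ^ k) ^ (2 * k) := by
        gcongr
    _ = T ^ (2 * k ^ 2 + 1) := by ring
    _ ≤ _ := pow_le_pow_right₀ hT (by unfold divisorExponent; omega)

lemma divisorScale_pow_mul_exp_le_one {α T h : ℝ} {M : ℕ} (hα : 0 < α) (hT0 : 0 < T)
    (hαT : 1 < α * Real.log T) (h1 : T ^ α ≤ h) (h2 : h < T) :
    divisorScale T ^ M * Real.exp (-(M / α * Real.log h / Real.log (Real.log h))) ≤ 1 := by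
  have hα' : α * Real.log T ≤ Real.log h := by
    rw [← Real.log_rpow hT0]
    exact Real.log_le_log (Real.rpow_pos_of_pos hT0 _) h1
  have hh0 : 0 < h := (Real.rpow_pos_of_pos hT0 _).trans_le h1
  have hhT : Real.log h ≤ Real.log T := Real.log_le_log hh0 h2.le
  have hll : 0 < Real.log (Real.log h) := Real.log_pos (hαT.trans_le hα')
  have hll2 : Real.log (Real.log h) ≤ Real.log (Real.log T) :=
    Real.log_le_log (by linarith) hhT
  have key : α * (Real.log T / Real.log (Real.log T)) ≤ Real.log h / Real.log (Real.log h) := by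
    rw [← mul_div_assoc]
    gcongr
    linarith
  rw [divisorScale, ← Real.exp_nat_mul, ← Real.exp_add, Real.exp_le_one_iff]
  have h3 : (M : ℝ) * (Real.log T / Real.log (Real.log T)) =
      M / α * (α * (Real.log T / Real.log (Real.log T))) := by field_simp
  have h4 : (M : ℝ) / α * (α * (Real.log T / Real.log (Real.log T))) ≤
      M / α * (Real.log h / Real.log (Real.log h)) := by gcongr
  rw [h3, mul_div_assoc]
  linarith

lemma exists_large_orderOf {k c e h p : ℕ} [Fact p.Prime] {α T : ℝ} {s : ZMod p} (hk : 1 ≤ k)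
    (hα : 0 < α) (hαk : 1 ≤ α * (2 * k - 1)) (hL : 16 ≤ divisorScale T)
    (hkL : (k : ℝ) ≤ divisorScale T) (hLT : divisorScale T ^ (c + 8) ≤ T ^ α)
    (hT : 2 ≤ T) (hαT : 1 < α * Real.log T)
    (hdiv : ∀ n : ℕ, n ≠ 0 → (n : ℝ) ≤ T ^ divisorExponent k →
      (#n.divisors : ℝ) ≤ divisorScale T ^ c)
    (hpT : (p : ℝ) ≤ T) (hTp : T / divisorScale T < p)
    (hgood : ∀ j : ℕ, 2 * (2 : ℝ) ^ j ≤ T / divisorScale T →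
      #(coprimeQuadsAt k (2 ^ j) p s) ≤ quadThreshold k e (divisorScale T) T (2 ^ j))
    (h1 : T ^ α ≤ h) (h2 : (h : ℝ) < T) :
    ∃ x : ℕ, 1 ≤ x ∧ x ≤ h ∧ ((x : ZMod p) + s) ≠ 0 ∧
      (orderOf ((x : ZMod p) + s) : ℝ) ≥ ((h : ℝ) * T) ^ ((1 : ℝ) / 2) *
        Real.exp (-((4 * k * (c + 3) + e + 5 : ℕ) / α * Real.log h /
          Real.log (Real.log h))) := by
  by_contra! hcon
  set L := divisorScale T with hLdef
  have hL0 : 0 < L := by linarith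
  have hh0 : 0 < (h : ℝ) := lt_of_lt_of_le (Real.rpow_pos_of_pos (by linarith) _) h1
  have hLh : L ^ (c + 8) ≤ h := hLT.trans h1
  have h2L : 1 ≤ (h : ℝ) / (2 * L) := by
    rw [le_div_iff₀ (by positivity)]
    have : L ^ 2 ≤ L ^ (c + 8) := pow_le_pow_right₀ (by linarith) (by omega)
    nlinarith
  obtain ⟨j, hj1, hj2⟩ := exists_nat_pow_near h2L (by norm_num : (1 : ℝ) < 2)
  rw [le_div_iff₀ (by positivity)] at hj1
  rw [div_lt_iff₀ (by positivity), pow_succ] at hj2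
  have hj3 : 2 * (2 : ℝ) ^ j ≤ T / L := by
    rw [le_div_iff₀ hL0]; linarith
  have hcast : ((2 ^ j : ℕ) : ℝ) = 2 ^ j := by push_cast; rfl
  have hj0 : (0 : ℝ) < 2 ^ j := by positivity
  have hjh : (2 : ℝ) ^ j ≤ h := by nlinarith
  have hHp : 2 ^ j < p := by
    have : ((2 ^ j : ℕ) : ℝ) < p := by rw [hcast]; linarith
    exact_mod_cast this
  have hDle : (⌊L ^ c⌋₊ : ℝ) ≤ L ^ c := Nat.floor_le (by positivity)
  have hfloor : ∀ n : ℕ, n ≠ 0 → (n : ℝ) ≤ T ^ divisorExponent k → #n.divisors ≤ ⌊L ^ c⌋₊ :=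
    fun n hn hnT => Nat.le_floor (hdiv n hn hnT)
  have hp := Fact.out (p := p.Prime)
  have hTpow : T ≤ T ^ divisorExponent k :=
    le_self_pow₀ (by linarith) (by unfold divisorExponent; omega)
  have hH : 128 * k ^ 4 * ⌊L ^ c⌋₊ ≤ 2 ^ j := by
    have h3 : (128 * k ^ 4 * ⌊L ^ c⌋₊ : ℝ) * (4 * L) ≤ 2 ^ j * (4 * L) :=
      calc (128 * k ^ 4 * ⌊L ^ c⌋₊ : ℝ) * (4 * L) ≤ 128 * L ^ 4 * L ^ c * (4 * L) := by gcongr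
        _ = 512 * L ^ (c + 5) := by ring
        _ ≤ L ^ 3 * L ^ (c + 5) := by
          gcongr
          calc (512 : ℝ) ≤ 16 ^ 3 := by norm_num
            _ ≤ L ^ 3 := by gcongr
        _ = L ^ (c + 8) := by ring
        _ ≤ h := hLh
        _ ≤ _ := by linarith
    have h4 := le_of_mul_le_mul_right h3 (by positivity)
    exact_mod_cast h4
  set K : ℝ := ((h : ℝ) * T) ^ ((1 : ℝ) / 2) *
        Real.exp (-((4 * k * (c + 3) + e + 5 : ℕ) / α * Real.log h /
          Real.log (Real.log h))) with hK
  have hor := pow_le_of_orderOf_lt (K := K) hk hHp hH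
    (hfloor _ (by have := hp.two_le; omega) (by
      refine le_trans ?_ (hpT.trans hTpow)
      exact_mod_cast Nat.sub_le p 1))
    (fun n hn hnH => hfloor n hn ((Nat.cast_le.2 hnH).trans
      (two_mul_pow_pow_le hT (by rw [hcast]; linarith))))
    (hgood j hj3)
    (fun x hx hx0 => hcon x (mem_Icc.1 hx).1 ((mem_Icc.1 hx).2.trans (by exact_mod_cast hjh)) hx0)
  rw [hcast] at hor
  have hT0 : 0 < T := by linarith
  have hexp := divisorScale_pow_mul_exp_le_one (M := 4 * k * (c + 3) + e + 5) hα hT0 hαT h1 h2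
  have hh1 : 1 ≤ (h : ℝ) := (Real.one_le_rpow (by linarith) hα.le).trans h1
  refine energy_bound_false (c := c) (e := e) hk hL hkL (Nat.cast_nonneg _) hDle hT0 hh0.le hj0 (by linarith)
    (by nlinarith) ?_ (Nat.cast_nonneg _) ?_ (by positivity) ?_ hor
  · have h3 : T ≤ (h : ℝ) ^ (2 * k - 1) :=
      calc T = T ^ (1 : ℝ) := (Real.rpow_one T).symm
        _ ≤ T ^ (α * ((2 * k - 1 : ℕ) : ℝ)) := by
          refine Real.rpow_le_rpow_of_exponent_le (by linarith) ?_
          rw [Nat.cast_sub (by omega)]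
          push_cast
          exact hαk
        _ = (T ^ α) ^ (2 * k - 1) := by rw [Real.rpow_mul hT0.le, Real.rpow_natCast]
        _ ≤ _ := by gcongr
    calc (h : ℝ) * T ≤ h * h ^ (2 * k - 1) := by gcongr
      _ = (h ^ k) ^ 2 := by rw [← pow_succ', ← pow_mul]; congr 1; omega
  · rw [quadThreshold, hcast]
    exact (Nat.ceil_lt_add_one (by positivity)).le
  · set E := Real.exp (-((4 * k * (c + 3) + e + 5 : ℕ) / α * Real.log h /
          Real.log (Real.log h))) with hE
    have hE0 : 0 < E := Real.exp_pos _
    have hhT : (((h : ℝ) * T) ^ ((1 : ℝ) / 2)) ^ 2 = h * T := by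
      rw [← Real.sqrt_eq_rpow, Real.sq_sqrt (by positivity)]
    have hLM : 1 ≤ L ^ (4 * k * (c + 3) + e + 5) := one_le_pow₀ (by linarith)
    have hE1 : E ≤ 1 := by nlinarith
    rw [hK, mul_pow, hhT]
    calc L ^ (4 * k * (c + 3) + e + 5) * (h * T * E ^ 2)
        = h * T * (L ^ (4 * k * (c + 3) + e + 5) * E * E) := by ring
      _ ≤ h * T * (1 * 1) := by gcongr
      _ = _ := by ring

open scoped Classical in
/-- The primes `p ≤ T` with a residue class at which many coprime quadruples with entries in
`[1, H]` vanish. -/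
noncomputable def exceptionalPrimes (k e H : ℕ) (L T : ℝ) : Finset ℕ :=
  {p ∈ Icc 1 ⌊T⌋₊ | p.Prime ∧ 2 * H < p ∧
    ∃ s : ZMod p, quadThreshold k e L T H ≤ #(coprimeQuadsAt k H p s)}

lemma card_exceptionalPrimes_le {k c H : ℕ} {L T : ℝ} (hL : 1 ≤ L) (hT : 0 < T)
    (hH : 0 < H) (hkL : 2 ^ (4 * k) * (k : ℝ) ≤ L)
    (hD : ∀ n : ℕ, n ≠ 0 → n ≤ (2 * k).factorial * ((2 * H + 1) ^ k) ^ (2 * k) →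
      (#n.divisors : ℝ) ≤ L ^ c) (hk : 1 ≤ k) :
    (#(exceptionalPrimes k (c + 4) H L T) : ℝ) ≤ T / L ^ 3 := by
  classical
  have hL0 : 0 < L := by linarith
  have hH0 : (0 : ℝ) < H := by exact_mod_cast hH
  have hex : ∀ p : ℕ, ∃ s : ZMod p, p ∈ exceptionalPrimes k (c + 4) H L T →
      quadThreshold k (c + 4) L T H ≤ #(coprimeQuadsAt k H p s) := by
    intro p
    by_cases hp : p ∈ exceptionalPrimes k (c + 4) H L T
    · obtain ⟨s, hs⟩ := (mem_filter.1 hp).2.2.2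
      exact ⟨s, fun _ => hs⟩
    · exact ⟨0, fun h => absurd h hp⟩
  choose s hs using hex
  have h1 := mul_card_primes_le (D := ⌊L ^ c⌋₊) (exceptionalPrimes k (c + 4) H L T) s
    (fun p hp => ⟨(mem_filter.1 hp).2.1, (mem_filter.1 hp).2.2.1, hs p hp⟩)
    (fun n hn hnH => Nat.le_floor (hD n hn hnH))
  have h2 : (#(exceptionalPrimes k (c + 4) H L T) : ℝ) * (H * quadThreshold k (c + 4) L T H) ≤
      (2 * H) ^ (4 * k) * (⌊L ^ c⌋₊ * k) := by exact_mod_cast h1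
  have h3 : (⌊L ^ c⌋₊ : ℝ) ≤ L ^ c := Nat.floor_le (by positivity)
  have h4 : (H : ℝ) ^ (4 * k - 1) * L ^ (c + 4) / T ≤ quadThreshold k (c + 4) L T H :=
    Nat.le_ceil _
  have h5 : (H : ℝ) * H ^ (4 * k - 1) = H ^ (4 * k) := by
    rw [← pow_succ']; congr 1; omega
  set N : ℝ := (#(exceptionalPrimes k (c + 4) H L T) : ℝ)
  have hN : 0 ≤ N := Nat.cast_nonneg _
  rw [le_div_iff₀ (by positivity)]
  have h6 : (H : ℝ) ^ (4 * k) * L ^ (c + 1) * (N * L ^ 3) ≤ (H : ℝ) ^ (4 * k) * L ^ (c + 1) * T :=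
    calc (H : ℝ) ^ (4 * k) * L ^ (c + 1) * (N * L ^ 3)
        = N * (H * (H ^ (4 * k - 1) * L ^ (c + 4) / T)) * T := by
          rw [← h5]; field_simp; ring
      _ ≤ N * (H * quadThreshold k (c + 4) L T H) * T := by gcongr
      _ ≤ (2 * H) ^ (4 * k) * (⌊L ^ c⌋₊ * k) * T := by gcongr
      _ ≤ (2 * H) ^ (4 * k) * (L ^ c * k) * T := by gcongr
      _ = H ^ (4 * k) * L ^ c * (2 ^ (4 * k) * k) * T := by rw [mul_pow]; ring
      _ ≤ H ^ (4 * k) * L ^ c * L * T := by gcongr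
      _ = _ := by ring
  exact le_of_mul_le_mul_left h6 (by positivity)

lemma ncard_primes_le_eq (T : ℝ) (hT : 0 ≤ T) :
    Set.ncard {p : ℕ | p.Prime ∧ (p : ℝ) ≤ T} = Nat.primeCounting ⌊T⌋₊ := by
  have h : {p : ℕ | p.Prime ∧ (p : ℝ) ≤ T} = (Nat.primesLE ⌊T⌋₊ : Set ℕ) := by
    ext p
    simp [Nat.mem_primesLE, Nat.le_floor_iff hT, and_comm]
  rw [h, Set.ncard_coe_finset, Nat.primesLE_card_eq_primeCounting]

open scoped Classical in
/-- The small primes together with the exceptional primes at all dyadic scales. -/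
noncomputable def badPrimes (k e : ℕ) (L T : ℝ) : Finset ℕ :=
  Icc 1 ⌊T / L⌋₊ ∪ {j ∈ range (⌊2 * Real.log T⌋₊ + 1) | 2 * (2 : ℝ) ^ j ≤ T / L}.biUnion
    fun j => exceptionalPrimes k e (2 ^ j) L T

lemma card_badPrimes_le {k c : ℕ} {L T : ℝ} (hk : 1 ≤ k) (hL : 16 ≤ L) (hT : 2 ≤ T)
    (hlog : 2 * Real.log T + 1 ≤ L) (hkL : 2 ^ (4 * k) * (k : ℝ) ≤ L)
    (hkT : ((2 * k).factorial : ℝ) ≤ T)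
    (hdiv : ∀ n : ℕ, n ≠ 0 → (n : ℝ) ≤ T ^ divisorExponent k → (#n.divisors : ℝ) ≤ L ^ c) :
    (#(badPrimes k (c + 4) L T) : ℝ) ≤ 2 * (T / L) := by
  classical
  have hL0 : 0 < L := by linarith
  have hlog0 : 0 ≤ Real.log T := Real.log_nonneg (by linarith)
  have hTL : T / L ≤ T / 16 := by gcongr
  have hsmall : (#(Icc 1 ⌊T / L⌋₊) : ℝ) ≤ T / L := by
    rw [Nat.card_Icc, Nat.add_sub_cancel]
    exact Nat.floor_le (by positivity)
  have hbig : (#({j ∈ range (⌊2 * Real.log T⌋₊ + 1) | 2 * (2 : ℝ) ^ j ≤ T / L}.biUnion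
      fun j => exceptionalPrimes k (c + 4) (2 ^ j) L T) : ℝ) ≤ T / L := by
    calc _ ≤ ∑ j ∈ range (⌊2 * Real.log T⌋₊ + 1) with 2 * (2 : ℝ) ^ j ≤ T / L,
          (#(exceptionalPrimes k (c + 4) (2 ^ j) L T) : ℝ) := by
          exact_mod_cast card_biUnion_le
      _ ≤ ∑ j ∈ range (⌊2 * Real.log T⌋₊ + 1) with 2 * (2 : ℝ) ^ j ≤ T / L, T / L ^ 3 := by
          refine sum_le_sum fun j hj => card_exceptionalPrimes_le (by linarith) (by linarith)
            (by positivity) hkL (fun n hn hnH => hdiv n hn ((Nat.cast_le.2 hnH).trans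
              (factorial_mul_pow_le (by linarith) ?_ hkT))) hk
          have := (mem_filter.1 hj).2
          push_cast
          linarith
      _ = #{j ∈ range (⌊2 * Real.log T⌋₊ + 1) | 2 * (2 : ℝ) ^ j ≤ T / L} * (T / L ^ 3) := by
          rw [sum_const, nsmul_eq_mul]
      _ ≤ L * (T / L ^ 3) := by
          gcongr
          refine le_trans (Nat.cast_le.2 (card_filter_le _ _)) ?_
          rw [card_range]
          push_cast
          have := Nat.floor_le (by positivity : 0 ≤ 2 * Real.log T)
          linarith
      _ = T / L / L := by field_simp
      _ ≤ T / L := div_le_self (by positivity) (by linarith)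
  have h := card_union_le (Icc 1 ⌊T / L⌋₊)
    ({j ∈ range (⌊2 * Real.log T⌋₊ + 1) | 2 * (2 : ℝ) ^ j ≤ T / L}.biUnion
      fun j => exceptionalPrimes k (c + 4) (2 ^ j) L T)
  refine (Nat.cast_le.2 h).trans ?_
  push_cast
  linarith

lemma quadThreshold_of_notMem_badPrimes {k e p : ℕ} {L T : ℝ} (hp : p.Prime) (hT : 1 ≤ T)
    (hL : 1 ≤ L) (hpT : (p : ℝ) ≤ T) (h : p ∉ badPrimes k e L T) :
    T / L < p ∧ ∀ (s : ZMod p) (j : ℕ), 2 * (2 : ℝ) ^ j ≤ T / L →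
      #(coprimeQuadsAt k (2 ^ j) p s) ≤ quadThreshold k e L T (2 ^ j) := by
  classical
  rw [badPrimes, mem_union, not_or, mem_biUnion] at h
  obtain ⟨h1, h2⟩ := h
  have hpL : T / L < p := by
    by_contra! h3
    exact h1 (mem_Icc.2 ⟨hp.one_le, Nat.le_floor h3⟩)
  refine ⟨hpL, fun s j hj => ?_⟩
  by_contra! h3
  refine h2 ⟨j, mem_filter.2 ⟨mem_range.2 (Nat.lt_succ_of_le (Nat.le_floor ?_)), hj⟩,
    mem_filter.2 ⟨mem_Icc.2 ⟨hp.one_le, Nat.le_floor hpT⟩, hp, ?_, s, h3.le⟩⟩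
  · have h4 : (2 : ℝ) ^ j ≤ T := by
      have h5 : T / L ≤ T := div_le_self (by linarith) hL
      have : (0 : ℝ) < 2 ^ j := by positivity
      linarith
    have h5 := Real.log_le_log (by positivity) h4
    rw [Real.log_pow] at h5
    nlinarith [Real.log_two_gt_d9, (Nat.cast_nonneg j : (0 : ℝ) ≤ j)]
  · have : ((2 * 2 ^ j : ℕ) : ℝ) < p := by push_cast; linarith
    exact_mod_cast this

end OrderShifts

/-- For fixed `α > 0` there is `C > 0` such that for every `ε > 0` there is `T₀`
so that for every `T ≥ T₀`, for all but at most `ε·π(T)` primes `p ≤ T`: for every integer `h`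
with `T^α ≤ h < T` and every `s ∈ 𝔽_p`, there is `1 ≤ x ≤ h` with `x + s ≠ 0` in `𝔽_p` and
`ord_p(x+s) ≥ (hT)^{1/2} exp(−C log h / log log h)`. -/
theorem stmt11 (α : ℝ) (hα : 0 < α) :
    ∃ C : ℝ, 0 < C ∧ ∀ ε : ℝ, 0 < ε → ∃ T₀ : ℝ, ∀ T : ℝ, T₀ ≤ T →
      (Set.ncard {p : ℕ | p.Prime ∧ (p : ℝ) ≤ T ∧
        ¬ (∀ h : ℕ, T ^ α ≤ (h : ℝ) → (h : ℝ) < T → ∀ s : ZMod p,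
            ∃ x : ℕ, 1 ≤ x ∧ x ≤ h ∧ ((x : ZMod p) + s) ≠ 0 ∧
              (orderOf ((x : ZMod p) + s) : ℝ) ≥
                ((h : ℝ) * T) ^ ((1 : ℝ) / 2) *
                  Real.exp (-(C * Real.log h / Real.log (Real.log h))))} : ℝ)
      ≤ ε * (Set.ncard {p : ℕ | p.Prime ∧ (p : ℝ) ≤ T} : ℝ) := by
  set k : ℕ := ⌈1 / α⌉₊ + 1 with hkdef
  set c : ℕ := 2 * divisorExponent k + 1
  have hk : 1 ≤ k := by omega
  have hαk : 1 ≤ α * (2 * k - 1) := by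
    have h1 : 1 / α ≤ ⌈1 / α⌉₊ := Nat.le_ceil _
    have h2 : 1 / α ≤ 2 * k - 1 := by
      rw [hkdef]
      push_cast
      have : 0 ≤ 1 / α := by positivity
      linarith
    rwa [div_le_iff₀' hα] at h2
  refine ⟨(4 * k * (c + 3) + (c + 4) + 5 : ℕ) / α, by positivity, fun ε hε => ?_⟩
  have hlim := tendsto_divisorScale
  obtain ⟨T₀, hT₀⟩ := Filter.eventually_atTop.1 <|
    (hlim.eventually_ge_atTop 16).and <| (hlim.eventually_ge_atTop k).and <|
    (hlim.eventually_ge_atTop (2 ^ (4 * k) * (k : ℝ))).and <|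
    (divisorScale_pow_le_rpow (c + 8) hα).and <|
    (card_divisors_le_divisorScale (divisorExponent k)).and <|
    (log_pow_le_divisorScale 2).and <|
    div_log_le_primeCounting.and <|
    (Real.tendsto_log_atTop.eventually_gt_atTop (1 / α)).and <|
    (Real.tendsto_log_atTop.eventually_ge_atTop (8 / ε)).and <|
    (Real.tendsto_log_atTop.eventually_ge_atTop 3).and <|
    (Filter.eventually_ge_atTop ((2 * k).factorial : ℝ)).and (Filter.eventually_ge_atTop 2)
  refine ⟨T₀, fun T hT => ?_⟩
  obtain ⟨hL, hkL, hkL', hLT, hdiv, hlogL, hpi, hαT, hεT, hlog, hkT, hT2⟩ := hT₀ T hT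
  rw [div_lt_iff₀' hα] at hαT
  rw [div_le_iff₀' hε] at hεT
  have hL0 := divisorScale_pos T
  rw [ncard_primes_le_eq T (by linarith)]
  calc _ ≤ ((badPrimes k (c + 4) (divisorScale T) T).card : ℝ) := by
        rw [← Set.ncard_coe_finset]
        refine Nat.cast_le.2 (Set.ncard_le_ncard ?_ (Finset.finite_toSet _))
        rintro p ⟨hp, hpT, hbad⟩
        by_contra hmem
        have := Fact.mk hp
        obtain ⟨hTp, hgood⟩ := quadThreshold_of_notMem_badPrimes (L := divisorScale T) hp (by linarith) (by linarith)
          hpT (by simpa using hmem)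
        exact hbad fun h h1 h2 s => exists_large_orderOf hk hα hαk hL hkL hLT hT2 hαT
          hdiv hpT hTp (hgood s) h1 h2
    _ ≤ 2 * (T / divisorScale T) :=
        card_badPrimes_le hk hL hT2 (by nlinarith) hkL' hkT hdiv
    _ ≤ ε * (T / (4 * Real.log T)) := by
        have h1 : 8 * Real.log T ≤ ε * divisorScale T := by nlinarith
        have hlog0 : 0 < Real.log T := by linarith
        rw [← mul_div_assoc, ← mul_div_assoc, div_le_div_iff₀ hL0 (by positivity)]
        nlinarith
    _ ≤ _ := by gcongr
end

section
/- There is an absolute constant c > 0 such that for every integer m ≥ 2 and every positive integer a, there exists a set S of integers contained in the interval [a, a+m) with #S ≥ c·√m/log m whose elements are multiplicatively independent, i.e., whenever (n_x)_{x∈S} are integers with ∏_{x∈S} x^{n_x} = 1 (as rational numbers), then n_x = 0 for all x ∈ S. -/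
open Finset in
/-- An interval of `N` consecutive integers contains at most `N / r + 1` multiples of `r`. -/
theorem card_filter_dvd_Ico_le (b : ℤ) (N : ℕ) {r : ℕ} (hr : 0 < r) :
    (#{x ∈ Ico b (b + N) | (r : ℤ) ∣ x} : ℚ) ≤ N / r + 1 := by
  have h := Int.Ico_filter_dvd_card b (b + N) (r := (r : ℤ)) (by exact_mod_cast hr)
  have h' : ((#{x ∈ Ico b (b + N) | (r : ℤ) ∣ x} : ℤ) : ℚ) ≤ N / r + 1 := by
    rw [h, Int.cast_max]
    have h₁ := Int.ceil_lt_add_one (((b + N : ℤ) : ℚ) / ((r : ℤ) : ℚ))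
    have h₂ := Int.le_ceil ((b : ℚ) / ((r : ℤ) : ℚ))
    push_cast [add_div] at h₁ h₂ ⊢
    exact max_le (by linarith) (by positivity)
  exact_mod_cast h'

open Finset in
/-- If `P` is a set of at most `k` primes exceeding `8 * k`, where `9 * k ≤ N` and `N² ≤ m`, then
every `p ∈ P` with `p ≤ N` has a multiple in `[a, a + m)` that is divisible by no other element
of `P`. -/
theorem exists_multiple_not_dvd {a m N k p : ℕ} (hN : 0 < N) (hNm : N * N ≤ m) (hk : 9 * k ≤ N)
    {P : Finset ℕ} (hP : ∀ q ∈ P, q.Prime ∧ 8 * k < q) (hcard : #P ≤ k) (hp : p ∈ P)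
    (hpN : p ≤ N) :
    ∃ x : ℤ, (a : ℤ) ≤ x ∧ x < a + m ∧ (p : ℤ) ∣ x ∧ ∀ q ∈ P, q ≠ p → ¬ (q : ℤ) ∣ x := by
  have hp0 : 0 < p := (hP p hp).1.pos
  have hk0 : 0 < k := (card_pos.2 ⟨p, hp⟩).trans_le hcard
  obtain ⟨b, hb₁, hb₂⟩ : ∃ b : ℤ, (a : ℤ) ≤ p * b ∧ p * b < a + p := by
    refine ⟨((a + p - 1 : ℤ) / p), ?_, ?_⟩
    · have := Int.lt_mul_ediv_self_add (x := (a + p - 1 : ℤ)) (k := p) (by exact_mod_cast hp0)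
      linarith
    · have := Int.mul_ediv_self_le (x := (a + p - 1 : ℤ)) (k := p) (by exact_mod_cast hp0.ne')
      linarith
  obtain ⟨t, ht, htP⟩ : ∃ t ∈ Ico b (b + N),
      t ∉ P.biUnion fun q ↦ {x ∈ Ico b (b + N) | (q : ℤ) ∣ x} := by
    refine exists_mem_notMem_of_card_lt_card ?_
    have hle : (#(P.biUnion fun q ↦ {x ∈ Ico b (b + N) | (q : ℤ) ∣ x}) : ℚ) ≤
        ∑ _q ∈ P, ((N : ℚ) / (8 * k) + 1) := by
      refine (Nat.cast_le.2 card_biUnion_le).trans ?_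
      rw [Nat.cast_sum]
      refine sum_le_sum fun q hq ↦ (card_filter_dvd_Ico_le b N (hP q hq).1.pos).trans ?_
      have : (8 * k : ℚ) ≤ q := by exact_mod_cast (hP q hq).2.le
      gcongr
    have hsum : ∑ _q ∈ P, ((N : ℚ) / (8 * k) + 1) ≤ N / 8 + k := by
      rw [sum_const, nsmul_eq_mul]
      calc (#P : ℚ) * (N / (8 * k) + 1) ≤ k * (N / (8 * k) + 1) := by gcongr
        _ = N / 8 + k := by field_simp
    have hk' : (9 * k : ℚ) ≤ N := by exact_mod_cast hk
    have hN' : (0 : ℚ) < N := by exact_mod_cast hN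
    have : (#(P.biUnion fun q ↦ {x ∈ Ico b (b + N) | (q : ℤ) ∣ x}) : ℚ) < N := by linarith
    simpa using (by exact_mod_cast this :
      #(P.biUnion fun q ↦ {x ∈ Ico b (b + N) | (q : ℤ) ∣ x}) < N)
  have ht' := mem_Ico.1 ht
  refine ⟨p * t, ?_, ?_, dvd_mul_right _ _, fun q hq hqp hdvd ↦ ?_⟩
  · nlinarith
  · have h₁ : (p : ℤ) * t ≤ p * (b + N - 1) := by
      gcongr
      linarith
    have h₂ : (p : ℤ) * N ≤ m := by exact_mod_cast (Nat.mul_le_mul_right N hpN).trans hNm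
    linarith
  · rcases (Nat.prime_iff_prime_int.1 (hP q hq).1).dvd_or_dvd hdvd with h | h
    · exact hqp ((Nat.prime_dvd_prime_iff_eq (hP q hq).1 (hP p hp).1).1 (by exact_mod_cast h))
    · exact htP (mem_biUnion.2 ⟨q, hq, mem_filter.2 ⟨ht, h⟩⟩)

/-- Nonzero integers, each divisible by a prime that divides none of the others, are
multiplicatively independent. -/
theorem eq_zero_of_prod_zpow_eq_one {S : Finset ℤ} (h0 : ∀ x ∈ S, x ≠ 0)
    (hS : ∀ x ∈ S, ∃ q : ℕ, q.Prime ∧ (q : ℤ) ∣ x ∧ ∀ y ∈ S, y ≠ x → ¬ (q : ℤ) ∣ y)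
    {n : ℤ → ℤ} (h : (∏ x ∈ S, (x : ℚ) ^ n x) = 1) : ∀ x ∈ S, n x = 0 := by
  intro x hx
  obtain ⟨q, hq, hqx, hqS⟩ := hS x hx
  have : Fact q.Prime := ⟨hq⟩
  have hval (T : Finset ℤ) (hT : T ⊆ S) :
      padicValRat q (∏ y ∈ T, (y : ℚ) ^ n y) = ∑ y ∈ T, n y * padicValRat q y := by
    induction T using Finset.induction_on with
    | empty => simp
    | insert y T hy ih =>
      have hne : ∀ z ∈ insert y T, (z : ℚ) ^ n z ≠ 0 := fun z hz ↦
        zpow_ne_zero _ (Int.cast_ne_zero.2 (h0 z (hT hz)))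
      rw [Finset.prod_insert hy, Finset.sum_insert hy,
        padicValRat.mul (hne y (Finset.mem_insert_self y T))
          (Finset.prod_ne_zero_iff.2 fun z hz ↦ hne z (Finset.mem_insert_of_mem hz)),
        ih ((Finset.subset_insert y T).trans hT), padicValRat.zpow]
  have hsum := hval S subset_rfl
  rw [h, padicValRat.one, Finset.sum_eq_single_of_mem x hx fun y hy hyx ↦ by
    rw [padicValRat.of_int, padicValInt.eq_zero_of_not_dvd (hqS y hy hyx)]; simp] at hsum
  refine (mul_eq_zero.1 hsum.symm).resolve_right ?_
  rw [padicValRat.of_int]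
  have := (padicValInt_dvd_iff 1 x).1 (by simpa using hqx)
  have := this.resolve_left (h0 x hx)
  exact_mod_cast (by lia)

open Finset in
/-- If there are at least `9 * k` primes up to `N`, then at least `k` of them exceed `8 * k`. -/
theorem exists_primes_gt {N k : ℕ} (hk : 9 * k ≤ Nat.primeCounting N) :
    ∃ P : Finset ℕ, #P = k ∧ ∀ q ∈ P, q.Prime ∧ 8 * k < q ∧ q ≤ N := by
  have hle : k ≤ #(Nat.primesLE N \ Icc 1 (8 * k)) := by
    have h₁ := le_card_sdiff (Icc 1 (8 * k)) (Nat.primesLE N)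
    rw [Nat.primesLE_card_eq_primeCounting, Nat.card_Icc] at h₁
    lia
  obtain ⟨P, hP, hcard⟩ := exists_subset_card_eq hle
  refine ⟨P, hcard, fun q hq ↦ ?_⟩
  have hq' := hP hq
  rw [mem_sdiff, Nat.mem_primesLE, mem_Icc] at hq'
  have := hq'.1.2.pos
  exact ⟨hq'.1.2, by lia, hq'.1.1⟩

theorem succ_sq_le_two_pow {n : ℕ} (hn : 6 ≤ n) : (n + 1) ^ 2 ≤ 2 ^ n := by
  induction n, hn using Nat.le_induction with
  | base => norm_num
  | succ n hn ih =>
    rw [pow_succ 2 n]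
    nlinarith

/-- Chebyshev's lower bound for the number of primes up to `√m`. -/
theorem mul_sqrt_div_log_le_primeCounting_sqrt {m : ℕ} (hm : 36 ≤ m) :
    Real.log 2 / 4 * Real.sqrt m / Real.log m ≤ Nat.primeCounting (Nat.sqrt m) := by
  set N := Nat.sqrt m
  have hN : 6 ≤ N := Nat.le_sqrt.2 (by lia)
  have hN' : (6 : ℝ) ≤ N := by exact_mod_cast hN
  have hpow := succ_sq_le_two_pow hN
  have hlog : 2 * Real.log (N + 1) ≤ N * Real.log 2 := by
    have := Real.log_le_log (by positivity) (by exact_mod_cast hpow : ((N : ℝ) + 1) ^ 2 ≤ 2 ^ N)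
    simpa using this
  have hsqrt : Real.sqrt m ≤ 2 * N := by
    have := Real.real_sqrt_le_nat_sqrt_succ (a := m)
    linarith
  have hNm : (N : ℝ) ≤ m := by exact_mod_cast Nat.sqrt_le_self m
  have hlogN : 0 < Real.log N := Real.log_pos (by linarith)
  have hlog2 : 0 < Real.log 2 := Real.log_pos (by norm_num)
  calc Real.log 2 / 4 * Real.sqrt m / Real.log m
      ≤ Real.log 2 / 4 * (2 * N) / Real.log N := by gcongr
    _ ≤ (N * Real.log 2 - Real.log (N + 1)) / Real.log N := by
        gcongr
        linarith
    _ ≤ _ := Chebyshev.pi_ge N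

/-- There is an absolute `c > 0` such that for every integer `m ≥ 2` and every
positive integer `a` there is a set `S ⊆ [a, a+m)` of integers with `#S ≥ c·√m / log m` whose
elements are multiplicatively independent. -/
theorem stmt12 :
    ∃ c : ℝ, 0 < c ∧ ∀ m : ℕ, 2 ≤ m → ∀ a : ℕ, 1 ≤ a →
      ∃ S : Finset ℤ,
        (∀ x ∈ S, (a : ℤ) ≤ x ∧ x < (a : ℤ) + m) ∧
        (S.card : ℝ) ≥ c * Real.sqrt m / Real.log m ∧
        (∀ n : ℤ → ℤ, (∏ x ∈ S, (x : ℚ) ^ (n x)) = 1 → ∀ x ∈ S, n x = 0) := by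
  have hlog2 : 0 < Real.log 2 := Real.log_pos (by norm_num)
  refine ⟨Real.log 2 / 72, by positivity, fun m hm a ha ↦ ?_⟩
  have hbound (s : ℕ) (hs : 0 < s) (hπ : Nat.primeCounting (Nat.sqrt m) ≤ 18 * s) :
      (s : ℝ) ≥ Real.log 2 / 72 * Real.sqrt m / Real.log m := by
    have hs' : (1 : ℝ) ≤ s := by exact_mod_cast hs
    rcases le_or_gt 36 m with h | h
    · have h₁ := mul_sqrt_div_log_le_primeCounting_sqrt h
      have h₂ : (Nat.primeCounting (Nat.sqrt m) : ℝ) ≤ 18 * s := by exact_mod_cast hπ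
      have h₃ : Real.log 2 / 72 * Real.sqrt m / Real.log m =
        (Real.log 2 / 4 * Real.sqrt m / Real.log m) / 18 := by ring
      linarith
    · have h₁ : Real.sqrt m ≤ 6 := Real.sqrt_le_iff.2
        ⟨by norm_num, by norm_num; exact_mod_cast h.le⟩
      have h₂ : Real.log 2 ≤ Real.log m := Real.log_le_log (by norm_num) (by exact_mod_cast hm)
      calc Real.log 2 / 72 * Real.sqrt m / Real.log m
          ≤ Real.log 2 / 72 * 6 / Real.log 2 := by gcongr
        _ = 1 / 12 := by field_simp; norm_num
        _ ≤ s := by linarith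
  obtain ⟨k, hk⟩ : ∃ k, k = Nat.primeCounting (Nat.sqrt m) / 9 := ⟨_, rfl⟩
  rcases Nat.eq_zero_or_pos k with hk0 | hk0
  · refine ⟨{(a + 1 : ℤ)}, by simp; lia, hbound _ (by simp) (by simp; lia), fun n hn ↦ ?_⟩
    refine eq_zero_of_prod_zpow_eq_one (by simp; lia) ?_ hn
    obtain ⟨q, hq, hqa⟩ := Nat.exists_prime_and_dvd (n := a + 1) (by lia)
    simpa using ⟨q, hq, by exact_mod_cast hqa⟩
  obtain ⟨P, hcard, hP⟩ := exists_primes_gt (N := Nat.sqrt m) (k := k) (by lia)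
  have hπN : Nat.primeCounting (Nat.sqrt m) ≤ Nat.sqrt m := by
    rw [← Nat.primesLE_card_eq_primeCounting, Nat.primesLE_eq_filter_Ioc_zero]
    simpa using Finset.card_filter_le (Finset.Ioc 0 (Nat.sqrt m)) Nat.Prime
  have hex (p : ℕ) (hp : p ∈ P) := exists_multiple_not_dvd (a := a) (N := Nat.sqrt m) (by lia)
    (Nat.sqrt_le m) (by lia) (fun q hq ↦ ⟨(hP q hq).1, (hP q hq).2.1⟩) hcard.le hp (hP p hp).2.2
  choose! f hfa hfm hfdvd hfndvd using hex
  have hinj : Set.InjOn f P := fun p hp q hq hpq ↦ by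
    by_contra hne
    exact hfndvd q hq p hp hne (hpq ▸ hfdvd p hp)
  refine ⟨P.image f, ?_, hbound _ ?_ ?_, fun n hn ↦ eq_zero_of_prod_zpow_eq_one ?_ ?_ hn⟩
  · simpa using fun p hp ↦ ⟨hfa p hp, hfm p hp⟩
  · rwa [Finset.card_image_of_injOn hinj, hcard]
  · rw [Finset.card_image_of_injOn hinj, hcard]
    lia
  · simp only [Finset.forall_mem_image]
    intro p hp
    have := hfa p hp
    lia
  · simp only [Finset.forall_mem_image]
    exact fun p hp ↦ ⟨p, (hP p hp).1, hfdvd p hp, fun q hq hne ↦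
      hfndvd q hq p hp fun h ↦ hne (h ▸ rfl)⟩
end
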